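/- Fix a real number u. As x → ∞, (1/x)·#{n : 1 < n ≤ x and Ω(s(n)) − log log x ≤ u·√(log log x)} tends to (1/√(2π)) ∫_{−∞}^{u} e^{−t²/2} dt, where Ω(m) = Σ_{p^k ∥ m} k counts prime factors with multiplicity. That is, the Erdős–Kac theorem for s(n) remains valid when prime factors are counted with multiplicity. -/

import Mathlib

open Filter

namespace ErdosKacS

open Finset
open scoped ComplexConjugate

/-- The additive character `θ ↦ exp (2πiθ)`. -/
noncomputable def ee (θ : ℝ) : ℂ := Complex.exp (2 * Real.pi * Complex.I * θ)

theorem ee_add (a b : ℝ) : ee (a + b) = ee a * ee b := by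
  simp only [ee, ← Complex.exp_add]; push_cast; ring_nf

theorem ee_zero : ee 0 = 1 := by simp [ee]

theorem norm_ee (a : ℝ) : ‖ee a‖ = 1 := by
  have : 2 * (Real.pi : ℂ) * Complex.I * a = ((2 * Real.pi * a : ℝ) : ℂ) * Complex.I := by
    push_cast; ring
  rw [ee, this, Complex.norm_exp_ofReal_mul_I]

theorem conj_ee (a : ℝ) : conj (ee a) = ee (-a) := by
  simp only [ee, ← Complex.exp_conj]
  congr 1
  simp only [map_mul, Complex.conj_ofReal, Complex.conj_I, map_ofNat]
  push_cast; ring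

theorem ee_natCast_mul (n : ℕ) (a : ℝ) : ee (n * a) = ee a ^ n := by
  simp only [ee, ← Complex.exp_nat_mul]
  congr 1; push_cast; ring

theorem ee_eq_one_iff (a : ℝ) : ee a = 1 ↔ ∃ n : ℤ, a = n := by
  rw [ee, Complex.exp_eq_one_iff]
  have hpi : (2 * Real.pi * Complex.I : ℂ) ≠ 0 := by
    simp [Real.pi_ne_zero, Complex.I_ne_zero]
  constructor
  · rintro ⟨n, hn⟩
    refine ⟨n, ?_⟩
    have : (a : ℂ) = n := by
      apply mul_left_cancel₀ hpi; rw [hn]; ring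
    exact_mod_cast this
  · rintro ⟨n, rfl⟩
    exact ⟨n, by push_cast; ring⟩

/-- Geometric sums of a nontrivial `v`-th root of unity are bounded by `v`. -/
theorem norm_geom_sum_le {ω : ℂ} {v : ℕ} (hv : 0 < v) (hω : ω ^ v = 1) (h1 : ω ≠ 1) (N : ℕ) :
    ‖∑ t ∈ range N, ω ^ t‖ ≤ v := by
  have hne : ω - 1 ≠ 0 := sub_ne_zero.mpr h1
  have hmod : ω ^ N = ω ^ (N % v) := by
    conv_lhs => rw [← Nat.div_add_mod N v, pow_add, pow_mul, hω, one_pow, one_mul]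
  have : ∑ t ∈ range N, ω ^ t = ∑ t ∈ range (N % v), ω ^ t := by
    rw [geom_sum_eq h1, geom_sum_eq h1, hmod]
  rw [this]
  have hn : ‖ω‖ = 1 := Complex.norm_eq_one_of_pow_eq_one hω hv.ne'
  calc ‖∑ t ∈ range (N % v), ω ^ t‖ ≤ ∑ t ∈ range (N % v), ‖ω ^ t‖ := norm_sum_le _ _
    _ = (N % v : ℕ) := by simp [hn]
    _ ≤ v := by exact_mod_cast (Nat.mod_lt _ hv).le

/-- Duality form of the large sieve for almost orthogonal unimodular families. -/
theorem large_sieve_of_almost_orthogonal {ι τ : Type*} (I : Finset ι) (T : Finset τ)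
    (E : ι → τ → ℂ) (hE : ∀ i t, ‖E i t‖ = 1) {R B : ℝ} (hB0 : 0 ≤ B) (hR : (#I : ℝ) ≤ R)
    (hB : ∀ i ∈ I, ∀ j ∈ I, i ≠ j → ‖∑ t ∈ T, E i t * conj (E j t)‖ ≤ B) (a : τ → ℂ) :
    ∑ i ∈ I, ‖∑ t ∈ T, a t * E i t‖ ^ 2 ≤ (#T + R * B) * ∑ t ∈ T, ‖a t‖ ^ 2 := by
  classical
  set S : ι → ℂ := fun i => ∑ t ∈ T, a t * E i t with hS
  set V : ℝ := ∑ i ∈ I, ‖S i‖ ^ 2 with hV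
  set A : ℝ := ∑ t ∈ T, ‖a t‖ ^ 2 with hA
  set G : τ → ℂ := fun t => ∑ i ∈ I, conj (S i) * E i t with hG
  have hV0 : 0 ≤ V := sum_nonneg fun _ _ => by positivity
  have hA0 : 0 ≤ A := sum_nonneg fun _ _ => by positivity
  have hR0 : 0 ≤ R := le_trans (Nat.cast_nonneg _) hR
  have h1 : (V : ℂ) = ∑ t ∈ T, a t * G t := by
    have : ∀ i ∈ I, ((‖S i‖ ^ 2 : ℝ) : ℂ) = ∑ t ∈ T, conj (S i) * (a t * E i t) := by
      intro i _
      rw [← mul_sum, ← Complex.normSq_eq_norm_sq, Complex.normSq_eq_conj_mul_self]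
    rw [hV, Complex.ofReal_sum, sum_congr rfl this, sum_comm]
    refine sum_congr rfl fun t _ => ?_
    rw [hG, mul_sum]
    exact sum_congr rfl fun i _ => by ring
  have h2 : V ^ 2 ≤ A * ∑ t ∈ T, ‖G t‖ ^ 2 := by
    have : V ≤ ∑ t ∈ T, ‖a t‖ * ‖G t‖ := by
      calc V = ‖(V : ℂ)‖ := by rw [Complex.norm_real, Real.norm_of_nonneg hV0]
        _ ≤ _ := by rw [h1]; exact (norm_sum_le _ _).trans_eq (by simp)
    calc V ^ 2 ≤ (∑ t ∈ T, ‖a t‖ * ‖G t‖) ^ 2 := by gcongr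
      _ ≤ _ := sum_mul_sq_le_sq_mul_sq _ _ _
  have h3 : ∑ t ∈ T, ‖G t‖ ^ 2 ≤ (#T + R * B) * V := by
    have e1 : ((∑ t ∈ T, ‖G t‖ ^ 2 : ℝ) : ℂ)
        = ∑ i ∈ I, ∑ j ∈ I, conj (S i) * S j * ∑ t ∈ T, E i t * conj (E j t) := by
      have : ∀ t ∈ T, ((‖G t‖ ^ 2 : ℝ) : ℂ)
          = ∑ i ∈ I, ∑ j ∈ I, conj (S i) * S j * (E i t * conj (E j t)) := by
        intro t _
        rw [← Complex.normSq_eq_norm_sq, Complex.normSq_eq_conj_mul_self, mul_comm, hG]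
        simp only [map_sum, map_mul, Complex.conj_conj]
        rw [sum_mul_sum]
        exact sum_congr rfl fun i _ => sum_congr rfl fun j _ => by ring
      rw [Complex.ofReal_sum, sum_congr rfl this, sum_comm]
      refine sum_congr rfl fun i _ => ?_
      rw [sum_comm]
      exact sum_congr rfl fun j _ => by rw [← mul_sum]
    have e2 : ∀ i ∈ I, ∀ j ∈ I, ‖conj (S i) * S j * ∑ t ∈ T, E i t * conj (E j t)‖
        ≤ (if i = j then #T * ‖S i‖ ^ 2 else 0) + ‖S i‖ * ‖S j‖ * B := by
      intro i hi j hj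
      rw [norm_mul, norm_mul, RCLike.norm_conj]
      split_ifs with h
      · subst h
        have : ‖∑ t ∈ T, E i t * conj (E i t)‖ ≤ #T := by
          refine (norm_sum_le _ _).trans ?_
          simp [hE]
        have h' : ‖S i‖ * ‖S i‖ * ‖∑ t ∈ T, E i t * conj (E i t)‖ ≤ ‖S i‖ * ‖S i‖ * #T := by
          gcongr
        have : 0 ≤ ‖S i‖ * ‖S i‖ * B := by positivity
        nlinarith
      · rw [zero_add]
        gcongr
        exact hB i hi j hj h
    have e3 : ∑ t ∈ T, ‖G t‖ ^ 2 ≤ #T * V + B * (∑ i ∈ I, ‖S i‖) ^ 2 := by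
      calc ∑ t ∈ T, ‖G t‖ ^ 2 = ‖((∑ t ∈ T, ‖G t‖ ^ 2 : ℝ) : ℂ)‖ := by
            rw [Complex.norm_real, Real.norm_of_nonneg (sum_nonneg fun _ _ => by positivity)]
        _ ≤ ∑ i ∈ I, ∑ j ∈ I, ((if i = j then #T * ‖S i‖ ^ 2 else 0) + ‖S i‖ * ‖S j‖ * B) := by
            rw [e1]
            refine (norm_sum_le _ _).trans (sum_le_sum fun i hi => ?_)
            exact (norm_sum_le _ _).trans (sum_le_sum fun j hj => e2 i hi j hj)
        _ = _ := by
            simp only [sum_add_distrib]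
            congr 1
            · rw [hV, mul_sum]
              refine sum_congr rfl fun i hi => ?_
              rw [sum_ite_eq]; simp [hi]
            · rw [sq, sum_mul_sum, mul_sum]
              refine sum_congr rfl fun i _ => ?_
              rw [mul_sum]
              exact sum_congr rfl fun j _ => by ring
    have e4 : (∑ i ∈ I, ‖S i‖) ^ 2 ≤ R * V := by
      calc (∑ i ∈ I, ‖S i‖) ^ 2 ≤ #I * V := sq_sum_le_card_mul_sum_sq
        _ ≤ R * V := by gcongr
    nlinarith
  rcases hV0.eq_or_lt with h0 | hpos
  · rw [← h0]; positivity
  · have : V * V ≤ ((#T + R * B) * A) * V := by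
      calc V * V = V ^ 2 := by ring
        _ ≤ A * ∑ t ∈ T, ‖G t‖ ^ 2 := h2
        _ ≤ A * ((#T + R * B) * V) := by gcongr
        _ = _ := by ring
    exact le_of_mul_le_mul_right this hpos

/-- Large sieve for rational points and a finite set contained in an arithmetic progression. -/
theorem large_sieve_ap (I : Finset ℚ) {D N b e : ℕ} {R : ℝ} (hR : (#I : ℝ) ≤ R)
    (hden : ∀ θ ∈ I, θ.den ≤ D)
    (hsep : ∀ θ ∈ I, ∀ θ' ∈ I, θ ≠ θ' → ¬ ∃ n : ℤ, (e : ℚ) * (θ - θ') = n) (he : 0 < e)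
    (Q : Finset ℕ) (hQ : ∀ q ∈ Q, ∃ t < N, q = b + e * t) :
    ∑ θ ∈ I, ‖∑ q ∈ Q, ee (θ * q)‖ ^ 2 ≤ (N + R * D ^ 2) * #Q := by
  classical
  set a : ℕ → ℂ := fun t => if b + e * t ∈ Q then 1 else 0 with ha
  have hQi : Q = ((range N).filter (fun t => b + e * t ∈ Q)).image (fun t => b + e * t) := by
    ext q
    simp only [mem_image, mem_filter, mem_range]
    constructor
    · intro h
      obtain ⟨t, ht, rfl⟩ := hQ q h
      exact ⟨t, ⟨ht, h⟩, rfl⟩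
    · rintro ⟨t, ⟨_, h⟩, rfl⟩; exact h
  have hinj : Set.InjOn (fun t => b + e * t) ((range N).filter (fun t => b + e * t ∈ Q)) := by
    intro s _ t _ hst
    simp only [add_right_inj] at hst
    exact Nat.eq_of_mul_eq_mul_left he hst
  have hsum : ∀ F : ℕ → ℂ, ∑ q ∈ Q, F q = ∑ t ∈ range N, a t * F (b + e * t) := by
    intro F
    conv_lhs => rw [hQi, sum_image hinj, sum_filter]
    exact sum_congr rfl fun t _ => by simp [ha]
  have hcard : ∑ t ∈ range N, ‖a t‖ ^ 2 = #Q := by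
    conv_rhs => rw [hQi, card_image_of_injOn hinj, card_filter]
    push_cast
    exact sum_congr rfl fun t _ => by simp only [ha]; split_ifs <;> simp
  have hE : ∀ (θ : ℚ) (t : ℕ), ‖ee (θ * e * t)‖ = 1 := fun _ _ => norm_ee _
  have key := large_sieve_of_almost_orthogonal I (range N) (fun θ t => ee (θ * e * t)) hE
    (B := (D : ℝ) ^ 2) (by positivity) hR ?_ a
  · rw [hcard, card_range] at key
    refine le_trans (le_of_eq (sum_congr rfl fun θ _ => ?_)) key
    rw [hsum]
    have : ∑ t ∈ range N, a t * ee (θ * ((b + e * t : ℕ) : ℝ))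
        = ee (θ * b) * ∑ t ∈ range N, a t * ee (θ * e * t) := by
      rw [mul_sum]
      refine sum_congr rfl fun t _ => ?_
      have : (θ : ℝ) * ((b + e * t : ℕ) : ℝ) = θ * b + θ * e * t := by push_cast; ring
      rw [this, ee_add]; ring
    rw [this, norm_mul, norm_ee, one_mul]
  · intro θ hθ θ' hθ' hne
    set δ : ℚ := e * (θ - θ') with hδ
    have e1 : ∀ t : ℕ, ee (θ * e * t) * conj (ee (θ' * e * t)) = ee (δ : ℝ) ^ t := by
      intro t
      rw [conj_ee, ← ee_add, ← ee_natCast_mul]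
      congr 1; rw [hδ]; push_cast; ring
    simp only [e1]
    set v := (θ - θ').den with hv
    have hv0 : 0 < v := (θ - θ').den_pos
    have hvD : v ≤ D ^ 2 := by
      have h1 : v ∣ θ.den * θ'.den := Rat.sub_den_dvd _ _
      calc v ≤ θ.den * θ'.den := Nat.le_of_dvd (Nat.mul_pos θ.den_pos θ'.den_pos) h1
        _ ≤ D * D := Nat.mul_le_mul (hden θ hθ) (hden θ' hθ')
        _ = D ^ 2 := by ring
    refine (norm_geom_sum_le hv0 ?_ ?_ N).trans (by exact_mod_cast hvD)
    · rw [← ee_natCast_mul, ee_eq_one_iff]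
      refine ⟨e * (θ - θ').num, ?_⟩
      have : (v : ℚ) * δ = e * (θ - θ').num := by
        rw [hδ, ← Rat.mul_den_eq_num (θ - θ')]; ring
      exact_mod_cast this
    · rw [Ne, ee_eq_one_iff]
      rintro ⟨n, hn⟩
      exact hsep θ hθ θ' hθ' hne ⟨n, by exact_mod_cast hn⟩

/-- Parseval's identity on `ℤ/d`. -/
theorem sum_norm_sq_eq_card_residues (Q : Finset ℕ) {d : ℕ} (hd : 0 < d) :
    ∑ b ∈ range d, ‖∑ q ∈ Q, ee (((b / d : ℚ) : ℝ) * q)‖ ^ 2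
      = d * ∑ h ∈ range d, (#{q ∈ Q | q % d = h} : ℝ) ^ 2 := by
  classical
  have hd' : (d : ℝ) ≠ 0 := by positivity
  have e0 : ∑ h ∈ range d, (#{q ∈ Q | q % d = h} : ℝ) ^ 2
      = ∑ q ∈ Q, ∑ q' ∈ Q, if q % d = q' % d then (1 : ℝ) else 0 := by
    have : ∀ h ∈ range d, (#{q ∈ Q | q % d = h} : ℝ) ^ 2
        = ∑ q ∈ Q, ∑ q' ∈ Q, if q % d = h ∧ q' % d = h then (1 : ℝ) else 0 := by
      intro h _
      rw [card_filter, sq]; push_cast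
      rw [sum_mul_sum]
      refine sum_congr rfl fun q _ => sum_congr rfl fun q' _ => ?_
      by_cases h1 : q % d = h <;> by_cases h2 : q' % d = h <;> simp [h1, h2]
    rw [sum_congr rfl this, sum_comm]
    refine sum_congr rfl fun q _ => ?_
    rw [sum_comm]
    refine sum_congr rfl fun q' _ => ?_
    by_cases h : q % d = q' % d
    · rw [if_pos h, sum_eq_single (q % d)]
      · simp [h]
      · intro b _ hb; rw [if_neg]; exact fun hh => hb hh.1.symm
      · intro hh; exact absurd (mem_range.mpr (Nat.mod_lt _ hd)) hh
    · rw [if_neg h]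
      exact sum_eq_zero fun b _ => if_neg fun hh => h (hh.1.trans hh.2.symm)
  have e1 : ∀ q q' : ℕ, ∑ b ∈ range d, ee (((b / d : ℚ) : ℝ) * q) * conj (ee (((b / d : ℚ) : ℝ) * q'))
      = if q % d = q' % d then (d : ℂ) else 0 := by
    intro q q'
    set δ : ℝ := ((q : ℝ) - q') / d with hδ
    have h1 : ∀ b : ℕ, ee (((b / d : ℚ) : ℝ) * q) * conj (ee (((b / d : ℚ) : ℝ) * q'))
        = ee δ ^ b := by
      intro b
      rw [conj_ee, ← ee_add, ← ee_natCast_mul]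
      congr 1; rw [hδ]; push_cast; field_simp; ring
    simp only [h1]
    have hiff : ee δ = 1 ↔ q % d = q' % d := by
      rw [ee_eq_one_iff, ← Nat.ModEq, Nat.modEq_iff_dvd]
      constructor
      · rintro ⟨n, hn⟩
        refine ⟨-n, ?_⟩
        have : (q : ℝ) - q' = d * n := by rw [← hn, hδ]; field_simp
        have : (q : ℤ) - q' = d * n := by exact_mod_cast this
        linarith
      · rintro ⟨n, hn⟩
        refine ⟨-n, ?_⟩
        have : (q' : ℝ) - q = d * n := by exact_mod_cast hn
        rw [hδ, div_eq_iff hd']; push_cast; linarith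
    split_ifs with h
    · rw [hiff.mpr h]; simp
    · have hne : ee δ ≠ 1 := fun hh => h (hiff.mp hh)
      have hp : ee δ ^ d = 1 := by
        rw [← ee_natCast_mul, ee_eq_one_iff]
        exact ⟨q - q', by rw [hδ]; push_cast; field_simp⟩
      rw [geom_sum_eq hne, hp]; simp
  have e2 : ((∑ b ∈ range d, ‖∑ q ∈ Q, ee (((b / d : ℚ) : ℝ) * q)‖ ^ 2 : ℝ) : ℂ)
      = ((d * ∑ h ∈ range d, (#{q ∈ Q | q % d = h} : ℝ) ^ 2 : ℝ) : ℂ) := by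
    rw [e0, Complex.ofReal_sum]
    have : ∀ b ∈ range d, ((‖∑ q ∈ Q, ee (((b / d : ℚ) : ℝ) * q)‖ ^ 2 : ℝ) : ℂ)
        = ∑ q ∈ Q, ∑ q' ∈ Q, ee (((b / d : ℚ) : ℝ) * q) * conj (ee (((b / d : ℚ) : ℝ) * q')) := by
      intro b _
      rw [← Complex.normSq_eq_norm_sq, Complex.normSq_eq_conj_mul_self, mul_comm, map_sum,
        sum_mul_sum]
    rw [sum_congr rfl this, sum_comm]
    rw [Complex.ofReal_mul, Complex.ofReal_sum, mul_sum]
    refine sum_congr rfl fun q _ => ?_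
    rw [sum_comm, Complex.ofReal_sum, mul_sum]
    refine sum_congr rfl fun q' _ => ?_
    rw [e1]; split_ifs <;> simp
  exact_mod_cast e2

theorem sum_Icc_inv_le (D : ℕ) : ∑ k ∈ Icc 1 D, (1 : ℝ) / k ≤ 1 + Real.log D := by
  have h := harmonic_le_one_add_log D
  rw [harmonic_eq_sum_Icc] at h
  push_cast at h
  simpa [one_div] using h

/-- Mean square distribution in residue classes to moduli without small prime factors. -/
theorem sum_variance_le {D H b : ℕ} {w : ℝ} (hw : 0 < w) (Q : Finset ℕ)
    (hQ : ∀ q ∈ Q, b ≤ q ∧ q < b + H) (hH : D ^ 4 ≤ H) (P : Finset ℕ)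
    (hP : ∀ d ∈ P, 1 ≤ d ∧ d ≤ D ∧ ∀ e, e ∣ d → e ≠ 1 → w ≤ e) :
    ∑ d ∈ P, ∑ h ∈ range d, ((#{q ∈ Q | q % d = h} : ℝ) - #Q / d) ^ 2
      ≤ (1 + Real.log D) * (2 * H) * #Q / w := by
  classical
  set S : ℚ → ℝ := fun θ => ‖∑ q ∈ Q, ee (θ * q)‖ ^ 2 with hS
  have hS0 : ∀ θ, 0 ≤ S θ := fun θ => by positivity
  have e1 : ∀ d ∈ P, ∑ h ∈ range d, ((#{q ∈ Q | q % d = h} : ℝ) - #Q / d) ^ 2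
      = ∑ b ∈ Ico 1 d, (1 / d : ℝ) * S (b / d) := by
    intro d hd
    have hd1 : 0 < d := (hP d hd).1
    have hd' : (d : ℝ) ≠ 0 := by positivity
    have h1 : ∑ h ∈ range d, (#{q ∈ Q | q % d = h} : ℝ) = #Q := by
      have := card_eq_sum_card_fiberwise (f := fun q => q % d) (s := Q) (t := range d)
        (fun q _ => mem_coe.mpr (mem_range.mpr (Nat.mod_lt _ hd1)))
      rw [this]; push_cast; rfl
    have h2 := sum_norm_sq_eq_card_residues Q hd1
    rw [range_eq_Ico, sum_eq_sum_Ico_succ_bot hd1] at h2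
    have h3 : ‖∑ q ∈ Q, ee ((((0 : ℕ) / d : ℚ) : ℝ) * q)‖ ^ 2 = (#Q : ℝ) ^ 2 := by
      simp [ee_zero]
    rw [h3, ← range_eq_Ico] at h2
    rw [← mul_sum]
    have h4 : ∑ b ∈ Ico 1 d, S (b / d) = d * ∑ h ∈ range d, (#{q ∈ Q | q % d = h} : ℝ) ^ 2
        - (#Q : ℝ) ^ 2 := by rw [← h2, zero_add]; simp only [hS]; ring
    rw [h4]
    have h5 : ∀ h ∈ range d, ((#{q ∈ Q | q % d = h} : ℝ) - #Q / d) ^ 2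
        = (#{q ∈ Q | q % d = h} : ℝ) ^ 2 - (2 * #Q / d) * (#{q ∈ Q | q % d = h} : ℝ)
          + (#Q / d : ℝ) ^ 2 := fun h _ => by ring
    rw [sum_congr rfl h5, sum_add_distrib, sum_sub_distrib, ← mul_sum, h1, sum_const, card_range,
      nsmul_eq_mul]
    field_simp; ring
  rw [sum_congr rfl e1]
  set U : Finset (Σ _ : ℕ, ℕ) := P.sigma (fun d => Ico 1 d) with hU
  set g : (Σ _ : ℕ, ℕ) → ℚ := fun x => (x.2 : ℚ) / x.1 with hg
  set I : Finset ℚ := U.image g with hI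
  have hUm : ∀ x ∈ U, x.1 ∈ P ∧ 1 ≤ x.2 ∧ x.2 < x.1 := by
    intro x hx
    simpa [hU] using hx
  have hden : ∀ x ∈ U, (g x).den ∣ x.1 := by
    intro x _
    have := Rat.den_dvd (x.2 : ℤ) (x.1 : ℤ)
    simp only [Int.cast_natCast, Rat.divInt_eq_div] at this
    exact_mod_cast this
  have hg01 : ∀ x ∈ U, 0 < g x ∧ g x < 1 := by
    intro x hx
    obtain ⟨_, h1, h2⟩ := hUm x hx
    have h3 : (0 : ℚ) < x.1 := by exact_mod_cast (by omega : 0 < x.1)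
    have h4 : (0 : ℚ) < x.2 := by exact_mod_cast h1
    exact ⟨div_pos h4 h3, (div_lt_one h3).mpr (by exact_mod_cast h2)⟩
  have e2 : ∑ d ∈ P, ∑ b ∈ Ico 1 d, (1 / d : ℝ) * S (b / d)
      = ∑ θ ∈ I, (∑ x ∈ U with g x = θ, (1 / x.1 : ℝ)) * S θ := by
    have : ∑ d ∈ P, ∑ b ∈ Ico 1 d, (1 / d : ℝ) * S (b / d) = ∑ x ∈ U, (1 / x.1 : ℝ) * S (g x) := by
      rw [hU, sum_sigma]
    rw [this, ← sum_fiberwise_of_maps_to (g := g) (t := I) (fun x hx => mem_image_of_mem g hx)]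
    refine sum_congr rfl fun θ _ => ?_
    rw [sum_mul]
    refine sum_congr rfl fun x hx => ?_
    rw [(mem_filter.mp hx).2]
  have hlog : 0 ≤ 1 + Real.log D := by
    rcases Nat.eq_zero_or_pos D with h | h
    · simp [h]
    · have := Real.log_nonneg (show (1 : ℝ) ≤ D by exact_mod_cast h); linarith
  have e3 : ∀ θ ∈ I, ∑ x ∈ U with g x = θ, (1 / x.1 : ℝ) ≤ (1 + Real.log D) / w := by
    intro θ hθ
    obtain ⟨x₀, hx₀, hx₀θ⟩ := mem_image.mp hθ
    have hdw : w ≤ θ.den := by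
      refine (hP _ (hUm x₀ hx₀).1).2.2 _ (hx₀θ ▸ hden x₀ hx₀) ?_
      intro h1
      obtain ⟨h0, h2⟩ := hx₀θ ▸ hg01 x₀ hx₀
      have h3 : θ = θ.num := by
        conv_lhs => rw [← Rat.num_div_den θ, h1]
        simp
      rw [h3] at h0 h2
      have h0' : 0 < θ.num := by exact_mod_cast h0
      have h2' : θ.num < 1 := by exact_mod_cast h2
      omega
    have hdpos : (0 : ℝ) < θ.den := lt_of_lt_of_le hw hdw
    have hinj : Set.InjOn (fun x : (Σ _ : ℕ, ℕ) => x.1 / θ.den) (U.filter (fun x => g x = θ)) := by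
      intro x hx y hy hxy
      obtain ⟨hxU, hxθ⟩ := mem_filter.mp (mem_coe.mp hx)
      obtain ⟨hyU, hyθ⟩ := mem_filter.mp (mem_coe.mp hy)
      have h1 : x.1 = y.1 := by
        have a1 := Nat.div_mul_cancel (hxθ ▸ hden x hxU)
        have a2 := Nat.div_mul_cancel (hyθ ▸ hden y hyU)
        simp only at hxy
        rw [← a1, ← a2, hxy]
      have hx0 : (x.1 : ℚ) ≠ 0 := by
        have := hUm x hxU; exact_mod_cast (by omega : x.1 ≠ 0)
      have h2 : (x.2 : ℚ) = y.2 := by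
        have a1 : (x.2 : ℚ) / x.1 = y.2 / y.1 := by
          have := hxθ.trans hyθ.symm
          simpa [hg] using this
        rw [← h1] at a1
        exact (div_left_inj' hx0).mp a1
      have h2' : x.2 = y.2 := by exact_mod_cast h2
      cases x; cases y; simp_all
    calc ∑ x ∈ U with g x = θ, (1 / x.1 : ℝ)
        = ∑ x ∈ U with g x = θ, (1 / θ.den : ℝ) * (1 / ((x.1 / θ.den : ℕ) : ℝ)) := by
          refine sum_congr rfl fun x hx => ?_
          obtain ⟨hxU, hxθ⟩ := mem_filter.mp hx
          rw [Nat.cast_div (hxθ ▸ hden x hxU) hdpos.ne']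
          have := hUm x hxU
          have hx0 : (x.1 : ℝ) ≠ 0 := by exact_mod_cast (by omega : x.1 ≠ 0)
          field_simp
      _ = (1 / θ.den : ℝ) * ∑ k ∈ (U.filter (fun x => g x = θ)).image (fun x => x.1 / θ.den),
            (1 / (k : ℝ)) := by rw [sum_image hinj, mul_sum]
      _ ≤ (1 / θ.den : ℝ) * ∑ k ∈ Icc 1 D, (1 / (k : ℝ)) := by
          gcongr
          intro k hk
          obtain ⟨x, hx, rfl⟩ := mem_image.mp hk
          obtain ⟨hxU, hxθ⟩ := mem_filter.mp hx
          have := hUm x hxU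
          rw [mem_Icc]
          refine ⟨Nat.div_pos (Nat.le_of_dvd (by omega) (hxθ ▸ hden x hxU)) θ.den_pos, ?_⟩
          exact (Nat.div_le_self _ _).trans (hP _ this.1).2.1
      _ ≤ (1 / w) * (1 + Real.log D) := by
          gcongr
          exact sum_Icc_inv_le D
      _ = _ := by ring
  have hcard : (#I : ℝ) ≤ (D : ℝ) ^ 2 := by
    have h1 : #I ≤ #U := card_image_le
    have h2 : U ⊆ (Icc 1 D).sigma (fun _ => range D) := by
      intro x hx
      have h3 := hUm x hx
      have h4 := (hP _ h3.1).2.1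
      simp only [mem_sigma, mem_Icc, mem_range]
      omega
    have h3 := card_le_card h2
    have h4 : #((Icc 1 D).sigma (fun _ => range D)) = D * D := by
      rw [card_sigma]; simp
    have : #I ≤ D ^ 2 := by
      calc #I ≤ _ := h1.trans h3
        _ = D ^ 2 := by rw [h4]; ring
    exact_mod_cast this
  have e4 : ∑ θ ∈ I, S θ ≤ (H + (D : ℝ) ^ 2 * D ^ 2) * #Q := by
    refine large_sieve_ap I (b := b) (e := 1) hcard ?_ ?_ one_pos Q ?_
    · intro θ hθ
      obtain ⟨x, hx, rfl⟩ := mem_image.mp hθ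
      have := hUm x hx
      exact (Nat.le_of_dvd (by omega) (hden x hx)).trans (hP _ this.1).2.1
    · intro θ hθ θ' hθ' hne
      obtain ⟨x, hx, rfl⟩ := mem_image.mp hθ
      obtain ⟨y, hy, rfl⟩ := mem_image.mp hθ'
      rintro ⟨n, hn⟩
      obtain ⟨a1, a2⟩ := hg01 x hx
      obtain ⟨a3, a4⟩ := hg01 y hy
      rw [Nat.cast_one, one_mul] at hn
      have h1 : (n : ℚ) < 1 := by linarith
      have h2 : (-1 : ℚ) < n := by linarith
      have h1' : n < 1 := by exact_mod_cast h1
      have h2' : -1 < n := by exact_mod_cast h2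
      have : n = 0 := by omega
      rw [this] at hn
      exact hne (sub_eq_zero.mp (by simpa using hn))
    · intro q hq
      have := hQ q hq
      exact ⟨q - b, by omega, by omega⟩
  rw [e2]
  calc ∑ θ ∈ I, (∑ x ∈ U with g x = θ, (1 / x.1 : ℝ)) * S θ
      ≤ ∑ θ ∈ I, ((1 + Real.log D) / w) * S θ :=
        sum_le_sum fun θ hθ => mul_le_mul_of_nonneg_right (e3 θ hθ) (hS0 θ)
    _ = ((1 + Real.log D) / w) * ∑ θ ∈ I, S θ := by rw [mul_sum]
    _ ≤ ((1 + Real.log D) / w) * ((H + (D : ℝ) ^ 2 * D ^ 2) * #Q) := by gcongr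
    _ ≤ ((1 + Real.log D) / w) * ((H + H) * #Q) := by
        have : (D : ℝ) ^ 2 * D ^ 2 ≤ H := by
          have : (D : ℝ) ^ 4 ≤ H := by exact_mod_cast hH
          calc (D : ℝ) ^ 2 * (D : ℝ) ^ 2 = (D : ℝ) ^ 4 := by ring
            _ ≤ (H : ℝ) := this
        gcongr
    _ = _ := by ring

theorem sum_range_div_eq_sum_divisors (F : ℚ → ℂ) {q : ℕ} (hq : 0 < q) :
    ∑ b ∈ range q, F (b / q) = ∑ d ∈ q.divisors, ∑ b ∈ range d with b.Coprime d, F (b / d) := by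
  have h1 : ∀ b ∈ range q, q / Nat.gcd b q ∈ q.divisors := by
    intro b _
    exact Nat.mem_divisors.mpr ⟨Nat.div_dvd_of_dvd (Nat.gcd_dvd_right b q), hq.ne'⟩
  rw [← sum_fiberwise_of_maps_to h1]
  refine sum_congr rfl fun d hd => ?_
  obtain ⟨k, hk⟩ := Nat.dvd_of_mem_divisors hd
  have hd0 : 0 < d := Nat.pos_of_mem_divisors hd
  have hk0 : 0 < k := by
    rcases Nat.eq_zero_or_pos k with h | h
    · simp [h] at hk; omega
    · exact h
  refine sum_bij' (fun b _ => b / k) (fun b _ => b * k) ?_ ?_ ?_ ?_ ?_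
  · intro b hb
    obtain ⟨hb1, hb2⟩ := mem_filter.mp hb
    have hg0 : 0 < Nat.gcd b q := Nat.gcd_pos_of_pos_right _ hq
    have hg : Nat.gcd b q = k := by
      have h3 : Nat.gcd b q * (q / Nat.gcd b q) = q := Nat.mul_div_cancel' (Nat.gcd_dvd_right b q)
      rw [hb2] at h3
      nth_rewrite 2 [hk] at h3
      rw [mul_comm] at h3
      exact Nat.eq_of_mul_eq_mul_left hd0 h3
    rw [mem_filter, mem_range]
    constructor
    · rw [Nat.div_lt_iff_lt_mul hk0, ← hk]; exact mem_range.mp hb1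
    · rw [← hg, ← hb2]
      exact Nat.coprime_div_gcd_div_gcd hg0
  · intro b hb
    obtain ⟨hb1, hb2⟩ := mem_filter.mp hb
    rw [mem_filter, mem_range]
    refine ⟨by rw [hk]; exact Nat.mul_lt_mul_of_pos_right (mem_range.mp hb1) hk0, ?_⟩
    rw [hk, Nat.gcd_mul_right, Nat.Coprime.gcd_eq_one hb2, one_mul]
    exact Nat.mul_div_cancel _ hk0
  · intro b hb
    obtain ⟨hb1, hb2⟩ := mem_filter.mp hb
    have h3 : Nat.gcd b q * (q / Nat.gcd b q) = q := Nat.mul_div_cancel' (Nat.gcd_dvd_right b q)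
    rw [hb2] at h3
    nth_rewrite 2 [hk] at h3
    rw [mul_comm] at h3
    have hg := Nat.eq_of_mul_eq_mul_left hd0 h3
    exact Nat.div_mul_cancel (hg ▸ Nat.gcd_dvd_left b q)
  · intro b _
    exact Nat.mul_div_cancel _ hk0
  · intro b hb
    obtain ⟨hb1, hb2⟩ := mem_filter.mp hb
    have h3 : Nat.gcd b q * (q / Nat.gcd b q) = q := Nat.mul_div_cancel' (Nat.gcd_dvd_right b q)
    rw [hb2] at h3
    nth_rewrite 2 [hk] at h3
    rw [mul_comm] at h3
    have hg := Nat.eq_of_mul_eq_mul_left hd0 h3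
    have hkb : k ∣ b := hg ▸ Nat.gcd_dvd_left b q
    congr 1
    rw [Nat.cast_div hkb (by positivity), hk]
    push_cast
    have : (k : ℚ) ≠ 0 := by positivity
    have : (d : ℚ) ≠ 0 := by positivity
    field_simp

/-- Ramanujan sums at coprime arguments are values of the Möbius function. -/
theorem ramanujan_sum_coprime {n q : ℕ} (hq : 0 < q) (h : n.Coprime q) :
    ∑ b ∈ range q with b.Coprime q, ee (((b / q : ℚ) : ℝ) * n) = (ArithmeticFunction.moebius q : ℤ) := by
  have key := (ArithmeticFunction.sum_eq_iff_sum_mul_moebius_eq_on (R := ℂ)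
    (f := fun d => ∑ b ∈ range d with b.Coprime d, ee (((b / d : ℚ) : ℝ) * n))
    (g := fun d => if d = 1 then 1 else 0) {d | n.Coprime d} ?_).mp ?_ q hq h
  · rw [← key]
    rw [sum_eq_single (q, 1)]
    · simp
    · rintro ⟨a, b⟩ hab hne
      have : b ≠ 1 := by
        rintro rfl
        have := (Nat.mem_divisorsAntidiagonal.mp hab).1
        simp at this
        exact hne (by rw [this])
      simp [this]
    · intro hh
      exact absurd (Nat.mem_divisorsAntidiagonal.mpr ⟨by simp, hq.ne'⟩) hh
  · intro a b hab hb
    exact Nat.Coprime.coprime_dvd_right hab hb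
  · intro d hd hcop
    rw [← sum_range_div_eq_sum_divisors (fun θ => ee ((θ : ℝ) * n)) hd]
    have e1 : ∀ b : ℕ, ee (((b / d : ℚ) : ℝ) * n) = ee (n / d) ^ b := by
      intro b
      rw [← ee_natCast_mul]; congr 1; push_cast; ring
    simp only [e1]
    have hd' : (d : ℝ) ≠ 0 := by positivity
    split_ifs with h1
    · subst h1; simp
    · have hne : ee (n / d) ≠ 1 := by
        rw [Ne, ee_eq_one_iff]
        rintro ⟨t, ht⟩
        rw [div_eq_iff hd'] at ht
        have ht' : (n : ℤ) = t * d := by exact_mod_cast ht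
        have : (d : ℤ) ∣ n := ⟨t, by rw [ht']; ring⟩
        have : d ∣ n := by exact_mod_cast this
        have h2 := Nat.dvd_gcd this dvd_rfl
        rw [Nat.Coprime.gcd_eq_one hcop] at h2
        exact h1 (Nat.dvd_one.mp h2)
      rw [geom_sum_eq hne]
      have : ee (n / d) ^ d = 1 := by
        rw [← ee_natCast_mul, ee_eq_one_iff]
        exact ⟨n, by push_cast; field_simp⟩
      rw [this]; simp

theorem sum_Icc_inv_sq_le (D : ℕ) : ∑ k ∈ Icc 1 D, (1 : ℝ) / (k : ℝ) ^ 2 ≤ 2 := by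
  have : ∀ D : ℕ, 1 ≤ D → ∑ k ∈ Icc 1 D, (1 : ℝ) / (k : ℝ) ^ 2 ≤ 2 - 1 / D := by
    intro D hD
    induction D, hD using Nat.le_induction with
    | base => norm_num
    | succ n hn ih =>
      rw [sum_Icc_succ_top (by omega)]
      have hn' : (0 : ℝ) < n := by exact_mod_cast hn
      have : (1 : ℝ) / ((n + 1 : ℕ) : ℝ) ^ 2 ≤ 1 / n - 1 / ((n + 1 : ℕ) : ℝ) := by
        push_cast
        rw [div_sub_div _ _ hn'.ne' (by positivity), div_le_div_iff₀ (by positivity) (by positivity)]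
        nlinarith
      linarith
  rcases Nat.eq_zero_or_pos D with h | h
  · simp [h]
  · have h1 := this D h
    have : (0 : ℝ) ≤ 1 / D := by positivity
    linarith

theorem log_le_sum_squarefree_coprime {D r : ℕ} (hr : r.Prime) :
    Real.log D ≤ 3 * ∑ q ∈ Icc 1 D with Squarefree q ∧ q.Coprime r, (1 : ℝ) / q := by
  classical
  set A := (Icc 1 D).filter (fun q => Squarefree q ∧ q.Coprime r) with hA
  have h1 : Real.log D ≤ ∑ k ∈ Icc 1 D, (1 : ℝ) / k := by
    have h := log_add_one_le_harmonic D
    rw [harmonic_eq_sum_Icc] at h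
    push_cast at h
    rcases Nat.eq_zero_or_pos D with h0 | h0
    · simp [h0]
    · have : Real.log D ≤ Real.log (D + 1) := by
        apply Real.log_le_log (by exact_mod_cast h0); linarith
      simpa [one_div] using this.trans h
  set T := A ×ˢ (({0, 1} : Finset ℕ) ×ˢ Icc 1 D) with hT
  set g : ℕ × ℕ × ℕ → ℕ := fun x => x.1 * r ^ x.2.1 * x.2.2 ^ 2 with hg
  have h2 : Icc 1 D ⊆ T.image g := by
    intro n hn
    obtain ⟨hn1, hnD⟩ := mem_Icc.mp hn
    obtain ⟨a, b, ha0, hb0, hab, hsq⟩ := Nat.sq_mul_squarefree_of_pos (n := n) (by omega)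
    have hbn : b ≤ n := by
      rw [← hab]; nlinarith
    by_cases hra : r ∣ a
    · obtain ⟨c, hc⟩ := hra
      have hcop : c.Coprime r := by
        rw [hc] at hsq
        rw [Nat.coprime_comm]
        exact (Nat.squarefree_mul_iff.mp hsq).1
      have hc0 : 0 < c := Nat.pos_of_ne_zero (by rintro rfl; simp at hc; omega)
      have hcn : c ≤ n := by
        rw [← hab, hc]
        have := hr.one_lt
        nlinarith [Nat.mul_pos (pow_pos hb0 2) hc0, pow_pos hb0 2,
          Nat.mul_le_mul (pow_pos hb0 2) (Nat.mul_le_mul hr.one_lt.le (le_refl c))]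
      rw [mem_image]
      refine ⟨(c, 1, b), ?_, ?_⟩
      · simp only [hT, hA, mem_product, mem_filter, mem_Icc, mem_insert, mem_singleton]
        refine ⟨⟨⟨hc0, by omega⟩, ?_, hcop⟩, by simp, hb0, by omega⟩
        exact hsq.squarefree_of_dvd ⟨r, by rw [hc]; ring⟩
      · simp only [hg]; rw [← hab, hc]; ring
    · rw [mem_image]
      have han : a ≤ n := by
        rw [← hab]; nlinarith [pow_pos hb0 2]
      refine ⟨(a, 0, b), ?_, ?_⟩
      · simp only [hT, hA, mem_product, mem_filter, mem_Icc, mem_insert, mem_singleton]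
        refine ⟨⟨⟨ha0, by omega⟩, hsq, ?_⟩, by simp, hb0, by omega⟩
        exact ((Nat.Prime.coprime_iff_not_dvd hr).mpr hra).symm
      · simp only [hg]; rw [← hab]; ring
  have hA0 : 0 ≤ ∑ q ∈ A, (1 : ℝ) / q := sum_nonneg fun _ _ => by positivity
  calc Real.log D ≤ ∑ k ∈ Icc 1 D, (1 : ℝ) / k := h1
    _ ≤ ∑ k ∈ T.image g, (1 : ℝ) / k := sum_le_sum_of_subset_of_nonneg h2 fun _ _ _ => by positivity
    _ ≤ ∑ x ∈ T, (1 : ℝ) / (g x : ℕ) :=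
        sum_image_le_of_nonneg (f := fun k : ℕ => (1 : ℝ) / k) (fun _ _ => by positivity)
    _ = (∑ q ∈ A, (1 : ℝ) / q) * ((∑ i ∈ ({0, 1} : Finset ℕ), (1 : ℝ) / (r : ℝ) ^ i)
          * ∑ b ∈ Icc 1 D, (1 : ℝ) / (b : ℝ) ^ 2) := by
        rw [hT, sum_product, sum_mul]
        refine sum_congr rfl fun q _ => ?_
        rw [sum_product, sum_mul, mul_sum]
        refine sum_congr rfl fun i _ => ?_
        rw [mul_sum, mul_sum]
        refine sum_congr rfl fun b _ => ?_
        simp only [hg]; push_cast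
        rw [one_div_mul_one_div, one_div_mul_one_div, mul_assoc]
    _ ≤ (∑ q ∈ A, (1 : ℝ) / q) * ((3 / 2) * 2) := by
        gcongr
        · rw [sum_pair (by norm_num)]
          have : (2 : ℝ) ≤ r := by exact_mod_cast hr.two_le
          have : (1 : ℝ) / r ≤ 1 / 2 := by gcongr
          simp only [pow_zero, pow_one]; linarith
        · exact sum_Icc_inv_sq_le D
    _ = _ := by ring

/-- A Brun–Titchmarsh type bound in intervals and residue classes to prime power moduli. -/
theorem card_mul_log_le_of_rough {D H b e r i : ℕ} (hr : r.Prime) (he : e = r ^ i) (Q : Finset ℕ)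
    (hQ : ∀ q ∈ Q, b ≤ q ∧ q < b + H) (hcop : ∀ q ∈ Q, ∀ d, 1 ≤ d → d ≤ D → q.Coprime d)
    (hmod : ∀ q ∈ Q, ∀ q' ∈ Q, q % e = q' % e) :
    (#Q : ℝ) * Real.log D ≤ 3 * ((H : ℝ) / e + 1 + (D : ℝ) ^ 4) := by
  classical
  rcases Q.eq_empty_or_nonempty with h | hne
  · rw [h, card_empty, Nat.cast_zero, zero_mul]; positivity
  have he0 : 0 < e := he ▸ pow_pos hr.pos i
  set A := (Icc 1 D).filter (fun q => Squarefree q ∧ q.Coprime r) with hA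
  set U : Finset (Σ _ : ℕ, ℕ) := A.sigma (fun q => (range q).filter (fun b => b.Coprime q)) with hU
  set g : (Σ _ : ℕ, ℕ) → ℚ := fun x => (x.2 : ℚ) / x.1 with hg
  have hUm : ∀ x ∈ U, 1 ≤ x.1 ∧ x.1 ≤ D ∧ Squarefree x.1 ∧ x.1.Coprime r ∧ x.2 < x.1 ∧
      x.2.Coprime x.1 := by
    intro x hx
    simp only [hU, hA, mem_sigma, mem_filter, mem_Icc, mem_range] at hx
    tauto
  have hden : ∀ x ∈ U, (g x).den = x.1 := by
    intro x hx
    obtain ⟨h1, _, _, _, _, h6⟩ := hUm x hx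
    have := Rat.den_div_eq_of_coprime (a := (x.2 : ℤ)) (b := (x.1 : ℤ)) (by exact_mod_cast h1)
      (by simpa using h6)
    simp only [Int.cast_natCast] at this
    exact_mod_cast this
  have hinj : Set.InjOn g U := by
    intro x hx y hy hxy
    have h1 : x.1 = y.1 := by rw [← hden x hx, ← hden y hy, hxy]
    have hx0 : (x.1 : ℚ) ≠ 0 := by
      have := (hUm x hx).1; exact_mod_cast (by omega : x.1 ≠ 0)
    have h2 : (x.2 : ℚ) = y.2 := by
      have a1 : (x.2 : ℚ) / x.1 = y.2 / y.1 := hxy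
      rw [← h1] at a1
      exact (div_left_inj' hx0).mp a1
    have h2' : x.2 = y.2 := by exact_mod_cast h2
    cases x; cases y; simp_all
  have hg01 : ∀ x ∈ U, 0 ≤ g x ∧ g x < 1 := by
    intro x hx
    obtain ⟨h1, _, _, _, h5, _⟩ := hUm x hx
    have h3 : (0 : ℚ) < x.1 := by exact_mod_cast h1
    exact ⟨by positivity, (div_lt_one h3).mpr (by exact_mod_cast h5)⟩
  have hcard : (#(U.image g) : ℝ) ≤ (D : ℝ) ^ 2 := by
    have h1 : #(U.image g) ≤ #U := card_image_le
    have h2 : U ⊆ (Icc 1 D).sigma (fun _ => range D) := by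
      intro x hx
      have h3 := hUm x hx
      simp only [mem_sigma, mem_Icc, mem_range]
      omega
    have h3 := card_le_card h2
    have h4 : #((Icc 1 D).sigma (fun _ => range D)) = D * D := by
      rw [card_sigma]; simp
    have : #(U.image g) ≤ D ^ 2 := by
      calc #(U.image g) ≤ _ := h1.trans h3
        _ = D ^ 2 := by rw [h4]; ring
    exact_mod_cast this
  set q₀ := Q.min' hne with hq₀
  have hq₀m : q₀ ∈ Q := Q.min'_mem hne
  have e4 : ∑ θ ∈ U.image g, ‖∑ q ∈ Q, ee (θ * q)‖ ^ 2
      ≤ ((H / e + 1 : ℕ) + (D : ℝ) ^ 2 * (D : ℝ) ^ 2) * #Q := by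
    refine large_sieve_ap (U.image g) (b := q₀) (e := e) hcard ?_ ?_ he0 Q ?_
    · intro θ hθ
      obtain ⟨x, hx, rfl⟩ := mem_image.mp hθ
      rw [hden x hx]; exact (hUm x hx).2.1
    · intro θ hθ θ' hθ' hne
      obtain ⟨x, hx, rfl⟩ := mem_image.mp hθ
      obtain ⟨y, hy, rfl⟩ := mem_image.mp hθ'
      rintro ⟨n, hn⟩
      obtain ⟨a1, a2⟩ := hg01 x hx
      obtain ⟨a3, a4⟩ := hg01 y hy
      set δ := g x - g y with hδ
      have hcop1 : δ.den.Coprime e := by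
        have h1 : δ.den ∣ x.1 * y.1 := by
          have := Rat.sub_den_dvd (g x) (g y)
          rwa [hden x hx, hden y hy] at this
        rw [he]
        exact Nat.Coprime.coprime_dvd_left h1
          (Nat.Coprime.pow_right _ (Nat.Coprime.mul_left (hUm x hx).2.2.2.1 (hUm y hy).2.2.2.1))
      have h2 : (e : ℤ) * δ.num = n * δ.den := by
        have : (e : ℚ) * δ.num = n * δ.den := by
          rw [← hn, ← Rat.mul_den_eq_num δ]; ring
        exact_mod_cast this
      have h3 : δ.den ∣ e * δ.num.natAbs := by
        have : (δ.den : ℤ) ∣ e * δ.num := ⟨n, by rw [h2]; ring⟩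
        have := Int.natAbs_dvd_natAbs.mpr this
        simpa [Int.natAbs_mul] using this
      have h4 : δ.den ∣ δ.num.natAbs := hcop1.dvd_of_dvd_mul_left h3
      have h5 : δ.den = 1 := by
        have := Nat.dvd_gcd h4 dvd_rfl
        rw [Nat.Coprime.gcd_eq_one δ.reduced] at this
        exact Nat.dvd_one.mp this
      have h6 : δ = δ.num := by
        conv_lhs => rw [← Rat.num_div_den δ, h5]
        simp
      have b1 : (δ.num : ℚ) < 1 := by rw [← h6]; linarith
      have b2 : (-1 : ℚ) < δ.num := by rw [← h6]; linarith
      have b1' : δ.num < 1 := by exact_mod_cast b1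
      have b2' : -1 < δ.num := by exact_mod_cast b2
      have : δ.num = 0 := by omega
      rw [this] at h6
      exact hne (sub_eq_zero.mp (by simpa using h6))
    · intro q hq
      have h1 : q₀ ≤ q := Q.min'_le q hq
      have h2 : e ∣ q - q₀ := (Nat.modEq_iff_dvd' h1).mp (hmod q₀ hq₀m q hq)
      obtain ⟨t, ht⟩ := h2
      refine ⟨t, ?_, by omega⟩
      have h3 := hQ q hq
      have h4 := hQ q₀ hq₀m
      have : t ≤ H / e := by
        rw [Nat.le_div_iff_mul_le he0, mul_comm, ← ht]; omega
      omega
  have e5 : ∀ q ∈ A, (1 : ℝ) / q * (#Q : ℝ) ^ 2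
      ≤ ∑ b ∈ (range q).filter (fun b => b.Coprime q), ‖∑ n ∈ Q, ee ((g ⟨q, b⟩ : ℝ) * n)‖ ^ 2 := by
    intro q hq
    simp only [hA, mem_filter, mem_Icc] at hq
    obtain ⟨⟨h1, h2⟩, h3, h4⟩ := hq
    have hq0 : (0 : ℝ) < q := by exact_mod_cast h1
    have a1 : ‖∑ b ∈ (range q).filter (fun b => b.Coprime q), ∑ n ∈ Q, ee ((g ⟨q, b⟩ : ℝ) * n)‖
        = #Q := by
      rw [sum_comm]
      have : ∀ n ∈ Q, ∑ b ∈ (range q).filter (fun b => b.Coprime q), ee ((g ⟨q, b⟩ : ℝ) * n)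
          = (ArithmeticFunction.moebius q : ℤ) := fun n hn =>
        ramanujan_sum_coprime h1 (hcop n hn q h1 h2)
      rw [sum_congr rfl this, sum_const, nsmul_eq_mul, norm_mul]
      have : |ArithmeticFunction.moebius q| = 1 := ArithmeticFunction.abs_moebius_eq_one_of_squarefree h3
      rw [Complex.norm_intCast, ← Int.cast_abs, this]
      simp
    have a2 : (#((range q).filter (fun b => b.Coprime q)) : ℝ) ≤ q := by
      have := card_filter_le (range q) (fun b => b.Coprime q)
      rw [card_range] at this
      exact_mod_cast this
    have a3 : (#Q : ℝ) ^ 2 ≤ q * ∑ b ∈ (range q).filter (fun b => b.Coprime q),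
        ‖∑ n ∈ Q, ee ((g ⟨q, b⟩ : ℝ) * n)‖ ^ 2 := by
      rw [← a1]
      calc _ ≤ (∑ b ∈ (range q).filter (fun b => b.Coprime q),
            ‖∑ n ∈ Q, ee ((g ⟨q, b⟩ : ℝ) * n)‖) ^ 2 := by
            gcongr; exact norm_sum_le _ _
        _ ≤ _ := sq_sum_le_card_mul_sum_sq
        _ ≤ _ := by gcongr
    rw [one_div, inv_mul_le_iff₀ hq0]
    exact a3
  have e6 : (∑ q ∈ A, (1 : ℝ) / q) * (#Q : ℝ) ^ 2 ≤ ((H : ℝ) / e + 1 + (D : ℝ) ^ 4) * #Q := by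
    calc (∑ q ∈ A, (1 : ℝ) / q) * (#Q : ℝ) ^ 2 = ∑ q ∈ A, (1 : ℝ) / q * (#Q : ℝ) ^ 2 := sum_mul _ _ _
      _ ≤ ∑ q ∈ A, ∑ b ∈ (range q).filter (fun b => b.Coprime q),
            ‖∑ n ∈ Q, ee ((g ⟨q, b⟩ : ℝ) * n)‖ ^ 2 := sum_le_sum e5
      _ = ∑ θ ∈ U.image g, ‖∑ q ∈ Q, ee (θ * q)‖ ^ 2 := by
          rw [sum_image hinj, hU, sum_sigma]
      _ ≤ _ := e4
      _ ≤ _ := by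
          refine mul_le_mul_of_nonneg_right ?_ (Nat.cast_nonneg _)
          have : ((H / e + 1 : ℕ) : ℝ) ≤ (H : ℝ) / e + 1 := by
            push_cast
            have := @Nat.cast_div_le ℝ _ _ _ H e
            linarith
          have h2 : (D : ℝ) ^ 2 * (D : ℝ) ^ 2 = (D : ℝ) ^ 4 := by ring
          linarith
  have hQ0 : (0 : ℝ) < #Q := by exact_mod_cast card_pos.mpr hne
  have e7 : (∑ q ∈ A, (1 : ℝ) / q) * (#Q : ℝ) ≤ (H : ℝ) / e + 1 + (D : ℝ) ^ 4 := by
    have : ((∑ q ∈ A, (1 : ℝ) / q) * (#Q : ℝ)) * #Q ≤ ((H : ℝ) / e + 1 + (D : ℝ) ^ 4) * #Q := by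
      calc _ = (∑ q ∈ A, (1 : ℝ) / q) * (#Q : ℝ) ^ 2 := by ring
        _ ≤ _ := e6
    exact le_of_mul_le_mul_right this hQ0
  have e8 := log_le_sum_squarefree_coprime (D := D) hr
  calc (#Q : ℝ) * Real.log D ≤ #Q * (3 * ∑ q ∈ A, (1 : ℝ) / q) := by gcongr
    _ = 3 * ((∑ q ∈ A, (1 : ℝ) / q) * (#Q : ℝ)) := by ring
    _ ≤ _ := by gcongr

theorem sum_log_div_mul_pred_le (N : ℕ) :
    ∑ n ∈ Icc 2 N, Real.log n / ((n : ℝ) * (n - 1)) ≤ 2 := by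
  have key : ∀ N : ℕ, 1 ≤ N →
      ∑ n ∈ Icc 2 N, Real.log n / ((n : ℝ) * (n - 1)) ≤ 2 - (2 + Real.log N) / N := by
    intro N hN
    induction N, hN using Nat.le_induction with
    | base => simp
    | succ n hn ih =>
      rw [sum_Icc_succ_top (by omega)]
      have hn' : (1 : ℝ) ≤ n := by exact_mod_cast hn
      have hn0 : (0 : ℝ) < n := by linarith
      push_cast
      have h1 : Real.log (n + 1) - Real.log n ≤ 1 / n := by
        rw [← Real.log_div (by positivity) (by positivity)]
        have := Real.log_le_sub_one_of_pos (show (0 : ℝ) < (n + 1) / n by positivity)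
        have h2 : ((n : ℝ) + 1) / n - 1 = 1 / n := by field_simp; ring
        linarith
      have h2 : (1 : ℝ) / n ≤ 1 := by rw [div_le_one hn0]; exact hn'
      have h3 : Real.log (n + 1) / (((n : ℝ) + 1) * (n + 1 - 1))
          ≤ (2 + Real.log n) / n - (2 + Real.log (n + 1)) / (n + 1) := by
        rw [div_sub_div _ _ hn0.ne' (by positivity), div_le_div_iff₀ (by simp; positivity) (by positivity)]
        have h4 : (n + 1) * (Real.log (n + 1) - Real.log n) ≤ 2 := by
          calc ((n : ℝ) + 1) * (Real.log (n + 1) - Real.log n) ≤ (n + 1) * (1 / n) := by gcongr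
            _ = 1 + 1 / n := by field_simp
            _ ≤ 2 := by linarith
        have h5 : 0 ≤ (n : ℝ) * (n + 1) := by positivity
        have h6 : 0 ≤ (2 - (n + 1) * (Real.log (n + 1) - Real.log n)) * ((n : ℝ) * (n + 1)) :=
          mul_nonneg (by linarith) h5
        linarith
      linarith
  rcases Nat.eq_zero_or_pos N with h | h
  · simp [h]
  · have h1 := key N h
    have : 0 ≤ (2 + Real.log N) / N := by
      have := Real.log_natCast_nonneg N
      positivity
    linarith

theorem log_factorial_eq_sum (N : ℕ) :
    Real.log (N.factorial) = ∑ p ∈ Icc 1 N with p.Prime, (padicValNat p N.factorial : ℝ) * Real.log p := by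
  have h := Nat.prod_pow_prime_padicValNat N.factorial N.factorial_ne_zero (N.factorial + 1)
    (Nat.lt_succ_self _)
  have h2 : ∏ p ∈ Icc 1 N with p.Prime, p ^ padicValNat p N.factorial = N.factorial := by
    rw [← h]
    conv_lhs => rw [h]
    refine prod_subset ?_ ?_
    · intro p hp
      simp only [mem_filter, mem_Icc, mem_range] at hp ⊢
      exact ⟨Nat.lt_succ_of_le (hp.1.2.trans N.self_le_factorial), hp.2⟩
    · intro p hp hp'
      simp only [mem_filter, mem_Icc, mem_range] at hp hp'
      have : N < p := by
        by_contra hlt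
        exact hp' ⟨⟨hp.2.one_lt.le, by omega⟩, hp.2⟩
      have h3 := Nat.factorization_factorial_eq_zero_of_lt this
      rw [Nat.factorization_def _ hp.2] at h3
      rw [h3, pow_zero]
  have h3 : (N.factorial : ℝ) = ∏ p ∈ Icc 1 N with p.Prime, (p : ℝ) ^ padicValNat p N.factorial := by
    conv_lhs => rw [← h2]
    push_cast; rfl
  rw [h3, Real.log_prod]
  · exact sum_congr rfl fun p _ => by rw [Real.log_pow]
  · intro p hp
    have := (mem_filter.mp hp).2.pos
    positivity

/-- Mertens' first theorem. -/
theorem mertens_first (N : ℕ) (hN : 1 ≤ N) :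
    |∑ p ∈ Icc 1 N with p.Prime, Real.log p / p - Real.log N| ≤ 3 := by
  have hN0 : (0 : ℝ) < N := by exact_mod_cast hN
  have h1 := log_factorial_eq_sum N
  have hup : Real.log N.factorial ≤ N * Real.log N := by
    have : (N.factorial : ℝ) ≤ (N : ℝ) ^ N := by exact_mod_cast Nat.factorial_le_pow N
    calc Real.log N.factorial ≤ Real.log ((N : ℝ) ^ N) :=
          Real.log_le_log (by exact_mod_cast N.factorial_pos) this
      _ = _ := by rw [Real.log_pow]
  have hlow : N * Real.log N - N ≤ Real.log N.factorial := by
    have := Stirling.le_log_factorial_stirling (n := N) (by omega)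
    have h2 : 0 ≤ Real.log N / 2 := by have := Real.log_natCast_nonneg N; positivity
    have h3 : 0 ≤ Real.log (2 * Real.pi) / 2 := by
      have := Real.log_nonneg (show (1 : ℝ) ≤ 2 * Real.pi by linarith [Real.pi_gt_three])
      positivity
    linarith
  have hth : ∑ p ∈ Icc 1 N with p.Prime, Real.log p ≤ Real.log 4 * N := by
    have := Chebyshev.theta_le_log4_mul_x (x := N) (by positivity)
    rw [Chebyshev.theta_eq_sum_Icc, Nat.floor_natCast] at this
    refine le_trans (sum_le_sum_of_subset_of_nonneg ?_ ?_) this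
    · intro p hp
      simp only [mem_filter, mem_Icc] at hp ⊢
      exact ⟨⟨Nat.zero_le _, hp.1.2⟩, hp.2⟩
    · intro p _ _; exact Real.log_natCast_nonneg p
  have hlog4 : Real.log 4 ≤ 3 := by
    have := Real.log_le_sub_one_of_pos (show (0 : ℝ) < 4 by norm_num)
    linarith
  rw [abs_le]
  constructor
  · have h2 : Real.log N.factorial ≤ N * (∑ p ∈ Icc 1 N with p.Prime, Real.log p / p + 2) := by
      have h3 : ∑ p ∈ Icc 1 N with p.Prime, Real.log p / ((p : ℝ) * (p - 1)) ≤ 2 := by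
        refine le_trans (sum_le_sum_of_subset_of_nonneg ?_ ?_) (sum_log_div_mul_pred_le N)
        · intro p hp
          simp only [mem_filter, mem_Icc] at hp ⊢
          exact ⟨hp.2.two_le, hp.1.2⟩
        · intro p hp _
          have : (2 : ℝ) ≤ p := by exact_mod_cast (mem_Icc.mp hp).1
          have := Real.log_natCast_nonneg p
          apply div_nonneg this
          apply mul_nonneg <;> linarith
      calc Real.log N.factorial ≤ ∑ p ∈ Icc 1 N with p.Prime, (N : ℝ) * (Real.log p / p + Real.log p / ((p : ℝ) * (p - 1))) := by
            rw [h1]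
            refine sum_le_sum fun p hp => ?_
            have hpp := (mem_filter.mp hp).2
            have := Fact.mk hpp
            have hp2 : (2 : ℝ) ≤ p := by exact_mod_cast hpp.two_le
            have h4 : (p - 1) * padicValNat p N.factorial ≤ N := by
              rw [sub_one_mul_padicValNat_factorial]; exact Nat.sub_le _ _
            have h5 : ((p : ℝ) - 1) * padicValNat p N.factorial ≤ N := by
              have : (((p - 1 : ℕ) : ℝ)) * padicValNat p N.factorial ≤ N := by exact_mod_cast h4
              rwa [Nat.cast_sub hpp.one_lt.le, Nat.cast_one] at this
            have h6 : Real.log p / p + Real.log p / ((p : ℝ) * (p - 1)) = Real.log p / (p - 1) := by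
              have : (p : ℝ) - 1 ≠ 0 := by linarith
              have : (p : ℝ) ≠ 0 := by linarith
              field_simp
              ring
            rw [h6]
            have h7 : (padicValNat p N.factorial : ℝ) ≤ N / (p - 1) := by
              rw [le_div_iff₀ (by linarith)]; linarith
            calc (padicValNat p N.factorial : ℝ) * Real.log p ≤ N / (p - 1) * Real.log p := by
                  gcongr
              _ = _ := by ring
        _ = N * (∑ p ∈ Icc 1 N with p.Prime, Real.log p / p
              + ∑ p ∈ Icc 1 N with p.Prime, Real.log p / ((p : ℝ) * (p - 1))) := by
            rw [← mul_sum, sum_add_distrib]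
        _ ≤ _ := by gcongr
    have h3 : N * (Real.log N - 1) ≤ N * (∑ p ∈ Icc 1 N with p.Prime, Real.log p / p + 2) := by
      linarith
    have := le_of_mul_le_mul_left h3 hN0
    linarith
  · have h2 : N * ∑ p ∈ Icc 1 N with p.Prime, Real.log p / p ≤ Real.log N.factorial + Real.log 4 * N := by
      calc N * ∑ p ∈ Icc 1 N with p.Prime, Real.log p / p
          ≤ ∑ p ∈ Icc 1 N with p.Prime, ((padicValNat p N.factorial : ℝ) * Real.log p + Real.log p) := by
            rw [mul_sum]
            refine sum_le_sum fun p hp => ?_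
            have hpp := (mem_filter.mp hp).2
            have := Fact.mk hpp
            have hp2 : (2 : ℝ) ≤ p := by exact_mod_cast hpp.two_le
            have h4 : N / p ≤ padicValNat p N.factorial := by
              rw [padicValNat_factorial (b := Nat.log p N + 2) (by omega)]
              have := single_le_sum (f := fun i => N / p ^ i) (fun _ _ => Nat.zero_le _)
                (mem_Ico.mpr ⟨le_refl 1, by omega⟩ : 1 ∈ Ico 1 (Nat.log p N + 2))
              simpa using this
            have h5 : (N : ℝ) / p ≤ padicValNat p N.factorial + 1 := by
              have : (N : ℝ) / p < (N / p : ℕ) + 1 := by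
                have := Nat.lt_floor_add_one ((N : ℝ) / p)
                rwa [Nat.floor_div_eq_div] at this
              have h6 : ((N / p : ℕ) : ℝ) ≤ padicValNat p N.factorial := by exact_mod_cast h4
              linarith
            calc (N : ℝ) * (Real.log p / p) = N / p * Real.log p := by ring
              _ ≤ (padicValNat p N.factorial + 1) * Real.log p := by
                gcongr
              _ = _ := by ring
        _ = Real.log N.factorial + ∑ p ∈ Icc 1 N with p.Prime, Real.log p := by
            rw [sum_add_distrib, h1]
        _ ≤ _ := by gcongr
    have h3 : N * ∑ p ∈ Icc 1 N with p.Prime, Real.log p / p ≤ N * (Real.log N + Real.log 4) := by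
      linarith
    have := le_of_mul_le_mul_left h3 hN0
    linarith

/-- Mertens' second theorem. -/
theorem mertens_second : ∃ C : ℝ, 0 ≤ C ∧ ∀ N : ℕ, 2 ≤ N →
    |∑ p ∈ Icc 1 N with p.Prime, (1 : ℝ) / p - Real.log (Real.log N)| ≤ C := by
  set A : ℕ → ℝ := fun N => ∑ p ∈ Icc 1 N with p.Prime, Real.log p / p with hA
  set B : ℕ → ℝ := fun N => ∑ p ∈ Icc 1 N with p.Prime, (1 : ℝ) / p with hB
  set E : ℕ → ℝ := fun N => A N - Real.log N with hE
  set G : ℕ → ℝ := fun N => B N - Real.log (Real.log N) - E N / Real.log N with hG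
  have hE3 : ∀ N : ℕ, 1 ≤ N → |E N| ≤ 3 := fun N hN => mertens_first N hN
  have hlogpos : ∀ N : ℕ, 2 ≤ N → 0 < Real.log N := fun N hN =>
    Real.log_pos (by exact_mod_cast hN)
  have hstep : ∀ N : ℕ, 2 ≤ N → |G (N + 1) - G N|
      ≤ 4 * (1 / Real.log N - 1 / Real.log ((N + 1 : ℕ) : ℝ)) := by
    intro N hN
    have hN0 : (0 : ℝ) < N := by positivity
    set a := Real.log N with ha
    set b := Real.log ((N + 1 : ℕ) : ℝ) with hb
    have ha0 : 0 < a := hlogpos N hN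
    have hb0 : 0 < b := hlogpos (N + 1) (by omega)
    have hab : a ≤ b := Real.log_le_log hN0 (by push_cast; linarith)
    have hba : b - a ≤ 1 := by
      rw [ha, hb, ← Real.log_div (by positivity) (by positivity)]
      have h1 := Real.log_le_sub_one_of_pos (show (0 : ℝ) < ((N + 1 : ℕ) : ℝ) / N by positivity)
      have h2 : ((N + 1 : ℕ) : ℝ) / N - 1 = 1 / N := by push_cast; field_simp; ring
      have h3 : (1 : ℝ) / N ≤ 1 := by
        rw [div_le_one hN0]; exact_mod_cast (by omega : 1 ≤ N)
      linarith
    have hBA : B (N + 1) - B N = (A (N + 1) - A N) / b := by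
      simp only [hA, hB, sum_filter]
      rw [sum_Icc_succ_top (by omega), sum_Icc_succ_top (by omega)]
      split_ifs
      · have hb' : Real.log ((N + 1 : ℕ) : ℝ) ≠ 0 := hb0.ne'
        rw [hb, add_sub_cancel_left, add_sub_cancel_left, div_right_comm, div_self hb']
      · simp
    have hG1 : G (N + 1) - G N = ((b - a) / b - (Real.log b - Real.log a))
        + E N * (1 / a - 1 / b) := by
      have : A (N + 1) - A N = (b - a) + (E (N + 1) - E N) := by simp only [hE]; ring
      have h2 : B (N + 1) = B N + ((b - a) + (E (N + 1) - E N)) / b := by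
        rw [← this, ← hBA]; ring
      simp only [hG]
      rw [h2, ← ha, ← hb]; field_simp; ring
    have hinv : 0 ≤ 1 / a - 1 / b := by
      have := one_div_le_one_div_of_le ha0 hab; linarith
    have hl1 : Real.log b - Real.log a ≤ (b - a) / a := by
      rw [← Real.log_div hb0.ne' ha0.ne']
      have := Real.log_le_sub_one_of_pos (div_pos hb0 ha0)
      have h2 : b / a - 1 = (b - a) / a := by field_simp
      linarith
    have hl2 : (b - a) / b ≤ Real.log b - Real.log a := by
      have : Real.log a - Real.log b ≤ a / b - 1 := by
        rw [← Real.log_div ha0.ne' hb0.ne']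
        exact Real.log_le_sub_one_of_pos (div_pos ha0 hb0)
      have h2 : a / b - 1 = -((b - a) / b) := by field_simp; ring
      linarith
    have h4 : (b - a) / a - (b - a) / b ≤ 1 / a - 1 / b := by
      have : (b - a) / a - (b - a) / b = (b - a) * (1 / a - 1 / b) := by ring
      rw [this]; nlinarith
    have h5 : |E N * (1 / a - 1 / b)| ≤ 3 * (1 / a - 1 / b) := by
      rw [abs_mul, abs_of_nonneg hinv]
      exact mul_le_mul_of_nonneg_right (hE3 N (by omega)) hinv
    rw [hG1]
    rw [abs_le] at h5 ⊢
    constructor <;> linarith [h5.1, h5.2]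
  have hGb : ∀ N : ℕ, 2 ≤ N → |G N - G 2| ≤ 4 * (1 / Real.log 2 - 1 / Real.log N) := by
    intro N hN
    induction N, hN using Nat.le_induction with
    | base => simp
    | succ n hn ih =>
      have h1 := hstep n hn
      have h2 := abs_sub_le (G (n + 1)) (G n) (G 2)
      linarith
  refine ⟨|G 2| + 4 / Real.log 2 + 3 / Real.log 2, ?_, ?_⟩
  · have : 0 < Real.log 2 := Real.log_pos (by norm_num)
    positivity
  · intro N hN
    have h1 := hGb N hN
    have hp := hlogpos N hN
    have h2 : B N - Real.log (Real.log N) = (G N - G 2) + G 2 + E N / Real.log N := by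
      simp only [hG]; ring
    have h3 : |E N / Real.log N| ≤ 3 / Real.log 2 := by
      rw [abs_div, abs_of_pos hp]
      have : Real.log 2 ≤ Real.log N := Real.log_le_log (by norm_num) (by exact_mod_cast hN)
      have h0 : 0 < Real.log 2 := Real.log_pos (by norm_num)
      gcongr
      exact hE3 N (by omega)
    have h4 : 0 ≤ 1 / Real.log N := by positivity
    change |B N - Real.log (Real.log N)| ≤ _
    rw [h2]
    refine (abs_add_le _ _).trans (add_le_add ((abs_add_le _ _).trans ?_) h3)
    have : 4 / Real.log 2 = 4 * (1 / Real.log 2) := by ring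
    linarith

theorem mertens_interval : ∃ C : ℝ, 0 ≤ C ∧ ∀ M N : ℕ, 2 ≤ M → M ≤ N →
    |∑ p ∈ Ioc M N with p.Prime, (1 : ℝ) / p - (Real.log (Real.log N) - Real.log (Real.log M))|
      ≤ C := by
  obtain ⟨C, hC, h⟩ := mertens_second
  refine ⟨2 * C, by positivity, fun M N hM hMN => ?_⟩
  have h1 := h M hM
  have h2 := h N (hM.trans hMN)
  have h3 : ∑ p ∈ Icc 1 N with p.Prime, (1 : ℝ) / p
      = ∑ p ∈ Icc 1 M with p.Prime, (1 : ℝ) / p + ∑ p ∈ Ioc M N with p.Prime, (1 : ℝ) / p := by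
    rw [← sum_union]
    · refine sum_congr ?_ fun _ _ => rfl
      ext p
      simp only [mem_filter, mem_union, mem_Icc, mem_Ioc]
      constructor
      · rintro ⟨⟨h1, h2⟩, h3⟩
        rcases le_or_gt p M with h | h
        · exact Or.inl ⟨⟨h1, h⟩, h3⟩
        · exact Or.inr ⟨⟨h, h2⟩, h3⟩
      · rintro (⟨⟨h1, h2⟩, h3⟩ | ⟨⟨h1, h2⟩, h3⟩)
        · exact ⟨⟨h1, by omega⟩, h3⟩
        · exact ⟨⟨by omega, by omega⟩, h3⟩
    · rw [disjoint_left]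
      intro p hp hp'
      simp only [mem_filter, mem_Icc, mem_Ioc] at hp hp'
      omega
  rw [abs_le] at h1 h2 ⊢
  constructor <;> linarith [h1.1, h1.2, h2.1, h2.2]

/-- The sum of proper divisors. -/
def sP (n : ℕ) : ℕ := ∑ d ∈ n.properDivisors, d

/-- The sum of divisors. -/
def sD (n : ℕ) : ℕ := ∑ d ∈ n.divisors, d

theorem sD_eq (n : ℕ) : sD n = sP n + n := Nat.sum_divisors_eq_sum_properDivisors_add_self

theorem sD_mul_prime {m q : ℕ} (hq : q.Prime) (h : ¬ q ∣ m) : sD (m * q) = sD m * (q + 1) := by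
  have hc : m.Coprime q := ((Nat.Prime.coprime_iff_not_dvd hq).mpr h).symm
  rw [sD, Nat.Coprime.sum_divisors_mul hc, sD, hq.divisors, sum_pair hq.one_lt.ne]
  ring

theorem sP_mul_prime {m q : ℕ} (hq : q.Prime) (h : ¬ q ∣ m) :
    sP (m * q) = q * sP m + sD m := by
  have h1 := sD_mul_prime hq h
  rw [sD_eq (m * q)] at h1
  have h2 := sD_eq m
  have h3 : sD m * (q + 1) = q * sP m + sD m + m * q := by
    rw [mul_add, mul_one]; nth_rewrite 1 [h2]; ring
  omega

theorem exists_residue {d s : ℕ} (t : ℕ) (hd : 0 < d) (h : d.Coprime s) :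
    ∃ r < d, ∀ q, d ∣ q * s + t ↔ q % d = r := by
  have : NeZero d := ⟨hd.ne'⟩
  set u := ZMod.unitOfCoprime s h.symm with hu
  have hus : (u : ZMod d) = s := ZMod.coe_unitOfCoprime s h.symm
  refine ⟨(-(t : ZMod d) * (u⁻¹ : (ZMod d)ˣ)).val, ZMod.val_lt _, fun q => ?_⟩
  rw [← ZMod.natCast_eq_zero_iff, ← ZMod.val_natCast, (ZMod.val_injective d).eq_iff]
  push_cast
  rw [← hus, Units.eq_mul_inv_iff_mul_eq]
  exact ⟨fun h => eq_neg_of_add_eq_zero_left h, fun h => by rw [h]; ring⟩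

/-- Primes in the auxiliary range. -/
def auxP (X D : ℕ) : Finset ℕ := (Ioc (D ^ 16) (Nat.sqrt X)).filter Nat.Prime

/-- The part of the auxiliary range lying in the `j`-th box. -/
def boxQ (X D j : ℕ) : Finset ℕ := (auxP X D).filter (fun q => q / D ^ 8 = j)

/-- The admissible cofactors for the `j`-th box. -/
noncomputable def boxM (X D j : ℕ) : Finset ℕ := by
  classical
  exact (Icc 1 (X / ((j + 1) * D ^ 8))).filter
    (fun m => (∀ p, p.Prime → D < p → ¬ p ^ 2 ∣ m) ∧ ∃ p ∈ auxP X D, p ∣ m)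

theorem mem_auxP {X D q : ℕ} : q ∈ auxP X D ↔ (D ^ 16 < q ∧ q ≤ Nat.sqrt X) ∧ q.Prime := by
  simp [auxP]

theorem mem_boxQ {X D j q : ℕ} : q ∈ boxQ X D j ↔ q ∈ auxP X D ∧ q / D ^ 8 = j := by
  simp [boxQ]

theorem mem_boxM {X D j m : ℕ} : m ∈ boxM X D j ↔ (1 ≤ m ∧ m ≤ X / ((j + 1) * D ^ 8)) ∧
    (∀ p, p.Prime → D < p → ¬ p ^ 2 ∣ m) ∧ ∃ p ∈ auxP X D, p ∣ m := by
  simp [boxM]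

/-- Integers in `[1, D]` all of whose prime factors exceed `w`. -/
noncomputable def roughs (D w : ℕ) : Finset ℕ := by
  classical
  exact (Icc 1 D).filter (fun d => ∀ p, p.Prime → p ∣ d → w < p)

theorem mem_roughs {D w d : ℕ} : d ∈ roughs D w ↔ (1 ≤ d ∧ d ≤ D) ∧
    ∀ p, p.Prime → p ∣ d → w < p := by
  simp [roughs]

/-- `d` is coprime to `m`, `s(m)` and `σ(m)`. -/
def CopAll (d m : ℕ) : Prop := d.Coprime m ∧ d.Coprime (sP m) ∧ d.Coprime (sD m)

theorem modEq_of_dvd_of_dvd {d h n p p' : ℕ} (hp : p.Prime) (hp' : p'.Prime) (hn : ¬ p ∣ n)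
    (hn' : ¬ p' ∣ n) (hc1 : d.Coprime (n * p)) (hc2 : d.Coprime (sD (n * p)))
    (h1 : d ∣ h * sP (n * p) + sD (n * p)) (h2 : d ∣ h * sP (n * p') + sD (n * p')) :
    p ≡ p' [MOD d] := by
  rw [sD_mul_prime hp hn] at hc2
  rw [sP_mul_prime hp hn, sD_mul_prime hp hn] at h1
  rw [sP_mul_prime hp' hn', sD_mul_prime hp' hn'] at h2
  have e := sD_eq n
  set a := sP n
  set c := sD n
  have c1 : IsCoprime (d : ℤ) c := Nat.isCoprime_iff_coprime.mpr (Nat.Coprime.coprime_mul_right_right hc2)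
  have c2 : IsCoprime (d : ℤ) n := Nat.isCoprime_iff_coprime.mpr (Nat.Coprime.coprime_mul_right_right hc1)
  have h1' : (d : ℤ) ∣ h * (p * a + c) + c * (p + 1) := by exact_mod_cast h1
  have h2' : (d : ℤ) ∣ h * (p' * a + c) + c * (p' + 1) := by exact_mod_cast h2
  have h3 : (d : ℤ) ∣ c * (n * (p - p')) := by
    have e1 : (c : ℤ) * (n * (p - p')) = (p' * a + c) * (h * (p * a + c) + c * (p + 1))
        - (p * a + c) * (h * (p' * a + c) + c * (p' + 1)) := by
      have : (n : ℤ) = c - a := by rw [e]; push_cast; ring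
      rw [this]; ring
    rw [e1]
    exact dvd_sub (Dvd.dvd.mul_left h1' _) (Dvd.dvd.mul_left h2' _)
  have h4 := c2.dvd_of_dvd_mul_left (c1.dvd_of_dvd_mul_left h3)
  refine ((Nat.modEq_iff_dvd).mpr ?_).symm
  exact h4

theorem card_le_of_modEq {d L : ℕ} (S : Finset ℕ) (hS : ∀ p ∈ S, p ≤ L)
    (hmod : ∀ p ∈ S, ∀ p' ∈ S, p ≡ p' [MOD d]) : #S ≤ L / d + 1 := by
  have h1 : Set.InjOn (fun p => p / d) (S : Set ℕ) := by
    intro p hp p' hp' hpp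
    have h2 := hmod p hp p' hp'
    simp only at hpp
    rw [← Nat.div_add_mod p d, ← Nat.div_add_mod p' d, hpp, h2]
  rw [← card_image_of_injOn h1]
  calc #(S.image (fun p => p / d)) ≤ #(range (L / d + 1)) := by
        apply card_le_card
        intro x hx
        obtain ⟨p, hp, rfl⟩ := mem_image.mp hx
        rw [mem_range]
        exact Nat.lt_succ_of_le (Nat.div_le_div_right (hS p hp))
    _ = _ := card_range _

open Classical in
theorem card_boxM_residue_le {X D j d h : ℕ} (hd : 0 < d) (hdD : d ≤ D) :
    (#{m ∈ boxM X D j | CopAll d m ∧ d ∣ h * sP m + sD m} : ℝ)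
      ≤ 2 * (X / ((j + 1) * D ^ 8) : ℕ) * (1 + Real.log X) / d := by
  set M := X / ((j + 1) * D ^ 8) with hM
  set A := (boxM X D j).filter (fun m => CopAll d m ∧ d ∣ h * sP m + sD m) with hA
  have hprop : ∀ m ∈ A, ∃ p ∈ auxP X D, p ∣ m := fun m hm =>
    (mem_boxM.mp (mem_filter.mp hm).1).2.2
  choose! π hπ hπm using hprop
  have hD1 : D ≤ D ^ 16 := Nat.le_self_pow (by norm_num) D
  have hmaps : ∀ m ∈ A, m / π m ∈ Icc 1 M := by
    intro m hm
    have h1 := (mem_boxM.mp (mem_filter.mp hm).1).1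
    have hp := (mem_auxP.mp (hπ m hm)).2
    rw [mem_Icc]
    exact ⟨Nat.div_pos (Nat.le_of_dvd (by omega) (hπm m hm)) hp.pos, (Nat.div_le_self _ _).trans h1.2⟩
  have hfib : ∀ n ∈ Icc 1 M, (#{m ∈ A | m / π m = n} : ℝ) ≤ (2 * M / d) * (1 / n) := by
    intro n hn
    obtain ⟨hn1, hnM⟩ := mem_Icc.mp hn
    have hn0 : (0 : ℝ) < n := by exact_mod_cast hn1
    have hd0 : (0 : ℝ) < d := by exact_mod_cast hd
    rcases (A.filter (fun m => m / π m = n)).eq_empty_or_nonempty with he | ⟨m₀, hm₀⟩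
    · rw [he, card_empty, Nat.cast_zero]; positivity
    have hfact : ∀ m ∈ A.filter (fun m => m / π m = n), m = n * π m ∧ (π m).Prime ∧ ¬ π m ∣ n ∧
        d < π m ∧ π m ≤ M / n := by
      intro m hm
      obtain ⟨hmA, hmn⟩ := mem_filter.mp hm
      obtain ⟨hb, hc⟩ := mem_filter.mp hmA
      obtain ⟨⟨b1, b2⟩, b3, _⟩ := mem_boxM.mp hb
      obtain ⟨⟨p1, _⟩, p2⟩ := mem_auxP.mp (hπ m hmA)
      have e1 : m = n * π m := by rw [← hmn]; exact (Nat.div_mul_cancel (hπm m hmA)).symm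
      refine ⟨e1, p2, ?_, by omega, ?_⟩
      · rintro ⟨t, ht⟩
        refine b3 _ p2 (by omega) ⟨t, ?_⟩
        calc m = n * π m := e1
          _ = (π m * t) * π m := by rw [← ht]
          _ = _ := by ring
      · rw [Nat.le_div_iff_mul_le hn1, mul_comm, ← e1]; exact b2
    have hinj : Set.InjOn π (A.filter (fun m => m / π m = n) : Set ℕ) := by
      intro m hm m' hm' hmm
      rw [(hfact m hm).1, (hfact m' hm').1, hmm]
    have hc : #(A.filter (fun m => m / π m = n)) ≤ (M / n) / d + 1 := by
      rw [← card_image_of_injOn hinj]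
      refine card_le_of_modEq _ ?_ ?_
      · intro p hp
        obtain ⟨m, hm, rfl⟩ := mem_image.mp hp
        exact (hfact m hm).2.2.2.2
      · intro p hp p' hp'
        obtain ⟨m, hm, rfl⟩ := mem_image.mp hp
        obtain ⟨m', hm', rfl⟩ := mem_image.mp hp'
        obtain ⟨f1, f2, f3, _⟩ := hfact m hm
        obtain ⟨g1, g2, g3, _⟩ := hfact m' hm'
        obtain ⟨⟨c1, _, c2⟩, c3⟩ := (mem_filter.mp (mem_filter.mp hm).1).2
        have c4 := (mem_filter.mp (mem_filter.mp hm').1).2.2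
        rw [f1] at c1 c2 c3
        rw [g1] at c4
        exact modEq_of_dvd_of_dvd f2 g2 f3 g3 c1 c2 c3 c4
    have hle : d ≤ M / n := by
      have := hfact m₀ hm₀; omega
    have h1 : 1 ≤ (M / n) / d := Nat.div_pos hle hd
    have h2 : (((M / n) / d : ℕ) : ℝ) ≤ (M : ℝ) / n / d := by
      calc (((M / n) / d : ℕ) : ℝ) ≤ ((M / n : ℕ) : ℝ) / d := Nat.cast_div_le
        _ ≤ (M : ℝ) / n / d := by gcongr; exact Nat.cast_div_le
    calc (#(A.filter (fun m => m / π m = n)) : ℝ) ≤ (((M / n) / d + 1 : ℕ) : ℝ) := by exact_mod_cast hc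
      _ ≤ 2 * (((M / n) / d : ℕ) : ℝ) := by
          have : (1 : ℝ) ≤ (((M / n) / d : ℕ) : ℝ) := by exact_mod_cast h1
          push_cast at *; linarith
      _ ≤ 2 * ((M : ℝ) / n / d) := by gcongr
      _ = _ := by field_simp
  calc (#A : ℝ) = ∑ n ∈ Icc 1 M, (#{m ∈ A | m / π m = n} : ℝ) := by
        rw [card_eq_sum_card_fiberwise (f := fun m => m / π m) (t := Icc 1 M) hmaps]
        push_cast; rfl
    _ ≤ ∑ n ∈ Icc 1 M, (2 * M / d : ℝ) * (1 / n) := sum_le_sum hfib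
    _ = (2 * M / d : ℝ) * ∑ n ∈ Icc 1 M, (1 : ℝ) / n := by rw [mul_sum]
    _ ≤ (2 * M / d : ℝ) * (1 + Real.log X) := by
        gcongr
        refine (sum_Icc_inv_le M).trans ?_
        rcases Nat.eq_zero_or_pos M with h0 | h0
        · rw [h0]; simp
          exact Real.log_natCast_nonneg X
        · have : M ≤ X := Nat.div_le_self _ _
          have : Real.log M ≤ Real.log X := Real.log_le_log (by exact_mod_cast h0) (by exact_mod_cast this)
          linarith
    _ = _ := by ring

open Classical in
theorem sum_abs_discrepancy_box_le {X D w j : ℕ} (hw : 0 < w) (hD : 1 ≤ D) (hDX : D ≤ X) :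
    ∑ m ∈ boxM X D j, ∑ d ∈ roughs D w with CopAll d m,
      |(#{q ∈ boxQ X D j | d ∣ q * sP m + sD m} : ℝ) - #(boxQ X D j) / d|
      ≤ 4 * X * (1 + Real.log X) ^ 2 / Real.sqrt w * (1 / (j + 1 : ℝ)) := by
  set M := X / ((j + 1) * D ^ 8) with hM
  set Q := boxQ X D j with hQ
  set c : ℕ → ℕ → ℝ := fun d h => |(#{q ∈ Q | q % d = h} : ℝ) - #Q / d| with hc
  have hX1 : 1 ≤ X := hD.trans hDX
  have hlogX : 0 ≤ Real.log X := Real.log_natCast_nonneg X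
  have hlogD : Real.log D ≤ Real.log X :=
    Real.log_le_log (by exact_mod_cast hD) (by exact_mod_cast hDX)
  have hw' : (0 : ℝ) < w := by exact_mod_cast hw
  have hH0 : 0 < D ^ 8 := pow_pos hD 8
  have hdis : ∀ d ∈ roughs D w,
      ∑ m ∈ boxM X D j with CopAll d m, |(#{q ∈ Q | d ∣ q * sP m + sD m} : ℝ) - #Q / d|
        ≤ ∑ h ∈ range d, (2 * M * (1 + Real.log X) / d) * c d h := by
    intro d hd
    have hd' := (mem_roughs.mp hd).1
    have hres : ∀ m ∈ (boxM X D j).filter (fun m => CopAll d m),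
        ∃ r ∈ range d, ∀ q, d ∣ q * sP m + sD m ↔ q % d = r := by
      intro m hm
      obtain ⟨r, h1, h2⟩ := exists_residue (sD m) hd'.1 (mem_filter.mp hm).2.2.1
      exact ⟨r, mem_range.mpr h1, h2⟩
    choose! ρ hρ hρq using hres
    have e1 : ∑ m ∈ boxM X D j with CopAll d m, |(#{q ∈ Q | d ∣ q * sP m + sD m} : ℝ) - #Q / d|
        = ∑ m ∈ boxM X D j with CopAll d m, c d (ρ m) := by
      refine sum_congr rfl fun m hm => ?_
      simp only [hc, hρq m hm]
    rw [e1, ← sum_fiberwise_of_maps_to hρ]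
    refine sum_le_sum fun h hh => ?_
    have e2 : ∑ m ∈ ((boxM X D j).filter (fun m => CopAll d m)) with ρ m = h, c d (ρ m)
        = #{m ∈ ((boxM X D j).filter (fun m => CopAll d m)) | ρ m = h} * c d h := by
      rw [← nsmul_eq_mul, ← sum_const]
      exact sum_congr rfl fun m hm => by rw [(mem_filter.mp hm).2]
    rw [e2]
    refine mul_le_mul_of_nonneg_right ?_ (abs_nonneg _)
    refine le_trans ?_ (card_boxM_residue_le (X := X) (j := j) (h := h) hd'.1 hd'.2)
    have : {m ∈ ((boxM X D j).filter (fun m => CopAll d m)) | ρ m = h}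
        ⊆ (boxM X D j).filter (fun m => CopAll d m ∧ d ∣ h * sP m + sD m) := by
      intro m hm
      obtain ⟨hm1, hm2⟩ := mem_filter.mp hm
      obtain ⟨hm3, hm4⟩ := mem_filter.mp hm1
      refine mem_filter.mpr ⟨hm3, hm4, ?_⟩
      rw [hρq m hm1, hm2]
      exact Nat.mod_eq_of_lt (mem_range.mp hh)
    exact_mod_cast card_le_card this
  have hswap : ∑ m ∈ boxM X D j, ∑ d ∈ roughs D w with CopAll d m,
      |(#{q ∈ Q | d ∣ q * sP m + sD m} : ℝ) - #Q / d|
      = ∑ d ∈ roughs D w, ∑ m ∈ boxM X D j with CopAll d m,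
      |(#{q ∈ Q | d ∣ q * sP m + sD m} : ℝ) - #Q / d| := by
    simp only [sum_filter]
    rw [sum_comm]
  have hQint : ∀ q ∈ Q, j * D ^ 8 ≤ q ∧ q < j * D ^ 8 + D ^ 8 := by
    intro q hq
    have h1 := (mem_boxQ.mp hq).2
    have h2 : j * D ^ 8 + q % D ^ 8 = q := by rw [← h1]; exact Nat.div_add_mod' q (D ^ 8)
    have h3 := Nat.mod_lt q hH0
    constructor
    · exact h2 ▸ Nat.le_add_right _ _
    · calc q = j * D ^ 8 + q % D ^ 8 := h2.symm
        _ < _ := Nat.add_lt_add_left h3 _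
  have hQcard : #Q ≤ D ^ 8 := by
    calc #Q ≤ #(Ico (j * D ^ 8) (j * D ^ 8 + D ^ 8)) :=
          card_le_card fun q hq => mem_Ico.mpr (hQint q hq)
      _ = D ^ 8 := by simp
  have hvar := sum_variance_le (D := D) (H := D ^ 8) (w := (w : ℝ)) hw' Q hQint
    (Nat.pow_le_pow_right hD (by norm_num)) (roughs D w) (by
      intro d hd
      obtain ⟨⟨h1, h2⟩, h3⟩ := mem_roughs.mp hd
      refine ⟨h1, h2, fun e he he1 => ?_⟩
      have h4 := h3 _ (Nat.minFac_prime he1) ((Nat.minFac_dvd e).trans he)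
      have h5 : e ≠ 0 := by
        rintro rfl
        have := Nat.eq_zero_of_zero_dvd he
        omega
      have := Nat.minFac_le (Nat.pos_of_ne_zero h5)
      exact_mod_cast (by omega : w ≤ e))
  have hS : ∑ d ∈ roughs D w, ∑ h ∈ range d, (1 / (d : ℝ)) * c d h
      ≤ (1 + Real.log X) * (2 * D ^ 8 / Real.sqrt w) := by
    rw [sum_sigma' (roughs D w) (fun d => range d) (fun d h => (1 / (d : ℝ)) * c d h)]
    have hcs := sum_mul_sq_le_sq_mul_sq ((roughs D w).sigma (fun d => range d))
      (fun x => 1 / (x.1 : ℝ)) (fun x => c x.1 x.2)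
    have e1 : ∑ x ∈ (roughs D w).sigma (fun d => range d), (1 / (x.1 : ℝ)) ^ 2 ≤ 1 + Real.log X := by
      rw [sum_sigma]
      calc ∑ d ∈ roughs D w, ∑ h ∈ range d, (1 / (d : ℝ)) ^ 2 = ∑ d ∈ roughs D w, 1 / (d : ℝ) := by
            refine sum_congr rfl fun d hd => ?_
            have h1 := (mem_roughs.mp hd).1.1
            have : (d : ℝ) ≠ 0 := by positivity
            rw [sum_const, card_range, nsmul_eq_mul]; field_simp
        _ ≤ ∑ d ∈ Icc 1 D, 1 / (d : ℝ) := by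
            refine sum_le_sum_of_subset_of_nonneg ?_ fun _ _ _ => by positivity
            intro d hd
            exact mem_Icc.mpr (mem_roughs.mp hd).1
        _ ≤ 1 + Real.log D := sum_Icc_inv_le D
        _ ≤ _ := by linarith
    have e2 : ∑ x ∈ (roughs D w).sigma (fun d => range d), (c x.1 x.2) ^ 2
        ≤ (1 + Real.log X) * (2 * D ^ 8) * D ^ 8 / w := by
      rw [sum_sigma]
      simp only [hc, sq_abs]
      refine hvar.trans ?_
      have : (#Q : ℝ) ≤ (D : ℝ) ^ 8 := by exact_mod_cast hQcard
      push_cast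
      gcongr
    have e3 : (∑ x ∈ (roughs D w).sigma (fun d => range d), (1 / (x.1 : ℝ)) * c x.1 x.2) ^ 2
        ≤ ((1 + Real.log X) * (2 * D ^ 8 / Real.sqrt w)) ^ 2 := by
      calc _ ≤ _ := hcs
        _ ≤ (1 + Real.log X) * ((1 + Real.log X) * (2 * D ^ 8) * D ^ 8 / w) := by
            apply mul_le_mul e1 e2 (sum_nonneg fun _ _ => by positivity) (by linarith)
        _ ≤ _ := by
            rw [mul_pow, div_pow, Real.sq_sqrt hw'.le]
            have : (1 + Real.log X) * ((1 + Real.log X) * (2 * (D : ℝ) ^ 8) * D ^ 8 / w)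
              = (1 + Real.log X) ^ 2 * (2 * (D : ℝ) ^ 16 / w) := by ring
            rw [this]
            have : (2 * (D : ℝ) ^ 8) ^ 2 = 4 * (D : ℝ) ^ 16 := by ring
            rw [this]
            gcongr
            norm_num
    exact le_of_sq_le_sq e3 (by positivity)
  have hMH : (M : ℝ) * D ^ 8 ≤ X * (1 / (j + 1 : ℝ)) := by
    have h1 : M * ((j + 1) * D ^ 8) ≤ X := Nat.div_mul_le_self _ _
    have h2 : (M : ℝ) * ((j + 1) * (D : ℝ) ^ 8) ≤ X := by exact_mod_cast h1
    rw [mul_one_div, le_div_iff₀ (by positivity)]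
    linarith
  rw [hswap]
  calc _ ≤ ∑ d ∈ roughs D w, ∑ h ∈ range d, (2 * M * (1 + Real.log X) / d) * c d h :=
        sum_le_sum hdis
    _ = (2 * M * (1 + Real.log X)) * ∑ d ∈ roughs D w, ∑ h ∈ range d, (1 / (d : ℝ)) * c d h := by
        rw [mul_sum]
        refine sum_congr rfl fun d _ => ?_
        rw [mul_sum]
        exact sum_congr rfl fun h _ => by ring
    _ ≤ (2 * M * (1 + Real.log X)) * ((1 + Real.log X) * (2 * D ^ 8 / Real.sqrt w)) := by
        gcongr
    _ = 4 * (1 + Real.log X) ^ 2 / Real.sqrt w * (M * D ^ 8) := by ring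
    _ ≤ 4 * (1 + Real.log X) ^ 2 / Real.sqrt w * (X * (1 / (j + 1 : ℝ))) := by gcongr
    _ = _ := by ring

open Classical in
/-- Equidistribution of the congruences `q s(m) + σ(m) ≡ 0` on average over cofactors and boxes. -/
theorem sum_abs_discrepancy_le {X D w : ℕ} (hw : 0 < w) (hD : 1 ≤ D) (hDX : D ≤ X) :
    ∑ j ∈ range X, ∑ m ∈ boxM X D j, ∑ d ∈ roughs D w with CopAll d m,
      |(#{q ∈ boxQ X D j | d ∣ q * sP m + sD m} : ℝ) - #(boxQ X D j) / d|
      ≤ 4 * X * (1 + Real.log X) ^ 3 / Real.sqrt w := by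
  have hlogX : 0 ≤ Real.log X := Real.log_natCast_nonneg X
  calc _ ≤ ∑ j ∈ range X, 4 * X * (1 + Real.log X) ^ 2 / Real.sqrt w * (1 / (j + 1 : ℝ)) :=
        sum_le_sum fun j _ => sum_abs_discrepancy_box_le hw hD hDX
    _ = 4 * X * (1 + Real.log X) ^ 2 / Real.sqrt w * ∑ k ∈ Icc 1 X, (1 : ℝ) / k := by
        rw [← mul_sum]
        congr 1
        rw [← Ico_add_one_right_eq_Icc, sum_Ico_eq_sum_range]
        exact sum_congr rfl fun j _ => by push_cast; rw [add_comm]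
    _ ≤ 4 * X * (1 + Real.log X) ^ 2 / Real.sqrt w * (1 + Real.log X) := by
        gcongr
        exact sum_Icc_inv_le X
    _ = _ := by ring

/-- The sum of the reciprocals of the auxiliary primes. -/
noncomputable def auxMass (X D : ℕ) : ℝ := ∑ q ∈ auxP X D, (1 : ℝ) / q

theorem auxMass_nonneg (X D : ℕ) : 0 ≤ auxMass X D := sum_nonneg fun _ _ => by positivity

theorem card_multiples (X d : ℕ) : #{n ∈ Icc 1 X | d ∣ n} = X / d := by
  have := Nat.Ioc_filter_dvd_card_eq_div X d
  rw [← this]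
  rfl

theorem card_multiples_le (X d : ℕ) : (#{n ∈ Icc 1 X | d ∣ n} : ℝ) ≤ X / d := by
  rw [card_multiples]; exact Nat.cast_div_le

theorem card_auxP_le (X D : ℕ) : #(auxP X D) ≤ X := by
  calc #(auxP X D) ≤ #(Ioc (D ^ 16) (Nat.sqrt X)) := card_filter_le _ _
    _ ≤ Nat.sqrt X := by simp
    _ ≤ X := Nat.sqrt_le_self X

/-- Turán's variance inequality for the number of auxiliary prime divisors. -/
theorem turan_variance_le (X D : ℕ) :
    ∑ n ∈ Icc 1 X, ((#{q ∈ auxP X D | q ∣ n} : ℝ) - auxMass X D) ^ 2 ≤ 3 * X * auxMass X D := by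
  set J := auxP X D with hJ
  set μ := auxMass X D with hμ
  have hμ0 : 0 ≤ μ := auxMass_nonneg X D
  set g : ℕ → ℕ → ℝ := fun q n => if q ∣ n then 1 else 0 with hg
  have hf : ∀ n, (#{q ∈ J | q ∣ n} : ℝ) = ∑ q ∈ J, g q n := by
    intro n; simp [hg]
  have hcount : ∀ d, ∑ n ∈ Icc 1 X, g d n = ((X / d : ℕ) : ℝ) := by
    intro d
    rw [← card_multiples]; simp [hg]
  have h1 : ∑ n ∈ Icc 1 X, (∑ q ∈ J, g q n) ^ 2 ≤ X * μ ^ 2 + X * μ := by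
    calc ∑ n ∈ Icc 1 X, (∑ q ∈ J, g q n) ^ 2
        = ∑ q ∈ J, ∑ q' ∈ J, ∑ n ∈ Icc 1 X, g q n * g q' n := by
          simp only [sq, sum_mul_sum]
          rw [sum_comm]
          exact sum_congr rfl fun q _ => sum_comm
      _ ≤ ∑ q ∈ J, ∑ q' ∈ J, (X * ((1 : ℝ) / q * (1 / q')) + if q = q' then (X : ℝ) / q else 0) := by
          refine sum_le_sum fun q hq => sum_le_sum fun q' hq' => ?_
          have hp := (mem_auxP.mp hq).2
          have hp' := (mem_auxP.mp hq').2
          by_cases h : q = q'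
          · subst h
            have : ∀ n, g q n * g q n = g q n := by
              intro n; simp only [hg]; split_ifs <;> simp
            simp only [this, hcount, if_true]
            have : ((X / q : ℕ) : ℝ) ≤ X / q := Nat.cast_div_le
            have : (0 : ℝ) ≤ X * ((1 : ℝ) / q * (1 / q)) := by positivity
            linarith
          · have hc : q.Coprime q' := (Nat.coprime_primes hp hp').mpr h
            have : ∀ n, g q n * g q' n = g (q * q') n := by
              intro n; simp only [hg]
              by_cases h1 : q ∣ n <;> by_cases h2 : q' ∣ n
              · simp [h1, h2, hc.mul_dvd_of_dvd_of_dvd h1 h2]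
              · simp [h2, show ¬ q * q' ∣ n from fun h => h2 ((dvd_mul_left _ _).trans h)]
              · simp [h1, show ¬ q * q' ∣ n from fun h => h1 ((dvd_mul_right _ _).trans h)]
              · simp [h1, show ¬ q * q' ∣ n from fun h => h1 ((dvd_mul_right _ _).trans h)]
            simp only [this, hcount, h, if_false, add_zero]
            refine Nat.cast_div_le.trans (le_of_eq ?_)
            push_cast
            field_simp
      _ = X * μ ^ 2 + X * μ := by
          simp only [sum_add_distrib, ← mul_sum, sum_ite_eq, ← sum_mul]
          rw [sum_congr rfl (fun q hq => if_pos hq)]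
          rw [hμ, auxMass, ← hJ, sq, mul_sum (s := J) (a := (X : ℝ))]
          congr 1
          exact sum_congr rfl fun q _ => by ring
  have h2 : X * μ - X ≤ ∑ n ∈ Icc 1 X, ∑ q ∈ J, g q n := by
    rw [sum_comm]
    simp only [hcount]
    calc X * μ - X ≤ X * μ - #J := by
          have := card_auxP_le X D
          rw [← hJ] at this
          have : (#J : ℝ) ≤ X := by exact_mod_cast this
          linarith
      _ = ∑ q ∈ J, ((X : ℝ) / q - 1) := by
          rw [sum_sub_distrib, hμ, auxMass, mul_sum]
          simp [div_eq_mul_inv, hJ]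
      _ ≤ _ := by
          refine sum_le_sum fun q _ => ?_
          have := Nat.lt_floor_add_one ((X : ℝ) / q)
          rw [Nat.floor_div_eq_div] at this
          linarith
  simp only [hf]
  have h3 : ∑ n ∈ Icc 1 X, ((∑ q ∈ J, g q n) - μ) ^ 2
      = ∑ n ∈ Icc 1 X, (∑ q ∈ J, g q n) ^ 2 - 2 * μ * ∑ n ∈ Icc 1 X, (∑ q ∈ J, g q n) + X * μ ^ 2 := by
    have : ∀ n, ((∑ q ∈ J, g q n) - μ) ^ 2
      = (∑ q ∈ J, g q n) ^ 2 - 2 * μ * (∑ q ∈ J, g q n) + μ ^ 2 := fun n => by ring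
    simp only [this, sum_add_distrib, sum_sub_distrib, ← mul_sum]
    simp
  rw [h3]
  have := mul_le_mul_of_nonneg_left h2 (by positivity : 0 ≤ 2 * μ)
  nlinarith

theorem sum_abs_turan_le (X D : ℕ) :
    ∑ n ∈ Icc 1 X, |(#{q ∈ auxP X D | q ∣ n} : ℝ) - auxMass X D|
      ≤ X * Real.sqrt (3 * auxMass X D) := by
  have h := sum_mul_sq_le_sq_mul_sq (Icc 1 X) (fun _ => (1 : ℝ))
    (fun n => |(#{q ∈ auxP X D | q ∣ n} : ℝ) - auxMass X D|)
  have h2 := turan_variance_le X D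
  have h0 := auxMass_nonneg X D
  simp only [one_mul, sq_abs, one_pow, sum_const, Nat.card_Icc, Nat.add_sub_cancel, nsmul_eq_mul,
    mul_one] at h
  refine le_of_sq_le_sq (h.trans ?_) (by positivity)
  rw [mul_pow, Real.sq_sqrt (by positivity)]
  calc _ ≤ (X : ℝ) * (3 * X * auxMass X D) := by gcongr
    _ = _ := by ring

/-- The sum of `ℱ m q` over all admissible pairs. -/
noncomputable def pairSum {E : Type*} [AddCommMonoid E] (X D : ℕ) (ℱ : ℕ → ℕ → E) : E :=
  ∑ j ∈ range X, ∑ m ∈ boxM X D j, ∑ q ∈ boxQ X D j, ℱ m q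

theorem pairSum_eq {E : Type*} [AddCommMonoid E] {X D : ℕ} (hD : 2 ≤ D) (ℱ : ℕ → ℕ → E) :
    pairSum X D ℱ = ∑ q ∈ auxP X D, ∑ m ∈ boxM X D (q / D ^ 8), ℱ m q := by
  have hmaps : ∀ q ∈ auxP X D, q / D ^ 8 ∈ range X := by
    intro q hq
    have h := mem_auxP.mp hq
    rw [mem_range]
    calc q / D ^ 8 < q := Nat.div_lt_self h.2.pos (Nat.one_lt_pow (by norm_num) hD)
      _ ≤ X := h.1.2.trans (Nat.sqrt_le_self X)
  rw [← sum_fiberwise_of_maps_to hmaps]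
  refine sum_congr rfl fun j _ => ?_
  rw [sum_comm]
  refine sum_congr rfl fun q hq => ?_
  rw [(mem_boxQ.mp hq).2]

theorem boxM_subset {X D q : ℕ} (hD : 2 ≤ D) (hq : 0 < q) : boxM X D (q / D ^ 8) ⊆ Icc 1 (X / q) := by
  intro m hm
  obtain ⟨⟨h1, h2⟩, _⟩ := mem_boxM.mp hm
  refine mem_Icc.mpr ⟨h1, h2.trans (Nat.div_le_div_left ?_ hq)⟩
  have := Nat.lt_div_mul_add (a := q) (b := D ^ 8) (by positivity)
  rw [add_mul, one_mul]; exact this.le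

theorem sum_inv_sq_gt_le (D N : ℕ) (hD : 1 ≤ D) : ∑ k ∈ Ioc D N, (1 : ℝ) / (k : ℝ) ^ 2 ≤ 1 / D := by
  rcases le_or_gt N D with h | h
  · rw [Ioc_eq_empty (by omega), sum_empty]; positivity
  have h1 := sum_Ioc_inv_sq_le_sub (α := ℝ) (k := D) (n := N) (by omega) h.le
  have : (0 : ℝ) ≤ (N : ℝ)⁻¹ := by positivity
  simp only [one_div]
  linarith

open Classical in
theorem card_sq_dvd_le (N D : ℕ) (hD : 1 ≤ D) :
    (#{m ∈ Icc 1 N | ∃ k, D < k ∧ k ^ 2 ∣ m} : ℝ) ≤ N / D := by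
  have hsub : {m ∈ Icc 1 N | ∃ k, D < k ∧ k ^ 2 ∣ m}
      ⊆ (Ioc D N).biUnion (fun k => {m ∈ Icc 1 N | k ^ 2 ∣ m}) := by
    intro m hm
    obtain ⟨h1, k, h2, h3⟩ := mem_filter.mp hm
    obtain ⟨h4, h5⟩ := mem_Icc.mp h1
    refine mem_biUnion.mpr ⟨k, mem_Ioc.mpr ⟨h2, ?_⟩, mem_filter.mpr ⟨h1, h3⟩⟩
    have := Nat.le_of_dvd h4 h3
    have := Nat.le_self_pow (n := 2) (by norm_num) k
    omega
  calc (#{m ∈ Icc 1 N | ∃ k, D < k ∧ k ^ 2 ∣ m} : ℝ)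
      ≤ ∑ k ∈ Ioc D N, (#{m ∈ Icc 1 N | k ^ 2 ∣ m} : ℝ) := by
        exact_mod_cast (card_le_card hsub).trans card_biUnion_le
    _ ≤ ∑ k ∈ Ioc D N, (N : ℝ) * (1 / (k : ℝ) ^ 2) := by
        refine sum_le_sum fun k _ => (card_multiples_le N (k ^ 2)).trans (le_of_eq ?_)
        push_cast; ring
    _ = N * ∑ k ∈ Ioc D N, (1 : ℝ) / (k : ℝ) ^ 2 := by rw [mul_sum]
    _ ≤ N * (1 / D) := by gcongr; exact sum_inv_sq_gt_le D N hD
    _ = _ := by ring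

open Classical in
theorem card_sdiff_boxM_le {X D q : ℕ} (hD : 2 ≤ D) (hq : q ∈ auxP X D) :
    (#(Icc 1 (X / q) \ boxM X D (q / D ^ 8)) : ℝ)
      ≤ 3 / D * (X / q) + #{m ∈ Icc 1 (X / q) | ∀ p ∈ auxP X D, ¬ p ∣ m} := by
  obtain ⟨⟨hq1, hq2⟩, hqp⟩ := mem_auxP.mp hq
  set M := X / ((q / D ^ 8 + 1) * D ^ 8) with hM
  have hsub : Icc 1 (X / q) \ boxM X D (q / D ^ 8) ⊆
      (Ioc M (X / q) ∪ {m ∈ Icc 1 (X / q) | ∃ k, D < k ∧ k ^ 2 ∣ m}) ∪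
        {m ∈ Icc 1 (X / q) | ∀ p ∈ auxP X D, ¬ p ∣ m} := by
    intro m hm
    obtain ⟨h1, h2⟩ := mem_sdiff.mp hm
    obtain ⟨h3, h4⟩ := mem_Icc.mp h1
    rw [mem_boxM] at h2
    simp only [mem_union, mem_filter, mem_Ioc]
    by_contra! hcon
    obtain ⟨⟨c1, c2⟩, c3⟩ := hcon
    apply h2
    refine ⟨⟨h3, ?_⟩, fun p _ hp => c2 h1 p hp, c3 h1⟩
    by_contra! h5
    exact absurd (c1 h5) (by omega)
  have hD0 : (0 : ℝ) < D := by exact_mod_cast (by omega : 0 < D)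
  have hD2 : (2 : ℝ) ≤ D := by exact_mod_cast hD
  have hq0 : (0 : ℝ) < q := by exact_mod_cast hqp.pos
  have hqD : (D : ℝ) ^ 16 ≤ q := by exact_mod_cast hq1.le
  have hqq : (q : ℝ) * q ≤ X := by exact_mod_cast Nat.le_sqrt.mp hq2
  have hI : (#(Ioc M (X / q)) : ℝ) ≤ 2 / D * (X / q) := by
    have h1 : (X / q : ℕ) ≤ (X : ℝ) / q := Nat.cast_div_le
    have h2 : (X : ℝ) / (q + (D : ℝ) ^ 8) - 1 ≤ (M : ℝ) := by
      have h3 := Nat.lt_floor_add_one ((X : ℝ) / ((((q / D ^ 8 + 1) * D ^ 8 : ℕ)) : ℝ))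
      rw [Nat.floor_div_eq_div, ← hM] at h3
      have h4 : ((((q / D ^ 8 + 1) * D ^ 8 : ℕ)) : ℝ) ≤ q + (D : ℝ) ^ 8 := by
        have : (q / D ^ 8 + 1) * D ^ 8 ≤ q + D ^ 8 := by
          rw [add_mul, one_mul]; exact Nat.add_le_add_right (Nat.div_mul_le_self _ _) _
        exact_mod_cast this
      have h5 : (X : ℝ) / (q + (D : ℝ) ^ 8) ≤ (X : ℝ) / ((((q / D ^ 8 + 1) * D ^ 8 : ℕ)) : ℝ) := by
        apply div_le_div_of_nonneg_left (by positivity) _ h4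
        have : 0 < (q / D ^ 8 + 1) * D ^ 8 := by positivity
        exact_mod_cast this
      linarith
    have h3 : (X : ℝ) / q - X / (q + (D : ℝ) ^ 8) ≤ (X / q) * (1 / (D : ℝ) ^ 8) := by
      have e : (X : ℝ) / q - X / (q + (D : ℝ) ^ 8) = (X / q) * ((D : ℝ) ^ 8 / (q + (D : ℝ) ^ 8)) := by
        field_simp; ring
      rw [e]
      apply mul_le_mul_of_nonneg_left _ (by positivity)
      rw [div_le_div_iff₀ (by positivity) (by positivity)]
      nlinarith [pow_pos hD0 8]
    have h4 : (1 : ℝ) ≤ (X / q) * (1 / (D : ℝ) ^ 8) := by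
      rw [mul_one_div, le_div_iff₀ (by positivity), le_div_iff₀ hq0]
      have : (D : ℝ) ^ 8 ≤ D ^ 16 := pow_le_pow_right₀ (by linarith) (by norm_num)
      nlinarith
    have h5 : (1 : ℝ) / (D : ℝ) ^ 8 ≤ 1 / D := by
      apply one_div_le_one_div_of_le hD0
      exact le_self_pow₀ (by linarith) (by norm_num)
    have h6 : (X : ℝ) / q * (1 / (D : ℝ) ^ 8) ≤ X / q * (1 / D) := by gcongr
    rw [Nat.card_Ioc]
    have h7 : ((X / q - M : ℕ) : ℝ) ≤ max 0 ((X / q : ℕ) - (M : ℝ)) := by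
      rcases le_total M (X / q) with h | h
      · rw [Nat.cast_sub h]; exact le_max_right _ _
      · rw [Nat.sub_eq_zero_of_le h]; simp
    refine h7.trans (max_le (by positivity) ?_)
    have : 2 / (D : ℝ) * (X / q) = X / q * (1 / D) + X / q * (1 / D) := by ring
    linarith
  have hII : (#{m ∈ Icc 1 (X / q) | ∃ k, D < k ∧ k ^ 2 ∣ m} : ℝ) ≤ 1 / D * (X / q) := by
    refine (card_sq_dvd_le (X / q) D (by omega)).trans ?_
    rw [div_eq_mul_one_div, mul_comm]
    gcongr
    exact Nat.cast_div_le
  have h := (card_le_card hsub).trans ((card_union_le _ _).trans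
    (Nat.add_le_add_right (card_union_le _ _) _))
  have h' : (#(Icc 1 (X / q) \ boxM X D (q / D ^ 8)) : ℝ) ≤
    #(Ioc M (X / q)) + #{m ∈ Icc 1 (X / q) | ∃ k, D < k ∧ k ^ 2 ∣ m}
     + #{m ∈ Icc 1 (X / q) | ∀ p ∈ auxP X D, ¬ p ∣ m} := by exact_mod_cast h
  have : 3 / (D : ℝ) * (X / q) = 2 / D * (X / q) + 1 / D * (X / q) := by ring
  linarith

open Classical in
theorem sum_card_no_aux_factor_le (X D : ℕ) :
    ∑ q ∈ auxP X D, #{m ∈ Icc 1 (X / q) | ∀ p ∈ auxP X D, ¬ p ∣ m} ≤ X := by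
  rw [← card_sigma]
  calc _ ≤ #(Icc 1 X) := by
        refine card_le_card_of_injOn (fun x => x.2 * x.1) ?_ ?_
        · rintro ⟨q, m⟩ hx
          obtain ⟨h1, h2⟩ := mem_sigma.mp hx
          have hp := (mem_auxP.mp h1).2
          obtain ⟨h3, h4⟩ := mem_Icc.mp (mem_filter.mp h2).1
          simp only [coe_Icc, Set.mem_Icc]
          exact ⟨Nat.mul_pos h3 hp.pos, (Nat.le_div_iff_mul_le hp.pos).mp h4⟩
        · rintro ⟨q, m⟩ hx ⟨q', m'⟩ hx' h
          obtain ⟨h1, h2⟩ := mem_sigma.mp hx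
          obtain ⟨h1', h2'⟩ := mem_sigma.mp hx'
          simp only at h h1 h1' h2 h2'
          have hp := (mem_auxP.mp h1).2
          have hp' := (mem_auxP.mp h1').2
          have hqq : q = q' := by
            have : q ∣ m' * q' := ⟨m, by rw [← h, mul_comm]⟩
            rcases (Nat.Prime.dvd_mul hp).mp this with h3 | h3
            · exact absurd h3 ((mem_filter.mp h2').2 q h1)
            · exact (Nat.prime_dvd_prime_iff_eq hp hp').mp h3
          subst hqq
          have := Nat.eq_of_mul_eq_mul_right hp.pos h
          subst this
          rfl
    _ = X := by simp

theorem sum_mul_card_eq_sum_pairs (X D : ℕ) (F : ℕ → ℂ) :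
    ∑ n ∈ Icc 1 X, (#{q ∈ auxP X D | q ∣ n} : ℂ) * F n
      = ∑ q ∈ auxP X D, ∑ m ∈ Icc 1 (X / q), F (m * q) := by
  have h1 : ∀ n, (#{q ∈ auxP X D | q ∣ n} : ℂ) * F n = ∑ q ∈ auxP X D, if q ∣ n then F n else 0 := by
    intro n
    rw [← sum_filter, sum_const, nsmul_eq_mul]
  simp only [h1]
  rw [sum_comm]
  refine sum_congr rfl fun q hq => ?_
  have hp := (mem_auxP.mp hq).2
  rw [← sum_filter]
  symm
  refine sum_bij (fun m _ => m * q) ?_ ?_ ?_ ?_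
  · intro m hm
    obtain ⟨h3, h4⟩ := mem_Icc.mp hm
    exact mem_filter.mpr ⟨mem_Icc.mpr ⟨Nat.mul_pos h3 hp.pos, (Nat.le_div_iff_mul_le hp.pos).mp h4⟩,
      dvd_mul_left _ _⟩
  · intro m _ m' _ h
    exact Nat.eq_of_mul_eq_mul_right hp.pos h
  · intro n hn
    obtain ⟨h1, m, rfl⟩ := mem_filter.mp hn
    obtain ⟨h3, h4⟩ := mem_Icc.mp h1
    refine ⟨m, mem_Icc.mpr ⟨Nat.pos_of_mul_pos_left h3, ?_⟩, mul_comm _ _⟩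
    rw [Nat.le_div_iff_mul_le hp.pos, mul_comm]; exact h4
  · intro m _; rfl

/-- Averages over `n ≤ X` agree with averages over admissible pairs, up to a small error. -/
theorem norm_sum_sub_pairSum_le {X D : ℕ} (hD : 2 ≤ D) (F : ℕ → ℂ) (ℱ : ℕ → ℕ → ℂ)
    (hF : ∀ n, ‖F n‖ ≤ 1) (hℱ : ∀ m q, ‖ℱ m q‖ ≤ 1)
    (h : ∀ m, ∀ q ∈ auxP X D, m ∈ boxM X D (q / D ^ 8) → ¬ q ∣ m → ℱ m q = F (m * q)) :
    ‖auxMass X D * ∑ n ∈ Icc 1 X, F n - pairSum X D ℱ‖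
      ≤ X * Real.sqrt (3 * auxMass X D) + 5 / D * X * auxMass X D + X := by
  classical
  set μ := auxMass X D with hμ
  have hD0 : (0 : ℝ) < D := by exact_mod_cast (by omega : 0 < D)
  have hD1 : (1 : ℝ) ≤ D := by exact_mod_cast (by omega : 1 ≤ D)
  have h1 : ‖μ * ∑ n ∈ Icc 1 X, F n - ∑ q ∈ auxP X D, ∑ m ∈ Icc 1 (X / q), F (m * q)‖
      ≤ X * Real.sqrt (3 * μ) := by
    rw [← sum_mul_card_eq_sum_pairs, mul_sum, ← sum_sub_distrib]
    refine (norm_sum_le _ _).trans (le_trans (sum_le_sum fun n _ => ?_) (sum_abs_turan_le X D))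
    rw [← sub_mul, norm_mul]
    have : ‖(μ : ℂ) - (#{q ∈ auxP X D | q ∣ n} : ℂ)‖ = |(#{q ∈ auxP X D | q ∣ n} : ℝ) - μ| := by
      rw [abs_sub_comm, ← Real.norm_eq_abs, ← Complex.norm_real]
      push_cast
      rfl
    rw [this]
    exact mul_le_of_le_one_right (abs_nonneg _) (hF n)
  have h2 : ‖∑ q ∈ auxP X D, ∑ m ∈ Icc 1 (X / q), F (m * q) - pairSum X D ℱ‖
      ≤ ∑ q ∈ auxP X D, (5 / D * (X / q) + #{m ∈ Icc 1 (X / q) | ∀ p ∈ auxP X D, ¬ p ∣ m} : ℝ) := by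
    rw [pairSum_eq hD, ← sum_sub_distrib]
    refine (norm_sum_le _ _).trans (sum_le_sum fun q hq => ?_)
    obtain ⟨⟨hq1, hq2⟩, hqp⟩ := mem_auxP.mp hq
    have hq0 : (0 : ℝ) < q := by exact_mod_cast hqp.pos
    rw [← sum_sdiff (boxM_subset (X := X) hD hqp.pos), add_sub_assoc, ← sum_sub_distrib]
    refine (norm_add_le _ _).trans ?_
    have e1 : ‖∑ m ∈ Icc 1 (X / q) \ boxM X D (q / D ^ 8), F (m * q)‖
        ≤ #(Icc 1 (X / q) \ boxM X D (q / D ^ 8)) := by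
      refine (norm_sum_le _ _).trans ((sum_le_sum fun m _ => hF _).trans (le_of_eq ?_))
      simp
    have e2 : ‖∑ m ∈ boxM X D (q / D ^ 8), (F (m * q) - ℱ m q)‖ ≤ 2 / D * (X / q) := by
      calc _ ≤ ∑ m ∈ boxM X D (q / D ^ 8), (if q ∣ m then (2 : ℝ) else 0) := by
            refine (norm_sum_le _ _).trans (sum_le_sum fun m hm => ?_)
            split_ifs with hqm
            · exact (norm_sub_le _ _).trans (by linarith [hF (m * q), hℱ m q])
            · rw [h m q hq hm hqm, sub_self, norm_zero]
        _ ≤ ∑ m ∈ Icc 1 (X / q), (if q ∣ m then (2 : ℝ) else 0) :=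
            sum_le_sum_of_subset_of_nonneg (boxM_subset hD hqp.pos) fun _ _ _ => by
              split_ifs <;> norm_num
        _ = #{m ∈ Icc 1 (X / q) | q ∣ m} * 2 := by rw [← sum_filter, sum_const, nsmul_eq_mul]
        _ ≤ (X / q : ℝ) / q * 2 := by
            gcongr
            refine (card_multiples_le _ _).trans ?_
            gcongr
            exact Nat.cast_div_le
        _ = 2 / q * (X / q) := by ring
        _ ≤ _ := by
            gcongr
            have : D ≤ D ^ 16 := Nat.le_self_pow (by norm_num) D
            have : D ≤ q := by omega
            exact_mod_cast this
    have e3 := card_sdiff_boxM_le hD hq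
    have : 5 / (D : ℝ) * (X / q) = 3 / D * (X / q) + 2 / D * (X / q) := by ring
    linarith
  have h3 : ∑ q ∈ auxP X D, (5 / D * (X / q) + #{m ∈ Icc 1 (X / q) | ∀ p ∈ auxP X D, ¬ p ∣ m} : ℝ)
      ≤ 5 / D * X * μ + X := by
    rw [sum_add_distrib]
    refine add_le_add (le_of_eq ?_) (by exact_mod_cast sum_card_no_aux_factor_le X D)
    rw [hμ, auxMass, mul_sum]
    exact sum_congr rfl fun q _ => by ring
  calc _ = ‖(μ * ∑ n ∈ Icc 1 X, F n - ∑ q ∈ auxP X D, ∑ m ∈ Icc 1 (X / q), F (m * q))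
        + (∑ q ∈ auxP X D, ∑ m ∈ Icc 1 (X / q), F (m * q) - pairSum X D ℱ)‖ := by congr 1; ring
    _ ≤ _ := norm_add_le _ _
    _ ≤ _ := by linarith

theorem norm_pow_sub_sum_choose_le {y : ℂ} (hy : ‖1 + y‖ = 1) (N K : ℕ) :
    ‖(1 + y) ^ N - ∑ k ∈ range K, (N.choose k : ℂ) * y ^ k‖ ≤ N.choose K * ‖y‖ ^ K := by
  induction N generalizing K with
  | zero =>
    cases K with
    | zero => simp
    | succ K => rw [sum_range_succ']; simp
  | succ N ih =>
    cases K with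
    | zero => simp [hy]
    | succ K =>
      have e : (1 + y) ^ (N + 1) - ∑ k ∈ range (K + 1), ((N + 1).choose k : ℂ) * y ^ k
          = ((1 + y) ^ N - ∑ k ∈ range (K + 1), (N.choose k : ℂ) * y ^ k)
            + y * ((1 + y) ^ N - ∑ k ∈ range K, (N.choose k : ℂ) * y ^ k) := by
        rw [sum_range_succ', sum_range_succ' (fun k => (N.choose k : ℂ) * y ^ k), mul_sub, mul_sum]
        simp only [Nat.choose_succ_succ, Nat.cast_add, add_mul, sum_add_distrib, pow_succ]
        have : ∑ x ∈ range K, (N.choose x : ℂ) * (y ^ x * y)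
          = ∑ x ∈ range K, y * ((N.choose x : ℂ) * y ^ x) :=
          sum_congr rfl fun x _ => by ring
        rw [this]
        simp
        ring
      rw [e]
      refine (norm_add_le _ _).trans ?_
      rw [norm_mul]
      have h1 := ih (K + 1)
      have h2 := mul_le_mul_of_nonneg_left (ih K) (norm_nonneg y)
      rw [Nat.choose_succ_succ]
      push_cast
      calc _ ≤ _ := add_le_add h1 h2
        _ = _ := by ring

theorem sum_choose_eq_sum_subsets {R : Type*} [CommRing R] (A : Finset ℕ) (T : Finset ℕ) (hT : T ⊆ A) (k : ℕ)
    (P : Finset ℕ → Prop) [DecidablePred P] (hP : ∀ S ⊆ A, P S ↔ S ⊆ T) :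
    ((#T).choose k : R) = ∑ S ∈ A.powersetCard k, if P S then 1 else 0 := by
  rw [← card_powersetCard, ← sum_filter, sum_const, nsmul_eq_mul, mul_one]
  congr 2
  ext S
  simp only [mem_powersetCard, mem_filter]
  constructor
  · rintro ⟨h1, h2⟩
    exact ⟨⟨h1.trans hT, h2⟩, (hP S (h1.trans hT)).mpr h1⟩
  · rintro ⟨⟨h1, h2⟩, h3⟩
    exact ⟨(hP S h1).mp h3, h2⟩

theorem prod_dvd_iff_subset {A : Finset ℕ} (hA : ∀ p ∈ A, p.Prime) (v : ℕ) {S : Finset ℕ} (hS : S ⊆ A) :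
    (∏ p ∈ S, p) ∣ v ↔ S ⊆ A.filter (fun p => p ∣ v) := by
  constructor
  · intro h p hp
    exact mem_filter.mpr ⟨hS hp, (dvd_prod_of_mem _ hp).trans h⟩
  · intro h
    exact prod_primes_dvd v (fun p hp => (hA p (hS hp)).prime) fun p hp => (mem_filter.mp (h hp)).2

/-- Truncated inclusion–exclusion for the characteristic function of a sum of divisibility
indicators. -/
theorem norm_sum_pow_sub_prod_le {y : ℂ} (hy : ‖1 + y‖ = 1) (hy1 : ‖y‖ ≤ 1) (Q A : Finset ℕ)
    (hA : ∀ p ∈ A, p.Prime) (v : ℕ → ℕ) (K : ℕ) :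
    ‖∑ q ∈ Q, (1 + y) ^ #{r ∈ A | r ∣ v q} - #Q * ∏ r ∈ A, (1 + y / r)‖
      ≤ ∑ S ∈ A.powerset with #S ≤ K, |(#{q ∈ Q | (∏ p ∈ S, p) ∣ v q} : ℝ) - #Q / (∏ p ∈ S, p : ℕ)|
        + 2 * #Q * ((1 / 2) ^ K * ∏ r ∈ A, (1 + 2 * ‖y‖ / r)) := by
  set d : Finset ℕ → ℕ := fun S => ∏ p ∈ S, p with hd
  set β : Finset ℕ → ℝ := fun S => (#{q ∈ Q | d S ∣ v q} : ℝ) with hβ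
  set B : ℝ := ((#Q : ℕ) : ℝ) with hB
  have hB0 : 0 ≤ B := by positivity
  have hβ' : ∀ S, (β S : ℂ) = ∑ q ∈ Q, if d S ∣ v q then (1 : ℂ) else 0 := by
    intro S; simp [hβ]
  have hβ'' : ∀ S, β S = ∑ q ∈ Q, if d S ∣ v q then (1 : ℝ) else 0 := by
    intro S; simp [hβ]
  have hlow : ∀ q, ∑ k ∈ range K, ((#{r ∈ A | r ∣ v q}).choose k : ℂ) * y ^ k
      = ∑ S ∈ A.powerset with #S < K, y ^ #S * (if d S ∣ v q then (1 : ℂ) else 0) := by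
    intro q
    have hmaps : ∀ S ∈ A.powerset.filter (fun S => #S < K), #S ∈ range K := fun S hS =>
      mem_range.mpr (mem_filter.mp hS).2
    rw [← sum_fiberwise_of_maps_to hmaps]
    refine sum_congr rfl fun k hk => ?_
    rw [sum_choose_eq_sum_subsets A _ (filter_subset _ _) k (fun S => d S ∣ v q)
      (fun S hS => prod_dvd_iff_subset hA (v q) hS), sum_mul]
    refine sum_congr ?_ ?_
    · ext S
      have := mem_range.mp hk
      simp only [mem_powersetCard, mem_filter, mem_powerset]
      constructor
      · rintro ⟨h1, h2⟩; exact ⟨⟨h1, by omega⟩, h2⟩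
      · rintro ⟨⟨h1, _⟩, h2⟩; exact ⟨h1, h2⟩
    · intro S hS
      rw [(mem_filter.mp hS).2, mul_comm]
  have hhigh : ∀ q, ((#{r ∈ A | r ∣ v q}).choose K : ℝ)
      = ∑ S ∈ A.powerset with #S = K, (if d S ∣ v q then (1 : ℝ) else 0) := by
    intro q
    rw [sum_choose_eq_sum_subsets A _ (filter_subset _ _) K (fun S => d S ∣ v q)
      (fun S hS => prod_dvd_iff_subset hA (v q) hS)]
    rw [powersetCard_eq_filter]
  have hprod : ∏ r ∈ A, (1 + y / r) = ∑ S ∈ A.powerset, y ^ #S / (d S : ℂ) := by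
    rw [prod_one_add]
    refine sum_congr rfl fun S _ => ?_
    rw [prod_div_distrib, prod_const, hd]; push_cast; rfl
  have hprod' : ∏ r ∈ A, (1 + 2 * ‖y‖ / r) = ∑ S ∈ A.powerset, (2 * ‖y‖) ^ #S / (d S : ℝ) := by
    rw [prod_one_add]
    refine sum_congr rfl fun S _ => ?_
    rw [prod_div_distrib, prod_const, hd]; push_cast; rfl
  set tail : ℝ := ∑ S ∈ A.powerset with K ≤ #S, ‖y‖ ^ #S / (d S : ℝ) with htail
  have htail_le : tail ≤ (1 / 2) ^ K * ∏ r ∈ A, (1 + 2 * ‖y‖ / r) := by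
    rw [hprod', mul_sum, htail]
    calc _ ≤ ∑ S ∈ A.powerset with K ≤ #S, (1 / 2) ^ K * ((2 * ‖y‖) ^ #S / (d S : ℝ)) := by
          refine sum_le_sum fun S hS => ?_
          have hK := (mem_filter.mp hS).2
          rw [← mul_div_assoc]
          gcongr
          rw [mul_pow, ← mul_assoc]
          refine le_mul_of_one_le_left (by positivity) ?_
          rw [one_div, inv_pow, ← div_eq_inv_mul, one_le_div (by positivity)]
          exact pow_le_pow_right₀ (by norm_num) hK
      _ ≤ _ := sum_le_sum_of_subset_of_nonneg (filter_subset _ _) fun _ _ _ => by positivity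
  set δ : Finset ℕ → ℝ := fun S => |β S - B / (d S : ℕ)| with hδ
  have E1 : ‖∑ q ∈ Q, (1 + y) ^ #{r ∈ A | r ∣ v q}
      - ∑ S ∈ A.powerset with #S < K, y ^ #S * (β S : ℂ)‖
      ≤ ∑ S ∈ A.powerset with #S = K, δ S + B * tail := by
    have e1 : ∑ S ∈ A.powerset with #S < K, y ^ #S * (β S : ℂ)
        = ∑ q ∈ Q, ∑ k ∈ range K, ((#{r ∈ A | r ∣ v q}).choose k : ℂ) * y ^ k := by
      simp only [hlow, hβ', mul_sum]
      rw [sum_comm]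
    rw [e1, ← sum_sub_distrib]
    calc _ ≤ ∑ q ∈ Q, ((#{r ∈ A | r ∣ v q}).choose K : ℝ) * ‖y‖ ^ K :=
          (norm_sum_le _ _).trans (sum_le_sum fun q _ => norm_pow_sub_sum_choose_le hy _ _)
      _ = ∑ S ∈ A.powerset with #S = K, β S * ‖y‖ ^ K := by
          simp only [hhigh, hβ'', sum_mul]
          rw [sum_comm]
      _ ≤ ∑ S ∈ A.powerset with #S = K, (δ S + B * (‖y‖ ^ #S / (d S : ℝ))) := by
          refine sum_le_sum fun S hS => ?_
          rw [(mem_filter.mp hS).2]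
          have h1 : β S - B / d S ≤ δ S := le_abs_self _
          have h2 : ‖y‖ ^ K ≤ 1 := pow_le_one₀ (norm_nonneg _) hy1
          have h3 : 0 ≤ δ S := abs_nonneg _
          have h4 : 0 ≤ ‖y‖ ^ K := by positivity
          calc β S * ‖y‖ ^ K ≤ (δ S + B / d S) * ‖y‖ ^ K := by gcongr; linarith
            _ = δ S * ‖y‖ ^ K + B * (‖y‖ ^ K / d S) := by ring
            _ ≤ _ := by gcongr; exact mul_le_of_le_one_right h3 h2
      _ ≤ _ := by
          rw [sum_add_distrib, ← mul_sum]
          gcongr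
          refine sum_le_sum_of_subset_of_nonneg ?_ fun _ _ _ => by positivity
          intro S hS
          rw [mem_filter] at hS ⊢
          exact ⟨hS.1, hS.2.ge⟩
  have E2 : ‖∑ S ∈ A.powerset with #S < K, y ^ #S * (β S : ℂ)
      - ∑ S ∈ A.powerset with #S < K, y ^ #S * ((B / d S : ℝ) : ℂ)‖
      ≤ ∑ S ∈ A.powerset with #S < K, δ S := by
    rw [← sum_sub_distrib]
    refine (norm_sum_le _ _).trans (sum_le_sum fun S _ => ?_)
    rw [← mul_sub, norm_mul, ← Complex.ofReal_sub, Complex.norm_real, norm_pow]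
    exact mul_le_of_le_one_left (norm_nonneg _) (pow_le_one₀ (norm_nonneg _) hy1)
  have E3 : ‖∑ S ∈ A.powerset with #S < K, y ^ #S * ((B / d S : ℝ) : ℂ)
      - #Q * ∏ r ∈ A, (1 + y / r)‖ ≤ B * tail := by
    rw [hprod, ← sum_filter_add_sum_filter_not A.powerset (fun S => #S < K), mul_add, mul_sum,
      ← sub_sub]
    have : ∑ S ∈ A.powerset with #S < K, y ^ #S * ((B / d S : ℝ) : ℂ)
      = ∑ S ∈ A.powerset with #S < K, (#Q : ℂ) * (y ^ #S / (d S : ℂ)) := by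
      refine sum_congr rfl fun S _ => ?_
      rw [hB]; push_cast; ring
    rw [this, sub_self, zero_sub, norm_neg, norm_mul, Complex.norm_natCast]
    refine mul_le_mul_of_nonneg_left ?_ hB0
    refine (norm_sum_le _ _).trans (le_of_eq ?_)
    rw [htail]
    simp only [not_lt, norm_div, norm_pow, Complex.norm_natCast]
  have hsplit : ∑ S ∈ A.powerset with #S ≤ K, δ S
      = ∑ S ∈ A.powerset with #S < K, δ S + ∑ S ∈ A.powerset with #S = K, δ S := by
    rw [← sum_union]
    · refine sum_congr ?_ fun _ _ => rfl
      ext S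
      simp only [mem_filter, mem_union, le_iff_lt_or_eq]
      tauto
    · rw [disjoint_filter]
      intro S _ h1 h2
      omega
  calc _ ≤ _ := norm_sub_le_norm_sub_add_norm_sub _ (∑ S ∈ A.powerset with #S < K, y ^ #S * (β S : ℂ)) _
    _ ≤ _ := add_le_add E1 ((norm_sub_le_norm_sub_add_norm_sub _
        (∑ S ∈ A.powerset with #S < K, y ^ #S * ((B / d S : ℝ) : ℂ)) _).trans (add_le_add E2 E3))
    _ ≤ _ := by
        rw [hsplit]
        have := mul_le_mul_of_nonneg_left htail_le hB0
        linarith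

/-- Primes in `(w, z]`. -/
def midPrimes (w z : ℕ) : Finset ℕ := (Ioc w z).filter Nat.Prime

theorem mem_midPrimes {w z r : ℕ} : r ∈ midPrimes w z ↔ (w < r ∧ r ≤ z) ∧ r.Prime := by
  simp [midPrimes]

/-- The number of primes in `(w, z]` dividing `s(n)` but not `n`. -/
def nStar (w z n : ℕ) : ℕ := #{r ∈ midPrimes w z | r ∣ sP n ∧ ¬ r ∣ n}

/-- Primes in `(w, z]` coprime to `m`, `s(m)` and `σ(m)`. -/
noncomputable def allowed (w z m : ℕ) : Finset ℕ := by
  classical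
  exact (midPrimes w z).filter (fun r => CopAll r m)

theorem mem_allowed {w z m r : ℕ} : r ∈ allowed w z m ↔ r ∈ midPrimes w z ∧ CopAll r m := by
  simp [allowed]

theorem copAll_of_dvd {r m q : ℕ} (hr : r.Prime) (h : r ∣ q * sP m + sD m) (hn : ¬ r ∣ m * q) :
    CopAll r m := by
  have e := sD_eq m
  have h1 : ¬ r ∣ m := fun h => hn (h.mul_right _)
  have h2 : ¬ r ∣ q := fun h => hn (h.mul_left _)
  have h3 : ¬ r ∣ sP m := fun h3 => by
    have h4 : r ∣ sD m := (Nat.dvd_add_right (h3.mul_left q)).mp h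
    rw [e] at h4
    exact h1 ((Nat.dvd_add_right h3).mp h4)
  have h4 : ¬ r ∣ sD m := fun h4 => by
    rcases hr.dvd_mul.mp ((Nat.dvd_add_left h4).mp h) with h5 | h5
    · exact h2 h5
    · exact h3 h5
  exact ⟨hr.coprime_iff_not_dvd.mpr h1, hr.coprime_iff_not_dvd.mpr h3, hr.coprime_iff_not_dvd.mpr h4⟩

theorem not_dvd_of_copAll {r m q : ℕ} (hr : r.Prime) (h : r ∣ q * sP m + sD m) (hc : CopAll r m) :
    ¬ r ∣ m * q := by
  intro h1
  rcases hr.dvd_mul.mp h1 with h2 | h2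
  · exact hr.coprime_iff_not_dvd.mp hc.1 h2
  · exact hr.coprime_iff_not_dvd.mp hc.2.2 ((Nat.dvd_add_right (h2.mul_right _)).mp h)

theorem nStar_mul_prime {w z m q : ℕ} (hq : q.Prime) (h : ¬ q ∣ m) :
    nStar w z (m * q) = #{r ∈ allowed w z m | r ∣ q * sP m + sD m} := by
  rw [nStar, sP_mul_prime hq h]
  congr 1
  ext r
  simp only [mem_filter, mem_allowed]
  constructor
  · rintro ⟨h1, h2, h3⟩
    exact ⟨⟨h1, copAll_of_dvd (mem_midPrimes.mp h1).2 h2 h3⟩, h2⟩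
  · rintro ⟨⟨h1, h2⟩, h3⟩
    exact ⟨h1, h3, not_dvd_of_copAll (mem_midPrimes.mp h1).2 h3 h2⟩

theorem copAll_prod {m : ℕ} {S : Finset ℕ} (h : ∀ p ∈ S, CopAll p m) : CopAll (∏ p ∈ S, p) m :=
  ⟨Nat.Coprime.prod_left fun p hp => (h p hp).1, Nat.Coprime.prod_left fun p hp => (h p hp).2.1,
    Nat.Coprime.prod_left fun p hp => (h p hp).2.2⟩

open Classical in
theorem sum_subsets_le_sum_roughs {w z D K m : ℕ} (hD : 1 ≤ D) (hz : z ^ K ≤ D) (g : ℕ → ℝ)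
    (hg : ∀ d, 0 ≤ g d) :
    ∑ S ∈ (allowed w z m).powerset with #S ≤ K, g (∏ p ∈ S, p)
      ≤ ∑ d ∈ roughs D w with CopAll d m, g d := by
  have hprime : ∀ S ∈ (allowed w z m).powerset, ∀ p ∈ S, p.Prime := fun S hS p hp =>
    (mem_midPrimes.mp (mem_allowed.mp (mem_powerset.mp hS hp)).1).2
  have hinj : Set.InjOn (fun S : Finset ℕ => ∏ p ∈ S, p)
      ((allowed w z m).powerset.filter (fun S => #S ≤ K) : Set (Finset ℕ)) := by
    intro S hS T hT h
    have h1 := hprime S (mem_filter.mp hS).1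
    have h2 := hprime T (mem_filter.mp hT).1
    simp only at h
    rw [← Nat.primeFactors_prod h1, ← Nat.primeFactors_prod h2, h]
  rw [← sum_image (f := g) hinj]
  refine sum_le_sum_of_subset_of_nonneg ?_ fun d _ _ => hg d
  intro d hd
  obtain ⟨S, hS, rfl⟩ := mem_image.mp hd
  obtain ⟨hS1, hS2⟩ := mem_filter.mp hS
  have hpr := hprime S hS1
  have hmem : ∀ p ∈ S, w < p ∧ p ≤ z ∧ CopAll p m := fun p hp => by
    have h := mem_allowed.mp (mem_powerset.mp hS1 hp)
    have h' := mem_midPrimes.mp h.1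
    exact ⟨h'.1.1, h'.1.2, h.2⟩
  refine mem_filter.mpr ⟨mem_roughs.mpr ⟨⟨Nat.pos_of_ne_zero (prod_ne_zero_iff.mpr
    fun p hp => (hpr p hp).ne_zero), ?_⟩, ?_⟩, copAll_prod fun p hp => (hmem p hp).2.2⟩
  · rcases S.eq_empty_or_nonempty with rfl | ⟨p, hp⟩
    · simpa using hD
    · have hz1 : 1 ≤ z := (hpr p hp).one_lt.le.trans (hmem p hp).2.1
      calc ∏ p ∈ S, p ≤ z ^ #S := prod_le_pow_card _ _ _ fun p hp => (hmem p hp).2.1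
        _ ≤ z ^ K := Nat.pow_le_pow_right hz1 hS2
        _ ≤ D := hz
  · intro p hp hpd
    obtain ⟨r, hr, hpr'⟩ := (Prime.dvd_finsetProd_iff hp.prime _).mp hpd
    rw [(Nat.prime_dvd_prime_iff_eq hp (hpr r hr)).mp hpr']
    exact (hmem r hr).1

theorem sD_le_sq (m : ℕ) : sD m ≤ m ^ 2 := by
  calc sD m ≤ #m.divisors • m := sum_le_card_nsmul _ _ _ fun d hd => Nat.divisor_le hd
    _ ≤ m ^ 2 := by
      rw [smul_eq_mul, sq]
      exact Nat.mul_le_mul_right _ (Nat.card_divisors_le_self m)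

theorem sP_pos {m : ℕ} (hm : 2 ≤ m) : 0 < sP m := by
  have : (1 : ℕ) ∈ m.properDivisors := Nat.mem_properDivisors.mpr ⟨one_dvd _, by omega⟩
  exact lt_of_lt_of_le one_pos (single_le_sum (f := fun d => d) (fun _ _ => Nat.zero_le _) this)

theorem card_not_allowed_le {w z m X : ℕ} (hm : 2 ≤ m) (hmX : m ≤ X) :
    (#(midPrimes w z \ allowed w z m) : ℝ) ≤ 8 * Real.log X := by
  set U := midPrimes w z \ allowed w z m with hU
  have hpr : ∀ r ∈ U, r.Prime := fun r hr => (mem_midPrimes.mp (mem_sdiff.mp hr).1).2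
  have hs := sP_pos hm
  have hsD : sD m ≤ X ^ 2 := (sD_le_sq m).trans (Nat.pow_le_pow_left hmX 2)
  have hsP : sP m ≤ X ^ 2 := by have := sD_eq m; omega
  have hsD0 : 0 < sD m := by have := sD_eq m; omega
  have hdvd : (∏ r ∈ U, r) ∣ m * sP m * sD m := by
    refine prod_primes_dvd _ (fun r hr => (hpr r hr).prime) fun r hr => ?_
    obtain ⟨h1, h2⟩ := mem_sdiff.mp hr
    have hp := hpr r hr
    by_contra h3
    apply h2
    refine mem_allowed.mpr ⟨h1, ?_⟩
    simp only [hp.dvd_mul, not_or] at h3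
    exact ⟨hp.coprime_iff_not_dvd.mpr h3.1.1, hp.coprime_iff_not_dvd.mpr h3.1.2,
      hp.coprime_iff_not_dvd.mpr h3.2⟩
  have h1 : 2 ^ #U ≤ X ^ 5 := by
    calc 2 ^ #U ≤ ∏ r ∈ U, r := by
          rw [← prod_const]
          exact prod_le_prod' fun r hr => (hpr r hr).two_le
      _ ≤ m * sP m * sD m := Nat.le_of_dvd (by positivity) hdvd
      _ ≤ X * X ^ 2 * X ^ 2 := by gcongr
      _ = X ^ 5 := by ring
  have h2 : (#U : ℝ) * Real.log 2 ≤ 5 * Real.log X := by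
    have h3 : ((2 : ℝ)) ^ #U ≤ (X : ℝ) ^ 5 := by exact_mod_cast h1
    have := Real.log_le_log (by positivity) h3
    rw [Real.log_pow, Real.log_pow] at this
    exact_mod_cast this
  have h3 := Real.log_two_gt_d9
  have h4 : (0 : ℝ) ≤ #U := by positivity
  nlinarith

theorem norm_prod_sub_one_le {ι : Type*} (s : Finset ι) (f : ι → ℂ) (hf : ∀ i ∈ s, ‖f i‖ ≤ 1) :
    ‖∏ i ∈ s, f i - 1‖ ≤ ∑ i ∈ s, ‖f i - 1‖ := by
  classical
  induction s using Finset.induction_on with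
  | empty => simp
  | insert a s ha ih =>
    rw [prod_insert ha, sum_insert ha]
    have e : f a * ∏ i ∈ s, f i - 1 = (f a - 1) + f a * (∏ i ∈ s, f i - 1) := by ring
    rw [e]
    refine (norm_add_le _ _).trans ?_
    rw [norm_mul]
    have h1 := ih fun i hi => hf i (mem_insert_of_mem hi)
    have h2 := hf a (mem_insert_self a s)
    have h3 := norm_nonneg (∏ i ∈ s, f i - 1)
    gcongr
    nlinarith [norm_nonneg (f a)]

theorem norm_one_add_div_le {y : ℂ} (hy : ‖1 + y‖ = 1) {r : ℕ} (hr : 1 ≤ r) : ‖1 + y / r‖ ≤ 1 := by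
  have hr0 : (0 : ℝ) < r := by exact_mod_cast hr
  have hr0' : (r : ℂ) ≠ 0 := by exact_mod_cast hr0.ne'
  have e : 1 + y / r = (((1 - 1 / r : ℝ)) : ℂ) + (1 + y) / r := by
    push_cast; field_simp; ring
  have h1 : (1 : ℝ) / r ≤ 1 := by rw [div_le_one hr0]; exact_mod_cast hr
  rw [e]
  refine (norm_add_le _ _).trans ?_
  rw [norm_div, hy, Complex.norm_real, Complex.norm_natCast, Real.norm_eq_abs,
    abs_of_nonneg (by linarith)]
  linarith

theorem norm_prod_allowed_sub_le {y : ℂ} (hy : ‖1 + y‖ = 1) (hy1 : ‖y‖ ≤ 1) {w z m X : ℕ}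
    (hw : 0 < w) (hm : 2 ≤ m) (hmX : m ≤ X) :
    ‖∏ r ∈ allowed w z m, (1 + y / r) - ∏ r ∈ midPrimes w z, (1 + y / r)‖
      ≤ 8 * Real.log X / w := by
  have hw0 : (0 : ℝ) < w := by exact_mod_cast hw
  have hsub : allowed w z m ⊆ midPrimes w z := fun r hr => (mem_allowed.mp hr).1
  have hle : ∀ r ∈ midPrimes w z, ‖1 + y / (r : ℂ)‖ ≤ 1 := fun r hr =>
    norm_one_add_div_le hy (mem_midPrimes.mp hr).2.one_lt.le
  rw [← prod_sdiff hsub, norm_sub_rev]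
  have e : (∏ r ∈ midPrimes w z \ allowed w z m, (1 + y / (r : ℂ))) * ∏ r ∈ allowed w z m, (1 + y / (r : ℂ))
      - ∏ r ∈ allowed w z m, (1 + y / (r : ℂ))
      = (∏ r ∈ midPrimes w z \ allowed w z m, (1 + y / (r : ℂ)) - 1)
        * ∏ r ∈ allowed w z m, (1 + y / (r : ℂ)) := by ring
  rw [e, norm_mul]
  have h1 : ‖∏ r ∈ allowed w z m, (1 + y / (r : ℂ))‖ ≤ 1 := by
    rw [norm_prod]
    exact prod_le_one (fun _ _ => norm_nonneg _) fun r hr => hle r (hsub hr)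
  have h2 := norm_prod_sub_one_le (midPrimes w z \ allowed w z m) (fun r => 1 + y / (r : ℂ))
    fun r hr => hle r (mem_sdiff.mp hr).1
  calc _ ≤ ‖∏ r ∈ midPrimes w z \ allowed w z m, (1 + y / (r : ℂ)) - 1‖ :=
        mul_le_of_le_one_right (norm_nonneg _) h1
    _ ≤ _ := h2
    _ ≤ ∑ r ∈ midPrimes w z \ allowed w z m, 1 / (w : ℝ) := by
        refine sum_le_sum fun r hr => ?_
        have h3 := (mem_midPrimes.mp (mem_sdiff.mp hr).1).1.1
        rw [add_sub_cancel_left, norm_div, Complex.norm_natCast]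
        gcongr
    _ = #(midPrimes w z \ allowed w z m) * (1 / (w : ℝ)) := by rw [sum_const, nsmul_eq_mul]
    _ ≤ 8 * Real.log X * (1 / (w : ℝ)) := by gcongr; exact card_not_allowed_le hm hmX
    _ = _ := by ring

theorem boxM_two_le {X D j m : ℕ} (hm : m ∈ boxM X D j) : 2 ≤ m ∧ m ≤ X := by
  obtain ⟨⟨h1, h2⟩, _, p, hp, hpm⟩ := mem_boxM.mp hm
  exact ⟨(mem_auxP.mp hp).2.two_le.trans (Nat.le_of_dvd h1 hpm), h2.trans (Nat.div_le_self _ _)⟩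

theorem sum_card_box_le {X D : ℕ} (hD : 2 ≤ D) :
    ∑ j ∈ range X, (#(boxM X D j) : ℝ) * #(boxQ X D j) ≤ X * auxMass X D := by
  have h := pairSum_eq (X := X) hD (fun _ _ => (1 : ℝ))
  have e : pairSum X D (fun _ _ => (1 : ℝ)) = ∑ j ∈ range X, (#(boxM X D j) : ℝ) * #(boxQ X D j) := by
    simp [pairSum]
  rw [← e, h, auxMass, mul_sum]
  refine sum_le_sum fun q hq => ?_
  have h1 := card_le_card (boxM_subset (X := X) hD (mem_auxP.mp hq).2.pos)
  rw [Nat.card_Icc, Nat.add_sub_cancel] at h1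
  rw [sum_const, nsmul_eq_mul, mul_one, mul_one_div]
  calc (#(boxM X D (q / D ^ 8)) : ℝ) ≤ (X / q : ℕ) := by exact_mod_cast h1
    _ ≤ _ := Nat.cast_div_le

theorem norm_pairSum_pow_sub_le {y : ℂ} (hy : ‖1 + y‖ = 1) (hy1 : ‖y‖ ≤ 1) {X D w z K : ℕ}
    (hD : 2 ≤ D) (hDX : D ≤ X) (hw : 0 < w) (hz : z ^ K ≤ D) :
    ‖pairSum X D (fun m q => (1 + y) ^ #{r ∈ allowed w z m | r ∣ q * sP m + sD m})
      - pairSum X D (fun _ _ => (1 : ℂ)) * ∏ r ∈ midPrimes w z, (1 + y / r)‖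
      ≤ 4 * X * (1 + Real.log X) ^ 3 / Real.sqrt w
        + X * auxMass X D * (2 * ((1 / 2) ^ K * ∏ r ∈ midPrimes w z, (1 + 2 * ‖y‖ / r))
          + 8 * Real.log X / w) := by
  classical
  set T := 2 * ((1 / 2) ^ K * ∏ r ∈ midPrimes w z, (1 + 2 * ‖y‖ / r)) + 8 * Real.log X / w with hT
  have hlog : 0 ≤ Real.log X := Real.log_natCast_nonneg X
  have hT0 : 0 ≤ T := by positivity
  have hm : ∀ j, ∀ m ∈ boxM X D j,
      ‖∑ q ∈ boxQ X D j, (1 + y) ^ #{r ∈ allowed w z m | r ∣ q * sP m + sD m}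
        - #(boxQ X D j) * ∏ r ∈ midPrimes w z, (1 + y / r)‖
      ≤ ∑ d ∈ roughs D w with CopAll d m,
        |(#{q ∈ boxQ X D j | d ∣ q * sP m + sD m} : ℝ) - #(boxQ X D j) / d| + #(boxQ X D j) * T := by
    intro j m hm
    obtain ⟨hm2, hmX⟩ := boxM_two_le hm
    have h1 := norm_sum_pow_sub_prod_le hy hy1 (boxQ X D j) (allowed w z m)
      (fun p hp => (mem_midPrimes.mp (mem_allowed.mp hp).1).2) (fun q => q * sP m + sD m) K
    have h2 := sum_subsets_le_sum_roughs (m := m) (w := w) (by omega : 1 ≤ D) hz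
      (fun d => |(#{q ∈ boxQ X D j | d ∣ q * sP m + sD m} : ℝ) - #(boxQ X D j) / d|)
      (fun d => abs_nonneg _)
    have h3 := norm_prod_allowed_sub_le hy hy1 (z := z) hw hm2 hmX
    have h4 : ∏ r ∈ allowed w z m, (1 + 2 * ‖y‖ / r) ≤ ∏ r ∈ midPrimes w z, (1 + 2 * ‖y‖ / (r : ℝ)) := by
      refine prod_le_prod_of_subset_of_one_le (fun r hr => (mem_allowed.mp hr).1) ?_ ?_
      · intro r _; positivity
      · intro r _ _
        have : 0 ≤ 2 * ‖y‖ / (r : ℝ) := by positivity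
        linarith
    have hB0 : (0 : ℝ) ≤ #(boxQ X D j) := by positivity
    calc _ ≤ _ := norm_sub_le_norm_sub_add_norm_sub _
          (#(boxQ X D j) * ∏ r ∈ allowed w z m, (1 + y / (r : ℂ))) _
      _ ≤ _ := by
          rw [← mul_sub, norm_mul, Complex.norm_natCast]
          have h5 := mul_le_mul_of_nonneg_left h3 hB0
          have h6 : (1 / 2 : ℝ) ^ K * ∏ r ∈ allowed w z m, (1 + 2 * ‖y‖ / r)
            ≤ (1 / 2 : ℝ) ^ K * ∏ r ∈ midPrimes w z, (1 + 2 * ‖y‖ / (r : ℝ)) := by gcongr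
          have h7 := mul_le_mul_of_nonneg_left h6 hB0
          rw [hT]
          linarith
  simp only [pairSum]
  rw [sum_mul, ← sum_sub_distrib]
  calc _ ≤ ∑ j ∈ range X, (∑ m ∈ boxM X D j, (∑ d ∈ roughs D w with CopAll d m,
        |(#{q ∈ boxQ X D j | d ∣ q * sP m + sD m} : ℝ) - #(boxQ X D j) / d| + #(boxQ X D j) * T)) := by
        refine (norm_sum_le _ _).trans (sum_le_sum fun j _ => ?_)
        rw [sum_mul, ← sum_sub_distrib]
        refine (norm_sum_le _ _).trans (sum_le_sum fun m hmm => ?_)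
        rw [sum_const, nsmul_eq_mul, mul_one]
        exact hm j m hmm
    _ = ∑ j ∈ range X, ∑ m ∈ boxM X D j, ∑ d ∈ roughs D w with CopAll d m,
        |(#{q ∈ boxQ X D j | d ∣ q * sP m + sD m} : ℝ) - #(boxQ X D j) / d|
        + (∑ j ∈ range X, (#(boxM X D j) : ℝ) * #(boxQ X D j)) * T := by
        simp only [sum_add_distrib, sum_const, nsmul_eq_mul, sum_mul, mul_assoc]
    _ ≤ _ := by
        gcongr
        · exact sum_abs_discrepancy_le hw (by omega) hDX
        · exact sum_card_box_le hD

/-- The error in passing from integers to admissible pairs. -/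
noncomputable def transferErr (X D : ℕ) : ℝ :=
  X * Real.sqrt (3 * auxMass X D) + 5 / D * X * auxMass X D + X

/-- The characteristic function of the number of medium prime divisors of `s(n)`. -/
theorem norm_sum_pow_nStar_sub_le {y : ℂ} (hy : ‖1 + y‖ = 1) (hy1 : ‖y‖ ≤ 1) {X D w z K : ℕ}
    (hD : 2 ≤ D) (hDX : D ≤ X) (hw : 0 < w) (hz : z ^ K ≤ D) :
    auxMass X D * ‖∑ n ∈ Icc 1 X, (1 + y) ^ nStar w z n - X * ∏ r ∈ midPrimes w z, (1 + y / r)‖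
      ≤ 2 * transferErr X D + 4 * X * (1 + Real.log X) ^ 3 / Real.sqrt w
        + X * auxMass X D * (2 * ((1 / 2) ^ K * ∏ r ∈ midPrimes w z, (1 + 2 * ‖y‖ / r))
          + 8 * Real.log X / w) := by
  set Z := ∏ r ∈ midPrimes w z, (1 + y / (r : ℂ)) with hZ
  have hZ1 : ‖Z‖ ≤ 1 := by
    rw [hZ, norm_prod]
    exact prod_le_one (fun _ _ => norm_nonneg _) fun r hr =>
      norm_one_add_div_le hy (mem_midPrimes.mp hr).2.one_lt.le
  have h1 := norm_sum_sub_pairSum_le (X := X) hD (fun n => (1 + y) ^ nStar w z n)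
    (fun m q => (1 + y) ^ #{r ∈ allowed w z m | r ∣ q * sP m + sD m})
    (fun n => by rw [norm_pow, hy, one_pow]) (fun m q => by rw [norm_pow, hy, one_pow])
    (fun m q hq _ hqm => by rw [nStar_mul_prime (mem_auxP.mp hq).2 hqm])
  have h2 := norm_sum_sub_pairSum_le (X := X) hD (fun _ => 1) (fun _ _ => 1)
    (fun n => by simp) (fun m q => by simp) (fun m q _ _ _ => rfl)
  have h3 := norm_pairSum_pow_sub_le hy hy1 hD hDX hw hz
  simp only [sum_const, Nat.card_Icc, Nat.add_sub_cancel, nsmul_eq_mul, mul_one] at h2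
  have h4 : ‖(pairSum X D (fun _ _ => (1 : ℂ)) - auxMass X D * X) * Z‖ ≤ transferErr X D := by
    rw [norm_mul, norm_sub_rev]
    exact (mul_le_of_le_one_right (norm_nonneg _) hZ1).trans h2
  rw [← abs_of_nonneg (auxMass_nonneg X D), ← Real.norm_eq_abs, ← Complex.norm_real, ← norm_mul]
  simp only [Complex.norm_real, Real.norm_eq_abs, abs_of_nonneg (auxMass_nonneg X D)]
  set S := pairSum X D (fun m q => (1 + y) ^ #{r ∈ allowed w z m | r ∣ q * sP m + sD m}) with hS
  set O := pairSum X D (fun _ _ => (1 : ℂ)) with hO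
  have e : (auxMass X D : ℂ) * (∑ n ∈ Icc 1 X, (1 + y) ^ nStar w z n - X * Z)
    = (auxMass X D * ∑ n ∈ Icc 1 X, (1 + y) ^ nStar w z n - S) + (S - O * Z)
      + (O - auxMass X D * X) * Z := by ring
  rw [e]
  have h5 := norm_add_le ((auxMass X D * ∑ n ∈ Icc 1 X, (1 + y) ^ nStar w z n - S) + (S - O * Z))
    ((O - auxMass X D * X) * Z)
  have h6 := norm_add_le (auxMass X D * ∑ n ∈ Icc 1 X, (1 + y) ^ nStar w z n - S) (S - O * Z)
  unfold transferErr at *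
  linarith

theorem pairSum_add (X D : ℕ) (f g : ℕ → ℕ → ℝ) :
    pairSum X D (fun m q => f m q + g m q) = pairSum X D f + pairSum X D g := by
  simp only [pairSum, sum_add_distrib]

theorem pairSum_mul_left (X D : ℕ) (c : ℝ) (f : ℕ → ℕ → ℝ) :
    pairSum X D (fun m q => c * f m q) = c * pairSum X D f := by
  simp only [pairSum, mul_sum]

theorem pairSum_finset_sum {ι : Type*} (X D : ℕ) (s : Finset ι) (f : ι → ℕ → ℕ → ℝ) :
    pairSum X D (fun m q => ∑ i ∈ s, f i m q) = ∑ i ∈ s, pairSum X D (f i) := by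
  classical
  induction s using Finset.induction_on with
  | empty => simp [pairSum]
  | insert a s ha ih =>
    simp only [sum_insert ha]
    rw [pairSum_add, ih]

theorem pairSum_le_pairSum {X D : ℕ} {f g : ℕ → ℕ → ℝ}
    (h : ∀ j m q, m ∈ boxM X D j → q ∈ boxQ X D j → f m q ≤ g m q) :
    pairSum X D f ≤ pairSum X D g :=
  sum_le_sum fun j _ => sum_le_sum fun m hm => sum_le_sum fun q hq => h j m q hm hq

open Classical in
theorem auxMass_mul_card_le {X D : ℕ} (hD : 2 ≤ D) (P : ℕ → Prop) :
    auxMass X D * #{n ∈ Icc 1 X | P n}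
      ≤ pairSum X D (fun m q => if ¬ q ∣ m ∧ P (m * q) then (1 : ℝ) else 0) + transferErr X D := by
  have h := norm_sum_sub_pairSum_le (X := X) hD (fun n => if P n then 1 else 0)
    (fun m q => if ¬ q ∣ m ∧ P (m * q) then 1 else 0)
    (fun n => by split_ifs <;> simp) (fun m q => by split_ifs <;> simp)
    (fun m q _ _ hqm => by simp [hqm])
  have e : (auxMass X D : ℂ) * ∑ n ∈ Icc 1 X, (if P n then (1 : ℂ) else 0)
      - pairSum X D (fun m q => if ¬ q ∣ m ∧ P (m * q) then (1 : ℂ) else 0)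
      = ((auxMass X D * #{n ∈ Icc 1 X | P n}
        - pairSum X D (fun m q => if ¬ q ∣ m ∧ P (m * q) then (1 : ℝ) else 0) : ℝ) : ℂ) := by
    rw [← sum_filter, sum_const, nsmul_eq_mul, mul_one]
    simp only [pairSum]
    push_cast [apply_ite]
    rfl
  rw [e, Complex.norm_real, Real.norm_eq_abs] at h
  have := (abs_le.mp h).2
  unfold transferErr
  linarith

open Classical in
theorem pairSum_card_dvd_le {X D w : ℕ} (hD : 2 ≤ D) (hDX : D ≤ X) (hw : 0 < w) (𝒟 : Finset ℕ)
    (h𝒟 : 𝒟 ⊆ roughs D w) :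
    pairSum X D (fun m q => (#{d ∈ 𝒟 | CopAll d m ∧ d ∣ q * sP m + sD m} : ℝ))
      ≤ 4 * X * (1 + Real.log X) ^ 3 / Real.sqrt w + X * auxMass X D * ∑ d ∈ 𝒟, (1 : ℝ) / d := by
  set T : ℝ := ∑ d ∈ 𝒟, (1 : ℝ) / d with hT
  have hm : ∀ j, ∀ m ∈ boxM X D j,
      ∑ q ∈ boxQ X D j, (#{d ∈ 𝒟 | CopAll d m ∧ d ∣ q * sP m + sD m} : ℝ)
      ≤ ∑ d ∈ roughs D w with CopAll d m,
        |(#{q ∈ boxQ X D j | d ∣ q * sP m + sD m} : ℝ) - #(boxQ X D j) / d| + #(boxQ X D j) * T := by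
    intro j m _
    have e1 : ∑ q ∈ boxQ X D j, (#{d ∈ 𝒟 | CopAll d m ∧ d ∣ q * sP m + sD m} : ℝ)
        = ∑ d ∈ 𝒟 with CopAll d m, (#{q ∈ boxQ X D j | d ∣ q * sP m + sD m} : ℝ) := by
      simp only [← filter_filter, card_filter, Nat.cast_sum]
      rw [sum_comm]
    rw [e1]
    calc _ ≤ ∑ d ∈ 𝒟 with CopAll d m,
          (|(#{q ∈ boxQ X D j | d ∣ q * sP m + sD m} : ℝ) - #(boxQ X D j) / d| + #(boxQ X D j) * (1 / (d : ℝ))) := by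
          refine sum_le_sum fun d _ => ?_
          rw [mul_one_div]
          linarith [le_abs_self ((#{q ∈ boxQ X D j | d ∣ q * sP m + sD m} : ℝ) - #(boxQ X D j) / d)]
      _ ≤ _ := by
          rw [sum_add_distrib, ← mul_sum]
          refine add_le_add ?_ (mul_le_mul_of_nonneg_left ?_ (by positivity))
          · exact sum_le_sum_of_subset_of_nonneg (filter_subset_filter _ h𝒟) fun _ _ _ => abs_nonneg _
          · exact sum_le_sum_of_subset_of_nonneg (filter_subset _ _) fun _ _ _ => by positivity
  have hT0 : 0 ≤ T := sum_nonneg fun _ _ => by positivity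
  simp only [pairSum]
  calc _ ≤ ∑ j ∈ range X, (∑ m ∈ boxM X D j, (∑ d ∈ roughs D w with CopAll d m,
        |(#{q ∈ boxQ X D j | d ∣ q * sP m + sD m} : ℝ) - #(boxQ X D j) / d| + #(boxQ X D j) * T)) :=
        sum_le_sum fun j _ => sum_le_sum fun m hmm => hm j m hmm
    _ = ∑ j ∈ range X, ∑ m ∈ boxM X D j, ∑ d ∈ roughs D w with CopAll d m,
        |(#{q ∈ boxQ X D j | d ∣ q * sP m + sD m} : ℝ) - #(boxQ X D j) / d|
        + (∑ j ∈ range X, (#(boxM X D j) : ℝ) * #(boxQ X D j)) * T := by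
        simp only [sum_add_distrib, sum_const, nsmul_eq_mul, sum_mul, mul_assoc]
    _ ≤ _ := by
        gcongr
        · exact sum_abs_discrepancy_le hw (by omega) hDX
        · exact sum_card_box_le hD

theorem card_prime_power_dvd_le {X D j r k m : ℕ} (hD : 2 ≤ D) (hr : r.Prime) (hk : r ^ k ≤ D ^ 4) :
    (#{q ∈ boxQ X D j | r ^ k ∣ q * sP m + sD m} : ℝ) * Real.log D
      ≤ ∑ i ∈ range (k + 1), if r ^ i ∣ m then 9 * (D : ℝ) ^ 8 / r ^ (k - i) else 0 := by
  have hnn : ∀ i ∈ range (k + 1), (0 : ℝ) ≤ if r ^ i ∣ m then 9 * (D : ℝ) ^ 8 / r ^ (k - i) else 0 := by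
    intro i _; split_ifs <;> positivity
  rcases (boxQ X D j).filter (fun q => r ^ k ∣ q * sP m + sD m) |>.eq_empty_or_nonempty with he | ⟨q₀, hq₀⟩
  · rw [he, card_empty, Nat.cast_zero, zero_mul]; exact sum_nonneg hnn
  obtain ⟨i, hik, hi⟩ := (Nat.dvd_prime_pow hr).mp (Nat.gcd_dvd_left (r ^ k) (sP m))
  have his : r ^ i ∣ sP m := hi ▸ Nat.gcd_dvd_right _ _
  have him : r ^ i ∣ m := by
    have h1 : r ^ i ∣ q₀ * sP m + sD m := (pow_dvd_pow r hik).trans (mem_filter.mp hq₀).2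
    have h2 := (Nat.dvd_add_right (his.mul_left q₀)).mp h1
    rw [sD_eq] at h2
    exact (Nat.dvd_add_right his).mp h2
  have h := card_mul_log_le_of_rough (D := D) (H := D ^ 8) (b := j * D ^ 8) (e := r ^ (k - i))
    hr rfl ((boxQ X D j).filter (fun q => r ^ k ∣ q * sP m + sD m)) ?_ ?_ ?_
  · refine h.trans (le_trans ?_ (single_le_sum hnn (mem_range.mpr (Nat.lt_succ_of_le hik))))
    rw [if_pos him]
    have hr0 : (0 : ℝ) < (r : ℝ) ^ (k - i) := by
      have := hr.pos
      positivity
    have h1 : (r : ℝ) ^ (k - i) ≤ (D : ℝ) ^ 4 := by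
      have : r ^ (k - i) ≤ D ^ 4 := (Nat.pow_le_pow_right hr.pos (Nat.sub_le k i)).trans hk
      exact_mod_cast this
    have hD4 : (1 : ℝ) ≤ (D : ℝ) ^ 4 := one_le_pow₀ (by exact_mod_cast (by omega : 1 ≤ D))
    have h2 : (D : ℝ) ^ 4 ≤ (D : ℝ) ^ 8 / r ^ (k - i) := by
      rw [le_div_iff₀ hr0]
      calc (D : ℝ) ^ 4 * r ^ (k - i) ≤ (D : ℝ) ^ 4 * D ^ 4 := by gcongr
        _ = _ := by ring
    push_cast
    rw [mul_div_assoc]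
    linarith
  · intro q hq
    have h1 := (mem_boxQ.mp (mem_filter.mp hq).1).2
    have h2 : j * D ^ 8 + q % D ^ 8 = q := by rw [← h1]; exact Nat.div_add_mod' q (D ^ 8)
    have h3 := Nat.mod_lt q (by positivity : 0 < D ^ 8)
    constructor
    · exact h2 ▸ Nat.le_add_right _ _
    · calc q = j * D ^ 8 + q % D ^ 8 := h2.symm
        _ < _ := Nat.add_lt_add_left h3 _
  · intro q hq d hd hdD
    obtain ⟨⟨h1, _⟩, h2⟩ := mem_auxP.mp (mem_boxQ.mp (mem_filter.mp hq).1).1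
    have h3 : D ≤ D ^ 16 := Nat.le_self_pow (by norm_num) D
    exact Nat.coprime_of_lt_prime (by omega) (by omega) h2
  · intro q hq q' hq'
    have h1 := (mem_filter.mp hq).2
    have h2 := (mem_filter.mp hq').2
    have h3 : sP m * q ≡ sP m * q' [MOD r ^ k] := by
      refine Nat.ModEq.add_right_cancel' (sD m) ?_
      rw [mul_comm _ q, mul_comm _ q']
      exact ((Nat.modEq_zero_iff_dvd).mpr h1).trans ((Nat.modEq_zero_iff_dvd).mpr h2).symm
    have h4 := Nat.ModEq.cancel_left_div_gcd (pow_pos hr.pos k) h3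
    rw [hi, Nat.pow_div hik hr.pos] at h4
    exact h4

theorem pairSum_prime_power_dvd_le {X D r k : ℕ} (hD : 2 ≤ D) (hr : r.Prime) (hk : r ^ k ≤ D ^ 4) :
    pairSum X D (fun m q => if r ^ k ∣ q * sP m + sD m then (1 : ℝ) else 0)
      ≤ 9 * X * (1 + Real.log X) / Real.log D * ((k + 1) / (r : ℝ) ^ k) := by
  have hlogD : 0 < Real.log D := Real.log_pos (by exact_mod_cast hD)
  have hr0 : (0 : ℝ) < r := by exact_mod_cast hr.pos
  have hbox : ∀ j, ∑ m ∈ boxM X D j, ∑ q ∈ boxQ X D j,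
      (if r ^ k ∣ q * sP m + sD m then (1 : ℝ) else 0)
      ≤ 9 * X / Real.log D * ((k + 1) / (r : ℝ) ^ k) * (1 / ((j : ℝ) + 1)) := by
    intro j
    set M := X / ((j + 1) * D ^ 8) with hM
    have hMH : (M : ℝ) * D ^ 8 ≤ X * (1 / (j + 1 : ℝ)) := by
      have h1 : M * ((j + 1) * D ^ 8) ≤ X := Nat.div_mul_le_self _ _
      have h2 : (M : ℝ) * ((j + 1) * (D : ℝ) ^ 8) ≤ X := by exact_mod_cast h1
      rw [mul_one_div, le_div_iff₀ (by positivity)]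
      linarith
    have h1 : ∑ m ∈ boxM X D j, ∑ q ∈ boxQ X D j,
        (if r ^ k ∣ q * sP m + sD m then (1 : ℝ) else 0)
        ≤ ∑ m ∈ Icc 1 M, (∑ i ∈ range (k + 1), if r ^ i ∣ m then 9 * (D : ℝ) ^ 8 / r ^ (k - i) else 0)
          / Real.log D := by
      calc _ ≤ ∑ m ∈ boxM X D j, (∑ i ∈ range (k + 1),
            if r ^ i ∣ m then 9 * (D : ℝ) ^ 8 / r ^ (k - i) else 0) / Real.log D := by
            refine sum_le_sum fun m _ => ?_
            rw [le_div_iff₀ hlogD, ← sum_filter, sum_const, nsmul_eq_mul, mul_one]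
            exact card_prime_power_dvd_le hD hr hk
        _ ≤ _ := by
            refine sum_le_sum_of_subset_of_nonneg ?_ fun m _ _ => ?_
            · intro m hm
              exact mem_Icc.mpr (mem_boxM.mp hm).1
            · refine div_nonneg (sum_nonneg fun i _ => ?_) hlogD.le
              split_ifs <;> positivity
    refine h1.trans ?_
    rw [← sum_div, sum_comm]
    have h2 : ∀ i ∈ range (k + 1), ∑ m ∈ Icc 1 M, (if r ^ i ∣ m then 9 * (D : ℝ) ^ 8 / r ^ (k - i) else 0)
        ≤ 9 * (M * (D : ℝ) ^ 8) / r ^ k := by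
      intro i hi
      have hik : i ≤ k := by have := mem_range.mp hi; omega
      rw [← sum_filter, sum_const, nsmul_eq_mul]
      have h3 := card_multiples_le M (r ^ i)
      push_cast at h3
      calc _ ≤ (M : ℝ) / r ^ i * (9 * (D : ℝ) ^ 8 / r ^ (k - i)) := by gcongr
        _ = 9 * (M * (D : ℝ) ^ 8) / (r ^ i * r ^ (k - i)) := by field_simp
        _ = _ := by rw [← pow_add, Nat.add_sub_cancel' hik]
    calc _ ≤ (∑ i ∈ range (k + 1), 9 * (M * (D : ℝ) ^ 8) / (r : ℝ) ^ k) / Real.log D := by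
          gcongr with i hi
          exact h2 i hi
      _ = 9 * (k + 1) / r ^ k / Real.log D * (M * (D : ℝ) ^ 8) := by
          rw [sum_const, card_range, nsmul_eq_mul]; push_cast; ring
      _ ≤ 9 * (k + 1) / r ^ k / Real.log D * (X * (1 / (j + 1 : ℝ))) := by gcongr
      _ = _ := by ring
  simp only [pairSum]
  calc _ ≤ ∑ j ∈ range X, 9 * X / Real.log D * ((k + 1) / (r : ℝ) ^ k) * (1 / ((j : ℝ) + 1)) :=
        sum_le_sum fun j _ => hbox j
    _ = 9 * X / Real.log D * ((k + 1) / (r : ℝ) ^ k) * ∑ k ∈ Icc 1 X, (1 : ℝ) / k := by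
        rw [← mul_sum]
        congr 1
        rw [← Ico_add_one_right_eq_Icc, sum_Ico_eq_sum_range]
        exact sum_congr rfl fun j _ => by push_cast; rw [add_comm]
    _ ≤ 9 * X / Real.log D * ((k + 1) / (r : ℝ) ^ k) * (1 + Real.log X) := by
        gcongr
        exact sum_Icc_inv_le X
    _ = _ := by ring

theorem sD_eq_prod {n : ℕ} (hn : n ≠ 0) :
    sD n = ∏ p ∈ n.primeFactors, ∑ k ∈ range (n.factorization p + 1), p ^ k := by
  rw [sD, ← ArithmeticFunction.sigma_one_apply,
    ArithmeticFunction.isMultiplicative_sigma.multiplicative_factorization _ hn,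
    Nat.prod_factorization_eq_prod_primeFactors]
  refine prod_congr rfl fun p hp => ?_
  rw [ArithmeticFunction.sigma_one_apply, Nat.sum_divisors_prime_pow (Nat.prime_of_mem_primeFactors hp)]

/-- If a large prime divides both `n` and `s(n)`, then `n` is divisible by a large square or by
`r p` with `p ≡ -1` modulo `r`. -/
theorem exists_prime_of_dvd_of_dvd_sP {n w κ r : ℕ} (hn : n ≠ 0) (hκ : κ ^ 4 ≤ w) (hr : r.Prime)
    (hw : w < r) (h1 : r ∣ n) (h2 : r ∣ sP n) (hsq : ∀ k, κ < k → ¬ k ^ 2 ∣ n) :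
    ∃ p, p.Prime ∧ r ∣ p + 1 ∧ r * p ∣ n := by
  have h3 : r ∣ sD n := by rw [sD_eq]; exact dvd_add h2 h1
  rw [sD_eq_prod hn] at h3
  obtain ⟨p, hp, hrp⟩ := (Prime.dvd_finsetProd_iff hr.prime _).mp h3
  have hpp := Nat.prime_of_mem_primeFactors hp
  have hpn := Nat.dvd_of_mem_primeFactors hp
  set a := n.factorization p with ha
  have ha1 : 1 ≤ a := (hpp.dvd_iff_one_le_factorization hn).mp hpn
  have han : p ^ a ∣ n := Nat.ordProj_dvd n p
  rcases Nat.lt_or_ge a 2 with h4 | h4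
  · have : a = 1 := by omega
    rw [this] at hrp
    simp only [sum_range_succ, range_zero, sum_empty, pow_zero, pow_one, zero_add] at hrp
    rw [add_comm] at hrp
    refine ⟨p, hpp, hrp, ?_⟩
    refine Nat.Coprime.mul_dvd_of_dvd_of_dvd ((Nat.coprime_primes hr hpp).mpr ?_) h1 hpn
    rintro rfl
    exact hr.one_lt.ne' (Nat.dvd_one.mp ((Nat.dvd_add_right dvd_rfl).mp hrp))
  · exfalso
    have h5 : p ^ (a / 2) ≤ κ := by
      by_contra! h
      refine hsq _ h (Dvd.dvd.trans ?_ han)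
      rw [← pow_mul]
      exact pow_dvd_pow _ (by omega)
    have h6 : ∑ k ∈ range (a + 1), p ^ k < p ^ (a + 1) :=
      Nat.geomSum_lt hpp.two_le fun k hk => mem_range.mp hk
    have h7 : p ^ (a + 1) ≤ κ ^ 4 := by
      calc p ^ (a + 1) ≤ p ^ (a / 2 * 4) := Nat.pow_le_pow_right hpp.pos (by omega)
        _ = (p ^ (a / 2)) ^ 4 := by rw [pow_mul]
        _ ≤ κ ^ 4 := Nat.pow_le_pow_left h5 4
    have h8 : 0 < ∑ k ∈ range (a + 1), p ^ k :=
      sum_pos (fun k _ => pow_pos hpp.pos k) ⟨0, by simp⟩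
    have := Nat.le_of_dvd h8 hrp
    omega

theorem sum_inv_of_dvd_succ_le {X r : ℕ} (hr : 2 ≤ r) :
    ∑ p ∈ Icc 1 X with r ∣ p + 1, (1 : ℝ) / p ≤ 2 / r * (1 + Real.log X) := by
  have hr0 : (0 : ℝ) < r := by exact_mod_cast (by omega : 0 < r)
  have hpt : ∀ p ∈ (Icc 1 X).filter (fun p => r ∣ p + 1),
      (1 : ℝ) / p ≤ 2 / r * (1 / ((((p + 1) / r : ℕ)) : ℝ)) := by
    intro p hp
    obtain ⟨h1, h2⟩ := mem_filter.mp hp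
    have hp1 := (mem_Icc.mp h1).1
    have hp0 : (0 : ℝ) < p := by exact_mod_cast hp1
    have hp1' : (1 : ℝ) ≤ p := by exact_mod_cast hp1
    rw [Nat.cast_div h2 hr0.ne']
    push_cast
    have e : 2 / (r : ℝ) * (1 / (((p : ℝ) + 1) / r)) = 2 / (p + 1) := by field_simp
    rw [e, div_le_div_iff₀ hp0 (by positivity)]
    linarith
  have hinj : Set.InjOn (fun p => (p + 1) / r) ((Icc 1 X).filter (fun p => r ∣ p + 1) : Set ℕ) := by
    intro p hp p' hp' h
    have h1 := Nat.div_mul_cancel (mem_filter.mp hp).2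
    have h2 := Nat.div_mul_cancel (mem_filter.mp hp').2
    simp only at h
    rw [h] at h1
    omega
  calc _ ≤ ∑ p ∈ Icc 1 X with r ∣ p + 1, 2 / (r : ℝ) * (1 / ((((p + 1) / r : ℕ)) : ℝ)) := sum_le_sum hpt
    _ = 2 / (r : ℝ) * ∑ j ∈ ((Icc 1 X).filter (fun p => r ∣ p + 1)).image (fun p => (p + 1) / r), (1 / (j : ℝ)) := by
        rw [← mul_sum, sum_image hinj]
    _ ≤ 2 / (r : ℝ) * ∑ j ∈ Icc 1 X, (1 / (j : ℝ)) := by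
        gcongr
        intro j hj
        obtain ⟨p, hp, rfl⟩ := mem_image.mp hj
        obtain ⟨h1, h2⟩ := mem_filter.mp hp
        obtain ⟨h3, h4⟩ := mem_Icc.mp h1
        refine mem_Icc.mpr ⟨Nat.div_pos (Nat.le_of_dvd (by omega) h2) (by omega), ?_⟩
        rw [Nat.div_le_iff_le_mul_add_pred (by omega)]
        nlinarith
    _ ≤ _ := by gcongr; exact sum_Icc_inv_le X

open Classical in
theorem card_common_large_prime_le {X w κ : ℕ} (hκ : 1 ≤ κ) (hκw : κ ^ 4 ≤ w) :
    (#{n ∈ Icc 1 X | ∃ r, r.Prime ∧ w < r ∧ r ∣ n ∧ r ∣ sP n} : ℝ)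
      ≤ X / κ + 2 * X * (1 + Real.log X) / w := by
  have hw : 1 ≤ w := (Nat.one_le_pow _ _ hκ).trans hκw
  have hsub : {n ∈ Icc 1 X | ∃ r, r.Prime ∧ w < r ∧ r ∣ n ∧ r ∣ sP n} ⊆
      {m ∈ Icc 1 X | ∃ k, κ < k ∧ k ^ 2 ∣ m} ∪
      (Ioc w X).biUnion (fun r => ((Icc 1 X).filter (fun p => r ∣ p + 1)).biUnion
        (fun p => {n ∈ Icc 1 X | r * p ∣ n})) := by
    intro n hn
    obtain ⟨h1, r, hr, hwr, hrn, hrs⟩ := mem_filter.mp hn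
    obtain ⟨hn1, hnX⟩ := mem_Icc.mp h1
    rw [mem_union]
    by_cases hsq : ∃ k, κ < k ∧ k ^ 2 ∣ n
    · exact Or.inl (mem_filter.mpr ⟨h1, hsq⟩)
    · push Not at hsq
      obtain ⟨p, hp, hrp, hd⟩ := exists_prime_of_dvd_of_dvd_sP (by omega) hκw hr hwr hrn hrs hsq
      refine Or.inr (mem_biUnion.mpr ⟨r, mem_Ioc.mpr ⟨hwr, (Nat.le_of_dvd hn1 hrn).trans hnX⟩,
        mem_biUnion.mpr ⟨p, mem_filter.mpr ⟨mem_Icc.mpr ⟨hp.one_lt.le,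
          (Nat.le_of_dvd hn1 ((dvd_mul_left _ _).trans hd)).trans hnX⟩, hrp⟩,
          mem_filter.mpr ⟨h1, hd⟩⟩⟩)
  have h1 : (#{n ∈ Icc 1 X | ∃ r, r.Prime ∧ w < r ∧ r ∣ n ∧ r ∣ sP n} : ℝ)
      ≤ #{m ∈ Icc 1 X | ∃ k, κ < k ∧ k ^ 2 ∣ m}
        + ∑ r ∈ Ioc w X, ∑ p ∈ Icc 1 X with r ∣ p + 1, (#{n ∈ Icc 1 X | r * p ∣ n} : ℝ) := by
    have := (card_le_card hsub).trans ((card_union_le _ _).trans (Nat.add_le_add_left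
      (card_biUnion_le.trans (sum_le_sum fun r _ => card_biUnion_le)) _))
    exact_mod_cast this
  have h2 : ∑ r ∈ Ioc w X, ∑ p ∈ Icc 1 X with r ∣ p + 1, (#{n ∈ Icc 1 X | r * p ∣ n} : ℝ)
      ≤ ∑ r ∈ Ioc w X, (2 * X * (1 + Real.log X)) * (1 / (r : ℝ) ^ 2) := by
    refine sum_le_sum fun r hr => ?_
    have hr2 : 2 ≤ r := by have := (mem_Ioc.mp hr).1; omega
    have hr0 : (0 : ℝ) < r := by exact_mod_cast (by omega : 0 < r)
    calc _ ≤ ∑ p ∈ Icc 1 X with r ∣ p + 1, (X / r : ℝ) * (1 / p) := by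
          refine sum_le_sum fun p _ => (card_multiples_le _ _).trans (le_of_eq ?_)
          push_cast
          rw [div_mul_div_comm, mul_one]
      _ = (X / r : ℝ) * ∑ p ∈ Icc 1 X with r ∣ p + 1, (1 / p : ℝ) := by rw [mul_sum]
      _ ≤ (X / r : ℝ) * (2 / r * (1 + Real.log X)) := by
          gcongr
          exact sum_inv_of_dvd_succ_le hr2
      _ = _ := by field_simp
  have hlog : 0 ≤ Real.log X := Real.log_natCast_nonneg X
  have h3 : ∑ r ∈ Ioc w X, (2 * X * (1 + Real.log X)) * (1 / (r : ℝ) ^ 2)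
      ≤ (2 * X * (1 + Real.log X)) * (1 / w) := by
    rw [← mul_sum]
    gcongr
    exact sum_inv_sq_gt_le w X hw
  have h4 := card_sq_dvd_le X κ hκ
  have : 2 * X * (1 + Real.log X) / (w : ℝ) = (2 * X * (1 + Real.log X)) * (1 / w) := by ring
  linarith

theorem length_primeFactorsList_eq (v : ℕ) :
    v.primeFactorsList.length = ∑ p ∈ v.primeFactors, v.factorization p := by
  rw [← ArithmeticFunction.cardFactors_apply, ArithmeticFunction.cardFactors_eq_sum_factorization]
  rfl

theorem sum_factorization_large_le {v D₀ : ℕ} {c : ℝ} (hD : 2 ≤ D₀)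
    (hc : Real.log v ≤ c * Real.log D₀) :
    ∑ p ∈ v.primeFactors with D₀ < p, (v.factorization p : ℝ) ≤ c := by
  have hlog : 0 < Real.log D₀ := Real.log_pos (by exact_mod_cast hD)
  refine le_of_mul_le_mul_right (le_trans ?_ hc) hlog
  rw [Real.log_nat_eq_sum_factorization v, sum_mul]
  calc _ ≤ ∑ p ∈ v.primeFactors with D₀ < p, (v.factorization p : ℝ) * Real.log p := by
        refine sum_le_sum fun p hp => ?_
        have hp := (mem_filter.mp hp).2
        gcongr
    _ ≤ _ := sum_le_sum_of_subset_of_nonneg (filter_subset _ _) fun p _ _ =>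
        mul_nonneg (Nat.cast_nonneg _) (Real.log_natCast_nonneg p)

theorem length_primeFactorsList_le {v w z D₀ : ℕ} {k : ℕ → ℕ} {c : ℝ} (hv : v ≠ 0) (hD : 2 ≤ D₀)
    (hc : Real.log v ≤ c * Real.log D₀) (hsmall : ∀ r, r.Prime → r ≤ w → ¬ r ^ k r ∣ v)
    (hsq : ∀ r, r.Prime → w < r → r ≤ D₀ → ¬ r ^ 2 ∣ v) :
    (v.primeFactorsList.length : ℝ) ≤ #{r ∈ midPrimes w z | r ∣ v} + #{r ∈ midPrimes z D₀ | r ∣ v}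
      + ∑ r ∈ Icc 1 w with r.Prime, (#{j ∈ Icc 1 (k r) | r ^ j ∣ v} : ℝ) + c := by
  have h1 : v.primeFactorsList.length ≤ #{p ∈ v.primeFactors | w < p ∧ p ≤ z}
      + #{p ∈ v.primeFactors | z < p ∧ p ≤ D₀} + ∑ p ∈ v.primeFactors with p ≤ w, v.factorization p
      + ∑ p ∈ v.primeFactors with D₀ < p, v.factorization p := by
    rw [length_primeFactorsList_eq]
    simp only [card_filter, sum_filter, ← sum_add_distrib]
    refine sum_le_sum fun p hp => ?_
    have hpp := Nat.prime_of_mem_primeFactors hp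
    rcases le_or_gt p w with h | h
    · rw [if_pos h]; omega
    rcases lt_or_ge D₀ p with h' | h'
    · rw [if_pos h']; omega
    have h2 : v.factorization p ≤ 1 := by
      by_contra! h3
      exact hsq p hpp h h' ((hpp.pow_dvd_iff_le_factorization hv).mpr h3)
    rcases le_or_gt p z with h3 | h3
    · rw [if_pos ⟨h, h3⟩]; omega
    · rw [if_pos (⟨h3, h'⟩ : z < p ∧ p ≤ D₀)]; omega
  have hmid : ∀ a b : ℕ, #{p ∈ v.primeFactors | a < p ∧ p ≤ b} ≤ #{r ∈ midPrimes a b | r ∣ v} := by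
    intro a b
    refine card_le_card fun p hp => ?_
    obtain ⟨h2, h3⟩ := mem_filter.mp hp
    exact mem_filter.mpr ⟨mem_midPrimes.mpr ⟨h3, Nat.prime_of_mem_primeFactors h2⟩,
      Nat.dvd_of_mem_primeFactors h2⟩
  have hsm : ∑ p ∈ v.primeFactors with p ≤ w, v.factorization p
      ≤ ∑ r ∈ Icc 1 w with r.Prime, #{j ∈ Icc 1 (k r) | r ^ j ∣ v} := by
    calc _ ≤ ∑ p ∈ v.primeFactors with p ≤ w, #{j ∈ Icc 1 (k p) | p ^ j ∣ v} := by
          refine sum_le_sum fun p hp => ?_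
          obtain ⟨h2, h3⟩ := mem_filter.mp hp
          have hpp := Nat.prime_of_mem_primeFactors h2
          calc v.factorization p = #(Icc 1 (v.factorization p)) := by simp
            _ ≤ _ := card_le_card fun j hj => by
                obtain ⟨h4, h5⟩ := mem_Icc.mp hj
                refine mem_filter.mpr ⟨mem_Icc.mpr ⟨h4, h5.trans ?_⟩,
                  (hpp.pow_dvd_iff_le_factorization hv).mpr h5⟩
                by_contra! h6
                exact hsmall p hpp h3 ((hpp.pow_dvd_iff_le_factorization hv).mpr h6.le)
      _ ≤ _ := by
          refine sum_le_sum_of_subset_of_nonneg (fun p hp => ?_) fun _ _ _ => Nat.zero_le _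
          obtain ⟨h2, h3⟩ := mem_filter.mp hp
          have hpp := Nat.prime_of_mem_primeFactors h2
          exact mem_filter.mpr ⟨mem_Icc.mpr ⟨hpp.one_lt.le, h3⟩, hpp⟩
  have h2 := sum_factorization_large_le hD hc
  have h3 := h1.trans (Nat.add_le_add_right (Nat.add_le_add (Nat.add_le_add (hmid w z) (hmid z D₀)) hsm) _)
  have h4 : (v.primeFactorsList.length : ℝ) ≤ #{r ∈ midPrimes w z | r ∣ v} + #{r ∈ midPrimes z D₀ | r ∣ v}
      + ∑ r ∈ Icc 1 w with r.Prime, (#{j ∈ Icc 1 (k r) | r ^ j ∣ v} : ℝ)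
      + ∑ p ∈ v.primeFactors with D₀ < p, (v.factorization p : ℝ) := by exact_mod_cast h3
  linarith

theorem sum_succ_div_pow_le {r n : ℕ} (hr : 2 ≤ r) :
    ∑ k ∈ Icc 1 n, ((k : ℝ) + 1) / (r : ℝ) ^ k ≤ 6 / r := by
  have hr0 : (2 : ℝ) ≤ r := by exact_mod_cast hr
  have h2 : ∀ n : ℕ, ∑ k ∈ range n, ((k : ℝ) + 2) / 2 ^ k = 6 - (2 * n + 6) / 2 ^ n := by
    intro n
    induction n with
    | zero => simp
    | succ n ih => rw [sum_range_succ, ih]; push_cast; field_simp; ring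
  rw [← Ico_add_one_right_eq_Icc, sum_Ico_eq_sum_range]
  calc _ = ∑ k ∈ range n, (1 / (r : ℝ)) * (((k : ℝ) + 2) / r ^ k) := by
        refine sum_congr (by simp) fun k _ => ?_
        rw [pow_add]; push_cast; field_simp; ring
    _ ≤ ∑ k ∈ range n, (1 / (r : ℝ)) * (((k : ℝ) + 2) / 2 ^ k) := by gcongr
    _ = (1 / (r : ℝ)) * (6 - (2 * n + 6) / 2 ^ n) := by rw [← mul_sum, h2]
    _ ≤ (1 / (r : ℝ)) * 6 := by gcongr; linarith [show (0:ℝ) ≤ (2 * n + 6) / 2 ^ n by positivity]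
    _ = _ := by ring

open Classical in
theorem bad_le {X w z D₀ n m q : ℕ} {k : ℕ → ℕ} {lam c : ℝ} (hl : 0 < lam) (hD₀ : 2 ≤ D₀)
    (hwz : w ≤ z) (hc : 2 * Real.log X ≤ c * Real.log D₀) (hq : q.Prime) (hqm : ¬ q ∣ m)
    (hn : n = m * q) (hn2 : 2 ≤ n) (hnX : n ≤ X)
    (hb : (nStar w z n : ℝ) + lam + c < (sP n).primeFactorsList.length)
    (hcom : ¬ ∃ r, r.Prime ∧ w < r ∧ r ∣ n ∧ r ∣ sP n) :
    (1 : ℝ) ≤ #{d ∈ (midPrimes w D₀).image (· ^ 2) | CopAll d m ∧ d ∣ q * sP m + sD m}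
      + ∑ r ∈ Icc 1 w with r.Prime, (if r ^ k r ∣ q * sP m + sD m then (1 : ℝ) else 0)
      + lam⁻¹ * ((#{r ∈ midPrimes z D₀ | CopAll r m ∧ r ∣ q * sP m + sD m} : ℝ)
        + ∑ r ∈ Icc 1 w with r.Prime, ∑ j ∈ Icc 1 (k r),
          (if r ^ j ∣ q * sP m + sD m then (1 : ℝ) else 0)) := by
  have hv : sP n = q * sP m + sD m := by rw [hn, sP_mul_prime hq hqm]
  rw [← hv]
  have hcop : ∀ r, r.Prime → w < r → r ∣ sP n → CopAll r m := fun r hr hwr hrv =>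
    copAll_of_dvd hr (hv ▸ hrv) fun h => hcom ⟨r, hr, hwr, hn ▸ h, hrv⟩
  have hg : 0 ≤ lam⁻¹ * ((#{r ∈ midPrimes z D₀ | CopAll r m ∧ r ∣ sP n} : ℝ)
        + ∑ r ∈ Icc 1 w with r.Prime, ∑ j ∈ Icc 1 (k r), (if r ^ j ∣ sP n then (1 : ℝ) else 0)) := by
    refine mul_nonneg (inv_nonneg.mpr hl.le) (add_nonneg (Nat.cast_nonneg _)
      (sum_nonneg fun _ _ => sum_nonneg fun _ _ => ?_))
    split_ifs <;> norm_num
  have hbn : ∀ r ∈ (Icc 1 w).filter Nat.Prime, (0 : ℝ) ≤ if r ^ k r ∣ sP n then (1 : ℝ) else 0 := by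
    intro r _; split_ifs <;> norm_num
  by_cases hsq : ∃ r, r.Prime ∧ w < r ∧ r ≤ D₀ ∧ r ^ 2 ∣ sP n
  · obtain ⟨r, hr, hwr, hrD, hrv⟩ := hsq
    have h1 : 0 < #{d ∈ (midPrimes w D₀).image (· ^ 2) | CopAll d m ∧ d ∣ sP n} := by
      refine card_pos.mpr ⟨r ^ 2, mem_filter.mpr ⟨mem_image.mpr ⟨r, mem_midPrimes.mpr ⟨⟨hwr, hrD⟩, hr⟩, rfl⟩,
        ?_, hrv⟩⟩
      obtain ⟨h2, h3, h4⟩ := hcop r hr hwr ((dvd_pow_self r two_ne_zero).trans hrv)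
      exact ⟨h2.pow_left 2, h3.pow_left 2, h4.pow_left 2⟩
    have h2 : (1 : ℝ) ≤ #{d ∈ (midPrimes w D₀).image (· ^ 2) | CopAll d m ∧ d ∣ sP n} := by
      exact_mod_cast h1
    linarith [sum_nonneg hbn]
  by_cases hsm : ∃ r, r.Prime ∧ r ≤ w ∧ r ^ k r ∣ sP n
  · obtain ⟨r, hr, hrw, hrv⟩ := hsm
    have h1 := single_le_sum hbn (mem_filter.mpr ⟨mem_Icc.mpr ⟨hr.one_lt.le, hrw⟩, hr⟩)
    rw [if_pos hrv] at h1
    have h2 : (0 : ℝ) ≤ #{d ∈ (midPrimes w D₀).image (· ^ 2) | CopAll d m ∧ d ∣ sP n} := Nat.cast_nonneg _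
    linarith
  push Not at hsq hsm
  have hv0 : sP n ≠ 0 := (sP_pos hn2).ne'
  have hlogv : Real.log (sP n) ≤ c * Real.log D₀ := by
    refine le_trans ?_ hc
    have h1 : sP n ≤ X ^ 2 := by
      have := sD_eq n
      have h2 := sD_le_sq n
      have h3 : n ^ 2 ≤ X ^ 2 := Nat.pow_le_pow_left hnX 2
      omega
    have h2 : Real.log (sP n) ≤ Real.log ((X : ℝ) ^ 2) :=
      Real.log_le_log (by exact_mod_cast Nat.pos_of_ne_zero hv0) (by exact_mod_cast h1)
    rw [Real.log_pow] at h2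
    exact_mod_cast h2
  have key := length_primeFactorsList_le (z := z) (k := k) hv0 hD₀ hlogv hsm
    (fun r hr h1 h2 => hsq r hr h1 h2)
  have e1 : #{r ∈ midPrimes w z | r ∣ sP n} ≤ nStar w z n := by
    refine card_le_card fun r hr => ?_
    obtain ⟨h1, h2⟩ := mem_filter.mp hr
    obtain ⟨⟨h3, _⟩, h4⟩ := mem_midPrimes.mp h1
    exact mem_filter.mpr ⟨h1, h2, fun h => hcom ⟨r, h4, h3, h, h2⟩⟩
  have e2 : #{r ∈ midPrimes z D₀ | r ∣ sP n} ≤ #{r ∈ midPrimes z D₀ | CopAll r m ∧ r ∣ sP n} := by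
    refine card_le_card fun r hr => ?_
    obtain ⟨h1, h2⟩ := mem_filter.mp hr
    obtain ⟨⟨h3, _⟩, h4⟩ := mem_midPrimes.mp h1
    exact mem_filter.mpr ⟨h1, hcop r h4 (hwz.trans_lt h3) h2, h2⟩
  have e1' : (#{r ∈ midPrimes w z | r ∣ sP n} : ℝ) ≤ nStar w z n := by exact_mod_cast e1
  have e2' : (#{r ∈ midPrimes z D₀ | r ∣ sP n} : ℝ) ≤ #{r ∈ midPrimes z D₀ | CopAll r m ∧ r ∣ sP n} := by
    exact_mod_cast e2
  have e3 : ∑ r ∈ Icc 1 w with r.Prime, (#{j ∈ Icc 1 (k r) | r ^ j ∣ sP n} : ℝ)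
      = ∑ r ∈ Icc 1 w with r.Prime, ∑ j ∈ Icc 1 (k r), (if r ^ j ∣ sP n then (1 : ℝ) else 0) := by
    refine sum_congr rfl fun r _ => ?_
    rw [card_filter]; push_cast; rfl
  rw [e3] at key
  have h5 : 1 ≤ lam⁻¹ * ((#{r ∈ midPrimes z D₀ | CopAll r m ∧ r ∣ sP n} : ℝ)
        + ∑ r ∈ Icc 1 w with r.Prime, ∑ j ∈ Icc 1 (k r), (if r ^ j ∣ sP n then (1 : ℝ) else 0)) := by
    rw [inv_mul_eq_div, one_le_div hl]
    linarith
  have h2 : (0 : ℝ) ≤ #{d ∈ (midPrimes w D₀).image (· ^ 2) | CopAll d m ∧ d ∣ sP n} := Nat.cast_nonneg _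
  linarith [sum_nonneg hbn]

open Classical in
theorem auxMass_mul_card_bad_le {X w z D₀ κ : ℕ} {lam c : ℝ} (hl : 0 < lam) (hD : 2 ≤ D) (hDX : D ≤ X)
    (hD₀ : 2 ≤ D₀) (hDD : D₀ ^ 2 ≤ D) (hw : 2 ≤ w) (hwz : w ≤ z) (hwD : w ^ 5 ≤ D ^ 4)
    (hκ : 1 ≤ κ) (hκw : κ ^ 4 ≤ w) (hc : 2 * Real.log X ≤ c * Real.log D₀) :
    auxMass X D * #{n ∈ Icc 1 X | 2 ≤ n ∧ (nStar w z n : ℝ) + lam + c < (sP n).primeFactorsList.length}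
      ≤ auxMass X D * (X / κ + 2 * X * (1 + Real.log X) / w) + transferErr X D
        + (4 * X * (1 + Real.log X) ^ 3 / Real.sqrt w + X * auxMass X D * (1 / w))
        + 9 * X * (1 + Real.log X) / Real.log D * (5 / (w : ℝ) ^ 2)
        + lam⁻¹ * ((4 * X * (1 + Real.log X) ^ 3 / Real.sqrt w
            + X * auxMass X D * ∑ r ∈ midPrimes z D₀, (1 : ℝ) / r)
          + 9 * X * (1 + Real.log X) / Real.log D * (6 * ∑ r ∈ Icc 1 w with r.Prime, (1 : ℝ) / r)) := by
  set k : ℕ → ℕ := fun r => Nat.log r (w ^ 5) with hk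
  set F : ℝ := 9 * X * (1 + Real.log X) / Real.log D with hF
  have hF0 : 0 ≤ F := by
    have h1 := Real.log_natCast_nonneg X
    have h2 := Real.log_natCast_nonneg D
    positivity
  have hkD : ∀ r, r ^ k r ≤ D ^ 4 := fun r => (Nat.pow_log_le_self r (by positivity)).trans hwD
  set P : ℕ → Prop := fun n => 2 ≤ n ∧ (nStar w z n : ℝ) + lam + c < (sP n).primeFactorsList.length with hP
  set Q : ℕ → Prop := fun n => ∃ r, r.Prime ∧ w < r ∧ r ∣ n ∧ r ∣ sP n with hQ
  set R : ℕ → Prop := fun n => P n ∧ ¬ Q n with hR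
  have hsplit : (#{n ∈ Icc 1 X | P n} : ℝ) ≤ #{n ∈ Icc 1 X | Q n} + #{n ∈ Icc 1 X | R n} := by
    have h1 : {n ∈ Icc 1 X | P n} ⊆ {n ∈ Icc 1 X | Q n} ∪ {n ∈ Icc 1 X | R n} := by
      intro n hn
      obtain ⟨h1, h2⟩ := mem_filter.mp hn
      by_cases h3 : Q n
      · exact mem_union_left _ (mem_filter.mpr ⟨h1, h3⟩)
      · exact mem_union_right _ (mem_filter.mpr ⟨h1, h2, h3⟩)
    exact_mod_cast (card_le_card h1).trans (card_union_le _ _)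
  have hQc := card_common_large_prime_le (X := X) hκ hκw
  have hpair := auxMass_mul_card_le (X := X) hD R
  have hpt : pairSum X D (fun m q => if ¬ q ∣ m ∧ R (m * q) then (1 : ℝ) else 0)
      ≤ pairSum X D (fun m q => (#{d ∈ (midPrimes w D₀).image (· ^ 2) | CopAll d m ∧ d ∣ q * sP m + sD m} : ℝ)
        + ∑ r ∈ Icc 1 w with r.Prime, (if r ^ k r ∣ q * sP m + sD m then (1 : ℝ) else 0)
        + lam⁻¹ * ((#{r ∈ midPrimes z D₀ | CopAll r m ∧ r ∣ q * sP m + sD m} : ℝ)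
          + ∑ r ∈ Icc 1 w with r.Prime, ∑ j ∈ Icc 1 (k r),
            (if r ^ j ∣ q * sP m + sD m then (1 : ℝ) else 0))) := by
    refine pairSum_le_pairSum fun j m q hm hq => ?_
    obtain ⟨hq1, hq2⟩ := mem_boxQ.mp hq
    have hqp := (mem_auxP.mp hq1).2
    split_ifs with h
    · obtain ⟨h1, ⟨h2, h3⟩, h4⟩ := h
      refine bad_le hl hD₀ hwz hc hqp h1 rfl h2 ?_ h3 h4
      subst hq2
      have := (mem_Icc.mp (boxM_subset hD hqp.pos hm)).2
      exact (Nat.le_div_iff_mul_le hqp.pos).mp this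
    · have h1 : ∀ r j : ℕ, (0 : ℝ) ≤ if r ^ j ∣ q * sP m + sD m then (1 : ℝ) else 0 := by
        intro r j; split_ifs <;> norm_num
      refine add_nonneg (add_nonneg (Nat.cast_nonneg _) (sum_nonneg fun r _ => h1 _ _))
        (mul_nonneg (inv_nonneg.mpr hl.le) (add_nonneg (Nat.cast_nonneg _)
          (sum_nonneg fun r _ => sum_nonneg fun j _ => h1 _ _)))
  rw [pairSum_add, pairSum_add, pairSum_mul_left, pairSum_add, pairSum_finset_sum, pairSum_finset_sum] at hpt
  simp only [pairSum_finset_sum] at hpt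
  have ha : pairSum X D (fun m q => (#{d ∈ (midPrimes w D₀).image (· ^ 2) | CopAll d m ∧ d ∣ q * sP m + sD m} : ℝ))
      ≤ 4 * X * (1 + Real.log X) ^ 3 / Real.sqrt w + X * auxMass X D * (1 / w) := by
    refine (pairSum_card_dvd_le hD hDX (by omega : 0 < w) _ ?_).trans ?_
    · intro d hd
      obtain ⟨r, hr, rfl⟩ := mem_image.mp hd
      obtain ⟨⟨h1, h2⟩, h3⟩ := mem_midPrimes.mp hr
      refine mem_roughs.mpr ⟨⟨Nat.one_le_pow _ _ h3.pos, (Nat.pow_le_pow_left h2 2).trans hDD⟩, fun p hp hpr => ?_⟩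
      rw [(Nat.prime_dvd_prime_iff_eq hp h3).mp (hp.dvd_of_dvd_pow hpr)]
      exact h1
    · have hX := auxMass_nonneg X D
      gcongr
      rw [sum_image fun a _ b _ h => Nat.pow_left_injective two_ne_zero h]
      refine le_trans ?_ (sum_inv_sq_gt_le w D₀ (by omega))
      push_cast
      exact sum_le_sum_of_subset_of_nonneg (filter_subset _ _) fun _ _ _ => by positivity
  have hg2 : pairSum X D (fun m q => (#{r ∈ midPrimes z D₀ | CopAll r m ∧ r ∣ q * sP m + sD m} : ℝ))
      ≤ 4 * X * (1 + Real.log X) ^ 3 / Real.sqrt w + X * auxMass X D * ∑ r ∈ midPrimes z D₀, (1 : ℝ) / r := by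
    refine pairSum_card_dvd_le hD hDX (by omega : 0 < w) _ ?_
    intro r hr
    obtain ⟨⟨h1, h2⟩, h3⟩ := mem_midPrimes.mp hr
    refine mem_roughs.mpr ⟨⟨h3.pos, h2.trans ((Nat.le_self_pow two_ne_zero _).trans hDD)⟩, fun p hp hpr => ?_⟩
    rw [(Nat.prime_dvd_prime_iff_eq hp h3).mp hpr]
    omega
  have hb : ∑ r ∈ Icc 1 w with r.Prime,
      pairSum X D (fun m q => if r ^ k r ∣ q * sP m + sD m then (1 : ℝ) else 0) ≤ F * (5 / (w : ℝ) ^ 2) := by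
    have hw0 : (0 : ℝ) < w := by exact_mod_cast (by omega : 0 < w)
    have h1 : ∀ r ∈ (Icc 1 w).filter Nat.Prime,
        pairSum X D (fun m q => if r ^ k r ∣ q * sP m + sD m then (1 : ℝ) else 0) ≤ F * (5 / (w : ℝ) ^ 3) := by
      intro r hr
      obtain ⟨h2, h3⟩ := mem_filter.mp hr
      have hrw := (mem_Icc.mp h2).2
      refine (pairSum_prime_power_dvd_le hD h3 (hkD r)).trans (mul_le_mul_of_nonneg_left ?_ hF0)
      have h4 : w ^ 4 ≤ r ^ k r := by
        have h5 : w ^ 5 < r ^ (k r + 1) := Nat.lt_pow_succ_log_self h3.one_lt _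
        rw [pow_succ] at h5
        by_contra! h6
        have : r ^ k r * r ≤ w ^ 4 * w := Nat.mul_le_mul h6.le hrw
        rw [← pow_succ] at this
        omega
      have h5 : k r + 1 ≤ 5 * w := by
        have h6 : 2 ^ k r < 2 ^ (5 * w) := by
          calc 2 ^ k r ≤ r ^ k r := Nat.pow_le_pow_left h3.two_le _
            _ ≤ w ^ 5 := Nat.pow_log_le_self r (by positivity)
            _ < (2 ^ w) ^ 5 := Nat.pow_lt_pow_left Nat.lt_two_pow_self (by norm_num)
            _ = 2 ^ (5 * w) := by rw [← pow_mul, mul_comm]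
        exact (Nat.pow_lt_pow_iff_right (by norm_num)).mp h6
      have h4' : (w : ℝ) ^ 4 ≤ (r : ℝ) ^ k r := by exact_mod_cast h4
      have h5' : (k r : ℝ) + 1 ≤ 5 * w := by exact_mod_cast h5
      calc ((k r : ℝ) + 1) / (r : ℝ) ^ k r ≤ (5 * w) / (w : ℝ) ^ 4 := by gcongr
        _ = _ := by field_simp
    refine (sum_le_sum h1).trans ?_
    rw [sum_const, nsmul_eq_mul]
    have h2 : (#((Icc 1 w).filter Nat.Prime) : ℝ) ≤ w := by
      exact_mod_cast (card_filter_le _ _).trans (by simp)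
    calc _ ≤ (w : ℝ) * (F * (5 / (w : ℝ) ^ 3)) := by gcongr
      _ = _ := by field_simp
  have hg1 : ∑ r ∈ Icc 1 w with r.Prime, ∑ j ∈ Icc 1 (k r),
      pairSum X D (fun m q => if r ^ j ∣ q * sP m + sD m then (1 : ℝ) else 0)
      ≤ F * (6 * ∑ r ∈ Icc 1 w with r.Prime, (1 : ℝ) / r) := by
    rw [mul_sum, mul_sum]
    refine sum_le_sum fun r hr => ?_
    have hrp := (mem_filter.mp hr).2
    calc _ ≤ ∑ j ∈ Icc 1 (k r), F * (((j : ℝ) + 1) / (r : ℝ) ^ j) :=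
          sum_le_sum fun j hj => pairSum_prime_power_dvd_le hD hrp
            ((Nat.pow_le_pow_right hrp.pos (mem_Icc.mp hj).2).trans (hkD r))
      _ ≤ F * (6 / r) := by
          rw [← mul_sum]
          exact mul_le_mul_of_nonneg_left (sum_succ_div_pow_le hrp.two_le) hF0
      _ = _ := by ring
  have hfin := mul_le_mul_of_nonneg_left (hsplit.trans (add_le_add_left hQc _)) (auxMass_nonneg X D)
  have hlam := mul_le_mul_of_nonneg_left (add_le_add hg2 hg1) (inv_nonneg.mpr hl.le)
  rw [mul_add] at hfin
  refine le_trans (le_of_eq ?_) (hfin.trans ?_)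
  · congr!
  have s1 := add_le_add (add_le_add ha hb) hlam
  have s2 := hpt.trans s1
  have s3 := hpair.trans (add_le_add (le_trans (le_of_eq (by congr!)) s2) le_rfl)
  have s4 : auxMass X D * (#{n ∈ Icc 1 X | R n} : ℝ) ≤ _ := le_trans (le_of_eq (by congr!)) s3
  linarith

theorem half_le_floor {y : ℝ} (hy : 1 ≤ y) : y / 2 ≤ ⌊y⌋₊ := by
  have h1 := Nat.lt_floor_add_one y
  have h2 : (1 : ℝ) ≤ ⌊y⌋₊ := by exact_mod_cast Nat.floor_pos.mpr hy
  linarith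

theorem log_floor_exp_le (t : ℝ) (ht : 0 ≤ t) : Real.log ⌊Real.exp t⌋₊ ≤ t := by
  have h1 : 0 < ⌊Real.exp t⌋₊ := Nat.floor_pos.mpr (Real.one_le_exp ht)
  calc _ ≤ Real.log (Real.exp t) := Real.log_le_log (by exact_mod_cast h1) (Nat.floor_le (Real.exp_pos t).le)
    _ = t := Real.log_exp t

theorem sub_one_le_log_floor_exp (t : ℝ) (ht : 0 ≤ t) : t - 1 ≤ Real.log ⌊Real.exp t⌋₊ := by
  have h2 := half_le_floor (Real.one_le_exp ht)
  have h3 := Real.log_le_log (by positivity) h2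
  rw [Real.log_div (Real.exp_pos t).ne' two_ne_zero, Real.log_exp] at h3
  linarith [Real.log_two_lt_d9]

theorem log_sqrt_bounds {N : ℕ} (hN : 1 ≤ N) :
    Real.log N / 2 - 1 ≤ Real.log N.sqrt ∧ Real.log N.sqrt ≤ Real.log N / 2 := by
  have hs : 1 ≤ N.sqrt := Nat.le_sqrt.mpr (by simpa using hN)
  have hs0 : (0 : ℝ) < N.sqrt := by exact_mod_cast hs
  have h1 : (N : ℝ) ≤ (2 * N.sqrt) ^ 2 := by
    have h3 : N < (N.sqrt + 1) ^ 2 := by rw [pow_two]; exact Nat.lt_succ_sqrt N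
    have h4 : (N.sqrt + 1) ^ 2 ≤ (2 * N.sqrt) ^ 2 := Nat.pow_le_pow_left (by omega) 2
    exact_mod_cast h3.le.trans h4
  have h2 : (N.sqrt : ℝ) ^ 2 ≤ N := by
    rw [pow_two]; exact_mod_cast Nat.sqrt_le N
  have hN0 : (0 : ℝ) < N := by exact_mod_cast hN
  have h3 := Real.log_le_log hN0 h1
  have h4 := Real.log_le_log (by positivity) h2
  rw [Real.log_pow, Real.log_mul two_ne_zero hs0.ne'] at h3
  rw [Real.log_pow] at h4
  push_cast at h3 h4
  constructor <;> linarith [Real.log_two_lt_d9]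

/-- `log x` as a function of `b = (log log x)^(1/4)`. -/
noncomputable def ell (b : ℝ) : ℝ := Real.exp (b ^ 4)

/-- The length of the range of `n`. -/
noncomputable def rangeX (b : ℝ) : ℕ := ⌊Real.exp (ell b)⌋₊

/-- The level of distribution. -/
noncomputable def levelD (b : ℝ) : ℕ := ⌊Real.exp (ell b / b)⌋₊

/-- The lower end of the main range of primes. -/
noncomputable def lowW (b : ℝ) : ℕ := ⌊ell b ^ 8⌋₊

/-- The upper end of the main range of primes. -/
noncomputable def highZ (b : ℝ) : ℕ := ⌊Real.exp (ell b / b ^ 4)⌋₊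

/-- The truncation level of the inclusion–exclusion. -/
noncomputable def truncK (b : ℝ) : ℕ := ⌊b ^ 3⌋₊

/-- The threshold for squarefull parts. -/
noncomputable def sqK (b : ℝ) : ℕ := ⌊ell b ^ 2⌋₊

theorem pow_le_ell {b : ℝ} (hb : 1000 ≤ b) : b ^ 20 ≤ ell b := by
  have h1 := Real.pow_div_factorial_le_exp (b ^ 4) (by positivity) 6
  refine le_trans ?_ h1
  rw [le_div_iff₀ (by positivity)]
  have h2 : (1000 : ℝ) ^ 4 ≤ b ^ 4 := by gcongr
  have h3 : ((Nat.factorial 6 : ℕ) : ℝ) ≤ b ^ 4 := by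
    norm_num [Nat.factorial] at h2 ⊢; linarith
  calc b ^ 20 * (Nat.factorial 6 : ℕ) ≤ b ^ 20 * b ^ 4 := by gcongr
    _ = _ := by ring

theorem log_ell (b : ℝ) : Real.log (ell b) = b ^ 4 := Real.log_exp _

theorem ell_pow (b : ℝ) (n : ℕ) : ell b ^ n = Real.exp (n * b ^ 4) := by
  rw [ell, ← Real.exp_nat_mul]

theorem highZ_pow_le {b : ℝ} (hb : 1000 ≤ b) : highZ b ^ truncK b ≤ levelD b := by
  refine Nat.le_floor ?_
  push_cast
  have hb0 : 0 < b := by linarith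
  have hl : 0 < ell b := Real.exp_pos _
  calc (highZ b : ℝ) ^ truncK b ≤ Real.exp (ell b / b ^ 4) ^ truncK b := by
        gcongr; exact Nat.floor_le (Real.exp_pos _).le
    _ = Real.exp (truncK b * (ell b / b ^ 4)) := by rw [← Real.exp_nat_mul]
    _ ≤ Real.exp (b ^ 3 * (ell b / b ^ 4)) := by
        gcongr; exact Nat.floor_le (by positivity)
    _ = _ := by congr 1; field_simp

theorem lowW_le_highZ {b : ℝ} (hb : 1000 ≤ b) : lowW b ≤ highZ b := by
  refine Nat.floor_mono ?_
  rw [ell_pow]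
  have hb0 : 0 < b := by linarith
  gcongr
  rw [le_div_iff₀ (by positivity)]
  refine le_trans ?_ (pow_le_ell hb)
  have h1 : (8 : ℝ) ≤ b ^ 12 := le_trans (by norm_num) (pow_le_pow_left₀ (by norm_num) hb 12)
  push_cast
  nlinarith [show 0 < b ^ 8 by positivity]

theorem two_le_truncK {b : ℝ} (hb : 1000 ≤ b) : 8 ≤ truncK b := by
  refine Nat.le_floor ?_
  push_cast
  exact le_trans (by norm_num) (pow_le_pow_left₀ (by norm_num) hb 3)

theorem ell_ge {b : ℝ} (hb : 1000 ≤ b) : 1000 ≤ ell b :=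
  hb.trans ((le_self_pow₀ (by linarith) (by norm_num)).trans (pow_le_ell hb))

theorem ell_pow_eight_div_two_le {b : ℝ} (hb : 1000 ≤ b) : ell b ^ 8 / 2 ≤ lowW b :=
  half_le_floor (one_le_pow₀ (by linarith [ell_ge hb]))

theorem ell_le_lowW {b : ℝ} (hb : 1000 ≤ b) : ell b ≤ lowW b := by
  refine le_trans ?_ (ell_pow_eight_div_two_le hb)
  have h1 := ell_ge hb
  have h2 : (2 : ℝ) ≤ ell b ^ 7 := le_trans (by norm_num) (pow_le_pow_left₀ (by norm_num) h1 7)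
  rw [le_div_iff₀ two_pos]
  calc ell b * 2 ≤ ell b * ell b ^ 7 := by gcongr
    _ = _ := by ring

theorem two_le_lowW {b : ℝ} (hb : 1000 ≤ b) : 2 ≤ lowW b := by
  have h1 := ell_le_lowW hb
  have h2 := ell_ge hb
  exact_mod_cast (by linarith : (2 : ℝ) ≤ lowW b)

theorem highZ_pow_eight_le {b : ℝ} (hb : 1000 ≤ b) : highZ b ^ 8 ≤ levelD b :=
  (Nat.pow_le_pow_right (by have := two_le_lowW hb; have := lowW_le_highZ hb; omega)
    (two_le_truncK hb)).trans (highZ_pow_le hb)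

theorem highZ_le_sqrt {b : ℝ} (hb : 1000 ≤ b) : highZ b ≤ (levelD b).sqrt := by
  rw [Nat.le_sqrt, ← pow_two]
  refine le_trans (Nat.pow_le_pow_right ?_ (by norm_num)) (highZ_pow_eight_le hb)
  have := two_le_lowW hb; have := lowW_le_highZ hb; omega

theorem highZ_le_levelD {b : ℝ} (hb : 1000 ≤ b) : highZ b ≤ levelD b :=
  (highZ_le_sqrt hb).trans (Nat.sqrt_le_self _)

theorem levelD_le_rangeX {b : ℝ} (hb : 1000 ≤ b) : levelD b ≤ rangeX b := by
  refine Nat.floor_mono ?_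
  have hl : 0 < ell b := Real.exp_pos _
  gcongr
  exact div_le_self hl.le (by linarith)

theorem lowW_pow_le {b : ℝ} (hb : 1000 ≤ b) : lowW b ^ 5 ≤ levelD b ^ 4 := by
  have h1 := two_le_lowW hb
  have h2 := lowW_le_highZ hb
  calc lowW b ^ 5 ≤ highZ b ^ 5 := Nat.pow_le_pow_left h2 5
    _ ≤ highZ b ^ 8 := Nat.pow_le_pow_right (by omega) (by norm_num)
    _ ≤ levelD b := highZ_pow_eight_le hb
    _ ≤ _ := Nat.le_self_pow (by norm_num) _

theorem sqK_pow_le (b : ℝ) : sqK b ^ 4 ≤ lowW b := by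
  refine Nat.le_floor ?_
  have hl : 0 < ell b := Real.exp_pos _
  push_cast
  calc (sqK b : ℝ) ^ 4 ≤ (ell b ^ 2) ^ 4 := by gcongr; exact Nat.floor_le (by positivity)
    _ = _ := by ring

theorem levelD_pow_le_sqrt {b : ℝ} (hb : 1000 ≤ b) : levelD b ^ 16 ≤ (rangeX b).sqrt := by
  rw [Nat.le_sqrt, ← pow_add]
  refine Nat.le_floor ?_
  have hl : 0 < ell b := Real.exp_pos _
  push_cast
  calc (levelD b : ℝ) ^ (16 + 16) ≤ Real.exp (ell b / b) ^ (16 + 16) := by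
        gcongr; exact Nat.floor_le (Real.exp_pos _).le
    _ = Real.exp (32 * (ell b / b)) := by rw [← Real.exp_nat_mul]; norm_num
    _ ≤ _ := by
        gcongr
        rw [← mul_div_assoc, div_le_iff₀ (by linarith)]
        nlinarith

theorem two_le_levelD {b : ℝ} (hb : 1000 ≤ b) : 2 ≤ levelD b :=
  (two_le_lowW hb).trans ((lowW_le_highZ hb).trans (highZ_le_levelD hb))

theorem ell_le_levelD {b : ℝ} (hb : 1000 ≤ b) : ell b ≤ levelD b :=
  (ell_le_lowW hb).trans (by exact_mod_cast (lowW_le_highZ hb).trans (highZ_le_levelD hb))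

theorem log_levelD_ge {b : ℝ} (hb : 1000 ≤ b) : ell b / (2 * b) ≤ Real.log (levelD b) := by
  have hl := ell_ge hb
  have h0 : b ^ 2 ≤ ell b := (pow_le_pow_right₀ (by linarith) (by norm_num)).trans (pow_le_ell hb)
  have h1 := sub_one_le_log_floor_exp (ell b / b) (by positivity)
  have h2 : b ≤ ell b / b := by rw [le_div_iff₀ (by linarith)]; nlinarith
  have e : ell b / (2 * b) = ell b / b / 2 := by field_simp
  rw [e]
  simp only [levelD]
  linarith

theorem log_sqrt_levelD_ge {b : ℝ} (hb : 1000 ≤ b) :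
    ell b / (8 * b) ≤ Real.log (levelD b).sqrt := by
  have hl := ell_ge hb
  have h0 : b ^ 2 ≤ ell b := (pow_le_pow_right₀ (by linarith) (by norm_num)).trans (pow_le_ell hb)
  have h1 := (log_sqrt_bounds (by have := two_le_levelD hb; omega : 1 ≤ levelD b)).1
  have h3 := log_levelD_ge hb
  have h2 : b ≤ ell b / b := by rw [le_div_iff₀ (by linarith)]; nlinarith
  have e : ell b / (2 * b) = ell b / b / 2 := by field_simp
  have e' : ell b / (8 * b) = ell b / b / 8 := by field_simp
  rw [e] at h3
  rw [e']
  linarith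

theorem log_sqrt_levelD_le {b : ℝ} (hb : 1000 ≤ b) :
    Real.log (levelD b).sqrt ≤ ell b / b := by
  have hl := ell_ge hb
  have h1 := (log_sqrt_bounds (by have := two_le_levelD hb; omega : 1 ≤ levelD b)).2
  have h2 := log_floor_exp_le (ell b / b) (by positivity)
  have h3 := Real.log_natCast_nonneg (levelD b)
  simp only [levelD] at *
  linarith

theorem log_rangeX_le (b : ℝ) : Real.log (rangeX b) ≤ ell b := log_floor_exp_le _ (Real.exp_pos _).le

theorem log_sqrt_rangeX_ge {b : ℝ} (hb : 1000 ≤ b) : ell b / 4 ≤ Real.log (rangeX b).sqrt := by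
  have hl := ell_ge hb
  have hX : 1 ≤ rangeX b := by have := two_le_levelD hb; have := levelD_le_rangeX hb; omega
  have h1 := (log_sqrt_bounds hX).1
  have h2 := sub_one_le_log_floor_exp (ell b) (by positivity)
  simp only [rangeX] at *
  linarith

theorem log_log_lowW_bounds {b : ℝ} (hb : 1000 ≤ b) :
    0 ≤ Real.log (Real.log (lowW b)) ∧ Real.log (Real.log (lowW b)) ≤ Real.log (8 * b ^ 4) := by
  have hl := ell_ge hb
  have hb4 : 1000 ≤ b ^ 4 := hb.trans (le_self_pow₀ (by linarith) (by norm_num))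
  have h1 : b ^ 4 ≤ Real.log (lowW b) := by
    rw [← log_ell]; exact Real.log_le_log (by linarith) (ell_le_lowW hb)
  have h2 : Real.log (lowW b) ≤ 8 * b ^ 4 := by
    have h3 : (lowW b : ℝ) ≤ ell b ^ 8 := Nat.floor_le (by positivity)
    have h4 := Real.log_le_log (by have := ell_le_lowW hb; linarith) h3
    rw [Real.log_pow, log_ell] at h4
    exact_mod_cast h4
  exact ⟨Real.log_nonneg (by linarith), Real.log_le_log (by linarith) h2⟩

theorem log_log_highZ_bounds {b : ℝ} (hb : 1000 ≤ b) :
    b ^ 4 - Real.log (2 * b ^ 4) ≤ Real.log (Real.log (highZ b)) ∧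
      Real.log (Real.log (highZ b)) ≤ b ^ 4 := by
  have hl := ell_ge hb
  have hb0 : 0 < b := by linarith
  have hb4 : 1 ≤ b ^ 4 := one_le_pow₀ (by linarith)
  have h0 : b ^ 4 * 2 ≤ ell b := by
    refine le_trans ?_ (pow_le_ell hb)
    have h1 : (2 : ℝ) ≤ b ^ 16 := le_trans (by norm_num) (pow_le_pow_left₀ (by norm_num) hb 16)
    calc b ^ 4 * 2 ≤ b ^ 4 * b ^ 16 := by gcongr
      _ = _ := by ring
  have h2 : 2 ≤ ell b / b ^ 4 := by rw [le_div_iff₀ (by positivity)]; linarith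
  have h3 : ell b / (2 * b ^ 4) ≤ Real.log (highZ b) := by
    have h4 := sub_one_le_log_floor_exp (ell b / b ^ 4) (by positivity)
    have e : ell b / (2 * b ^ 4) = ell b / b ^ 4 / 2 := by field_simp
    rw [e]
    simp only [highZ]
    linarith
  have h5 : Real.log (highZ b) ≤ ell b / b ^ 4 := log_floor_exp_le _ (by positivity)
  have h6 : 0 < ell b / (2 * b ^ 4) := by positivity
  constructor
  · have := Real.log_le_log h6 h3
    rwa [Real.log_div (by linarith) (by positivity), log_ell] at this
  · refine (Real.log_le_log (by linarith) (h5.trans (div_le_self (by linarith) hb4))).trans ?_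
    rw [log_ell]

theorem log_log_sqrt_levelD_sub_le {b : ℝ} (hb : 1000 ≤ b) :
    Real.log (Real.log (levelD b).sqrt) - Real.log (Real.log (highZ b)) ≤ Real.log (2 * b ^ 4) := by
  have hl := ell_ge hb
  have h1 := (log_log_highZ_bounds hb).1
  have h2 := log_sqrt_levelD_ge hb
  have h3 := log_sqrt_levelD_le hb
  have h4 : 0 < ell b / (8 * b) := by positivity
  have h5 := Real.log_le_log (by linarith) (h3.trans (div_le_self (by linarith) (by linarith : (1:ℝ) ≤ b)))
  rw [log_ell] at h5
  linarith

theorem prime_sum_bounds : ∃ C : ℝ, ∀ b : ℝ, 1000 ≤ b →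
    (∑ r ∈ Icc 1 (lowW b) with r.Prime, (1 : ℝ) / r ≤ C + Real.log (16 * b ^ 8)) ∧
    (∑ r ∈ midPrimes (highZ b) (levelD b).sqrt, (1 : ℝ) / r ≤ C + Real.log (16 * b ^ 8)) ∧
    (|∑ r ∈ midPrimes (lowW b) (highZ b), (1 : ℝ) / r - b ^ 4| ≤ C + Real.log (16 * b ^ 8)) ∧
    Real.log (b / 64) - C ≤ auxMass (rangeX b) (levelD b) := by
  obtain ⟨C₁, hC₁, h₁⟩ := mertens_second
  obtain ⟨C₂, hC₂, h₂⟩ := mertens_interval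
  refine ⟨C₁ + C₂, fun b hb => ?_⟩
  have hb0 : 0 < b := by linarith
  have hl := ell_ge hb
  have hw2 := two_le_lowW hb
  have hwz := lowW_le_highZ hb
  have hD2 := two_le_levelD hb
  have hb4 : 1 ≤ b ^ 4 := one_le_pow₀ (by linarith)
  have e : Real.log (16 * b ^ 8) = Real.log (2 * b ^ 4) + Real.log (8 * b ^ 4) := by
    rw [← Real.log_mul (by positivity) (by positivity)]; congr 1; ring
  have e1 : 0 ≤ Real.log (2 * b ^ 4) := Real.log_nonneg (by linarith)
  have e2 : 0 ≤ Real.log (8 * b ^ 4) := Real.log_nonneg (by linarith)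
  have hW := log_log_lowW_bounds hb
  have hZ := log_log_highZ_bounds hb
  have hS := log_log_sqrt_levelD_sub_le hb
  have i1 := (abs_le.mp (h₁ (lowW b) hw2)).2
  have i2 := (abs_le.mp (h₂ (highZ b) (levelD b).sqrt (hw2.trans hwz) (highZ_le_sqrt hb))).2
  have i3 := abs_le.mp (h₂ (lowW b) (highZ b) hw2 hwz)
  have i4 := (abs_le.mp (h₂ (levelD b ^ 16) (rangeX b).sqrt (hD2.trans (Nat.le_self_pow (by norm_num) _))
    (levelD_pow_le_sqrt hb))).1
  refine ⟨by linarith, ?_, ?_, ?_⟩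
  · rw [midPrimes]; linarith
  · rw [midPrimes, abs_le]; constructor <;> linarith [i3.1, i3.2]
  · rw [auxMass, auxP]
    have j1 : Real.log (ell b / 4) ≤ Real.log (Real.log (rangeX b).sqrt) :=
      Real.log_le_log (by positivity) (log_sqrt_rangeX_ge hb)
    have hD0 : 0 < Real.log (levelD b) := Real.log_pos (by exact_mod_cast hD2)
    have j2 : Real.log (Real.log ((levelD b ^ 16 : ℕ) : ℝ)) ≤ Real.log (16 * (ell b / b)) := by
      push_cast
      rw [Real.log_pow]
      refine Real.log_le_log (by positivity) ?_
      push_cast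
      gcongr
      exact log_floor_exp_le _ (by positivity)
    have j3 : Real.log (b / 64) = Real.log (ell b / 4) - Real.log (16 * (ell b / b)) := by
      rw [← Real.log_div (by positivity) (by positivity)]
      congr 1; field_simp; norm_num
    linarith

theorem tendsto_auxMass : Tendsto (fun b => auxMass (rangeX b) (levelD b)) atTop atTop := by
  obtain ⟨C, h⟩ := prime_sum_bounds
  have h1 : Tendsto (fun b : ℝ => Real.log (b / 64) - C) atTop atTop :=
    tendsto_atTop_add_const_right _ (-C) (Real.tendsto_log_atTop.comp (tendsto_id.atTop_div_const (by norm_num)))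
  refine tendsto_atTop_mono' _ ?_ h1
  filter_upwards [eventually_ge_atTop 1000] with b hb using (h b hb).2.2.2

theorem eventually_log_le_sqrt (C : ℝ) :
    ∀ᶠ b : ℝ in atTop, C + Real.log (16 * b ^ 8) ≤ Real.sqrt b := by
  have h1 : (fun b : ℝ => Real.log b) =o[atTop] fun b => b ^ (1 / 2 : ℝ) := isLittleO_log_rpow_atTop (by norm_num)
  have h2 := h1.bound (show (0 : ℝ) < 1 / 16 by norm_num)
  have h3 : Tendsto (fun b : ℝ => Real.sqrt b) atTop atTop := Real.tendsto_sqrt_atTop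
  filter_upwards [h2, h3.eventually_ge_atTop (2 * (C + Real.log 16)), eventually_ge_atTop 1] with b h4 h5 h6
  rw [← Real.sqrt_eq_rpow, Real.norm_eq_abs, Real.norm_eq_abs, abs_of_nonneg (Real.log_nonneg h6),
    abs_of_nonneg (Real.sqrt_nonneg b)] at h4
  rw [Real.log_mul (by norm_num) (by positivity), Real.log_pow]
  push_cast
  linarith

/-- The estimates on the parameters which hold for all large `b`. -/
structure ParamBounds (b : ℝ) : Prop where
  large : 1000 ≤ b
  mass : 1 ≤ auxMass (rangeX b) (levelD b)
  small_sum : ∑ r ∈ Icc 1 (lowW b) with r.Prime, (1 : ℝ) / r ≤ Real.sqrt b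
  upper_sum : ∑ r ∈ midPrimes (highZ b) (levelD b).sqrt, (1 : ℝ) / r ≤ b
  main_sum : |∑ r ∈ midPrimes (lowW b) (highZ b), (1 : ℝ) / r - b ^ 4| ≤ b

theorem eventually_paramBounds : ∀ᶠ b in atTop, ParamBounds b := by
  obtain ⟨C, h⟩ := prime_sum_bounds
  filter_upwards [eventually_ge_atTop 1000, eventually_log_le_sqrt C,
    tendsto_auxMass.eventually_ge_atTop 1] with b h1 h2 h3
  obtain ⟨h4, h5, h6, _⟩ := h b h1
  have h7 : Real.sqrt b ≤ b := Real.sqrt_le_iff.mpr ⟨by linarith, by nlinarith⟩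
  exact ⟨h1, h3, by linarith, by linarith, by linarith⟩

theorem one_le_rangeX {b : ℝ} (hb : 1000 ≤ b) : 1 ≤ rangeX b := by
  have := two_le_levelD hb; have := levelD_le_rangeX hb; omega

theorem one_add_log_rangeX_le {b : ℝ} (hb : 1000 ≤ b) : 1 + Real.log (rangeX b) ≤ 2 * ell b := by
  linarith [log_rangeX_le b, ell_ge hb]

theorem large_sieve_err_le {b : ℝ} (hb : 1000 ≤ b) :
    4 * (rangeX b : ℝ) * (1 + Real.log (rangeX b)) ^ 3 / Real.sqrt (lowW b) ≤ rangeX b * (64 / ell b) := by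
  have hl := ell_ge hb
  have h1 : ell b ^ 4 / 2 ≤ Real.sqrt (lowW b) := by
    refine Real.le_sqrt_of_sq_le (le_trans ?_ (ell_pow_eight_div_two_le hb))
    have : 0 < ell b ^ 8 := by positivity
    calc (ell b ^ 4 / 2) ^ 2 = ell b ^ 8 / 4 := by ring
      _ ≤ _ := by linarith
  have h2 := one_add_log_rangeX_le hb
  have h3 := Real.log_natCast_nonneg (rangeX b)
  calc _ ≤ 4 * (rangeX b : ℝ) * (2 * ell b) ^ 3 / (ell b ^ 4 / 2) := by gcongr
    _ = _ := by field_simp; ring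

theorem log_div_lowW_le {b : ℝ} (hb : 1000 ≤ b) :
    (1 + Real.log (rangeX b)) / lowW b ≤ 4 / ell b := by
  have hl := ell_ge hb
  have h1 : ell b ^ 2 / 2 ≤ lowW b := by
    refine le_trans ?_ (ell_pow_eight_div_two_le hb)
    gcongr
    · linarith
    · norm_num
  have h2 := one_add_log_rangeX_le hb
  have h3 := Real.log_natCast_nonneg (rangeX b)
  calc _ ≤ 2 * ell b / (ell b ^ 2 / 2) := by gcongr
    _ = _ := by field_simp; ring

/-- The normalised transfer error. -/
noncomputable def transferRatio (b : ℝ) : ℝ :=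
  transferErr (rangeX b) (levelD b) / (rangeX b * auxMass (rangeX b) (levelD b))

theorem inv_ell_le {b : ℝ} (hb : 1000 ≤ b) : 1 / ell b ≤ 1 / b ^ 2 := by
  gcongr
  exact (pow_le_pow_right₀ (by linarith) (by norm_num)).trans (pow_le_ell hb)

theorem tendsto_transferRatio : Tendsto transferRatio atTop (nhds 0) := by
  have h1 : Tendsto (fun b => Real.sqrt 3 * (Real.sqrt (auxMass (rangeX b) (levelD b)))⁻¹ + 5 * b⁻¹
      + (auxMass (rangeX b) (levelD b))⁻¹) atTop (nhds 0) := by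
    have h2 := (tendsto_inv_atTop_zero.comp (Real.tendsto_sqrt_atTop.comp tendsto_auxMass)).const_mul (Real.sqrt 3)
    have h3 := (tendsto_inv_atTop_zero (𝕜 := ℝ)).const_mul 5
    have h4 := tendsto_inv_atTop_zero.comp tendsto_auxMass
    simpa using (h2.add h3).add h4
  refine squeeze_zero' ?_ ?_ h1
  · filter_upwards with b
    unfold transferRatio transferErr
    have := auxMass_nonneg (rangeX b) (levelD b)
    positivity
  · filter_upwards [eventually_paramBounds] with b hP
    have hb := hP.large
    have hμ := hP.mass
    have hX : (0 : ℝ) < rangeX b := by exact_mod_cast one_le_rangeX hb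
    set μ := auxMass (rangeX b) (levelD b) with hμd
    have hμ0 : 0 < μ := by linarith
    have hs : Real.sqrt (3 * μ) = Real.sqrt 3 * Real.sqrt μ := Real.sqrt_mul (by norm_num) _
    have hs2 : Real.sqrt μ * Real.sqrt μ = μ := Real.mul_self_sqrt hμ0.le
    have hs0 : 0 < Real.sqrt μ := Real.sqrt_pos.mpr hμ0
    have hD : b ≤ levelD b := le_trans ((le_self_pow₀ (by linarith) (by norm_num)).trans (pow_le_ell hb))
      (ell_le_levelD hb)
    have e : transferRatio b = Real.sqrt 3 * (Real.sqrt μ)⁻¹ + 5 * (levelD b : ℝ)⁻¹ + μ⁻¹ := by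
      unfold transferRatio transferErr
      rw [← hμd, hs]
      have hD0 : (0 : ℝ) < levelD b := by linarith
      field_simp
      linear_combination (Real.sqrt 3 * levelD b) * hs2
    rw [e]
    gcongr

theorem inv_mul_sum_eq {η b s μ x : ℝ} (hη : 0 < η) (hb : 0 < b) (hs : 0 < s) (h : s * s = b) :
    (η * b ^ 2)⁻¹ * (μ * (x * 64) + x * μ * b + μ * (x * (216 * b * s)))
      = μ * (x * (η⁻¹ * (64 / b ^ 2 + 1 / b + 216 / s))) := by
  have e : 216 / s = 216 * s / b := by
    rw [div_eq_div_iff hs.ne' hb.ne', ← h]; ring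
  rw [e]
  field_simp

set_option maxHeartbeats 1000000 in
theorem card_bad_le {b η : ℝ} (hη : 0 < η) (hP : ParamBounds b) :
    (#{n ∈ Icc 1 (rangeX b) | 2 ≤ n ∧ (nStar (lowW b) (highZ b) n : ℝ) + η * b ^ 2 + 16 * b
        < (sP n).primeFactorsList.length} : ℝ) / rangeX b
      ≤ transferRatio b + 300 / b + η⁻¹ * (64 / b ^ 2 + 1 / b + 216 / Real.sqrt b) := by
  have hb := hP.large
  have hμ := hP.mass
  have hb0 : 0 < b := by linarith
  have hl := ell_ge hb
  have hX : (0 : ℝ) < rangeX b := by exact_mod_cast one_le_rangeX hb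
  set μ := auxMass (rangeX b) (levelD b) with hμd
  have hμ0 : 0 < μ := by linarith
  have hD0 := log_levelD_ge hb
  have hw2 := two_le_lowW hb
  have hwz := lowW_le_highZ hb
  have hwl := ell_le_lowW hb
  have hw0 : (0 : ℝ) < lowW b := by linarith
  have hc : 2 * Real.log (rangeX b) ≤ 16 * b * Real.log (levelD b).sqrt := by
    have h1 := log_sqrt_levelD_ge hb
    rw [div_le_iff₀ (by positivity)] at h1
    linarith [log_rangeX_le b]
  have hκ2 : ell b ^ 2 / 2 ≤ sqK b := half_le_floor (one_le_pow₀ (by linarith))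
  have hκl : ell b ≤ sqK b := by refine le_trans ?_ hκ2; nlinarith
  have hκ : 1 ≤ sqK b := by exact_mod_cast (by linarith : (1 : ℝ) ≤ sqK b)
  have key := auxMass_mul_card_bad_le (X := rangeX b) (lam := η * b ^ 2) (c := 16 * b) (by positivity)
    (two_le_levelD hb) (levelD_le_rangeX hb) (hw2.trans (hwz.trans (highZ_le_sqrt hb)))
    (by rw [pow_two]; exact Nat.sqrt_le _) hw2 hwz (lowW_pow_le hb) hκ (sqK_pow_le b) hc
  rw [← hμd] at key
  set B : ℝ := (#{n ∈ Icc 1 (rangeX b) | 2 ≤ n ∧ (nStar (lowW b) (highZ b) n : ℝ) + η * b ^ 2 + 16 * b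
        < (sP n).primeFactorsList.length} : ℝ) with hB
  have hE := large_sieve_err_le hb
  set E : ℝ := 4 * (rangeX b : ℝ) * (1 + Real.log (rangeX b)) ^ 3 / Real.sqrt (lowW b) with hEd
  have hil := inv_ell_le hb
  have hib : 1 / b ^ 2 ≤ 1 / b := by
    gcongr; exact le_self_pow₀ (by linarith) (by norm_num)
  have t1 : (rangeX b : ℝ) / sqK b + 2 * rangeX b * (1 + Real.log (rangeX b)) / lowW b ≤ rangeX b * (9 / b) := by
    have h1 := log_div_lowW_le hb
    have h2 : (rangeX b : ℝ) / sqK b ≤ rangeX b * (1 / ell b) := by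
      rw [mul_one_div]; gcongr
    have h3 : 2 * rangeX b * (1 + Real.log (rangeX b)) / lowW b = 2 * rangeX b * ((1 + Real.log (rangeX b)) / lowW b) := by
      ring
    have h4 : 2 * (rangeX b : ℝ) * ((1 + Real.log (rangeX b)) / lowW b) ≤ 2 * rangeX b * (4 / ell b) := by gcongr
    have h5 : (rangeX b : ℝ) * (1 / ell b) + 2 * rangeX b * (4 / ell b) = rangeX b * (9 * (1 / ell b)) := by ring
    have h6 : (rangeX b : ℝ) * (9 * (1 / ell b)) ≤ rangeX b * (9 * (1 / b)) :=
      mul_le_mul_of_nonneg_left (mul_le_mul_of_nonneg_left (hil.trans hib) (by norm_num)) hX.le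
    have h7 : 9 * (1 / b) = 9 / b := by ring
    rw [h7] at h6
    linarith
  have t3 : E ≤ rangeX b * (64 / b ^ 2) := by
    refine hE.trans ?_
    have : (rangeX b : ℝ) * (64 * (1 / ell b)) ≤ rangeX b * (64 * (1 / b ^ 2)) := by gcongr
    simpa only [mul_one_div] using this
  have tF : 9 * (rangeX b : ℝ) * (1 + Real.log (rangeX b)) / Real.log (levelD b) ≤ rangeX b * (36 * b) := by
    have h2 := one_add_log_rangeX_le hb
    have h3 := Real.log_natCast_nonneg (rangeX b)
    calc _ ≤ 9 * (rangeX b : ℝ) * (2 * ell b) / (ell b / (2 * b)) := by gcongr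
      _ = _ := by field_simp; ring
  have t4 : 9 * (rangeX b : ℝ) * (1 + Real.log (rangeX b)) / Real.log (levelD b) * (5 / (lowW b : ℝ) ^ 2)
      ≤ rangeX b * (180 / b) := by
    have h1 : 5 / (lowW b : ℝ) ^ 2 ≤ 5 / b ^ 2 := by
      gcongr
      exact ((le_self_pow₀ (by linarith) (by norm_num)).trans (pow_le_ell hb)).trans hwl
    calc _ ≤ rangeX b * (36 * b) * (5 / b ^ 2) := by gcongr
      _ = _ := by field_simp; ring
  have hw1 : 1 / (lowW b : ℝ) ≤ 1 / b := (one_div_le_one_div_of_le (by linarith) hwl).trans (hil.trans hib)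
  have hS1 := hP.small_sum
  have hS2 := hP.upper_sum
  have t5 : 9 * (rangeX b : ℝ) * (1 + Real.log (rangeX b)) / Real.log (levelD b)
      * (6 * ∑ r ∈ Icc 1 (lowW b) with r.Prime, (1 : ℝ) / r) ≤ rangeX b * (216 * b * Real.sqrt b) := by
    have : (0 : ℝ) ≤ ∑ r ∈ Icc 1 (lowW b) with r.Prime, (1 : ℝ) / r := sum_nonneg fun _ _ => by positivity
    calc _ ≤ rangeX b * (36 * b) * (6 * Real.sqrt b) := by gcongr
      _ = _ := by ring
  have hτ : transferErr (rangeX b) (levelD b) = μ * (rangeX b * transferRatio b) := by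
    unfold transferRatio
    rw [← hμd]; field_simp
  have hsb : Real.sqrt b * Real.sqrt b = b := Real.mul_self_sqrt hb0.le
  have hsb0 : 0 < Real.sqrt b := Real.sqrt_pos.mpr hb0
  have t6 : (η * b ^ 2)⁻¹ * ((E + rangeX b * μ * ∑ r ∈ midPrimes (highZ b) (levelD b).sqrt, (1 : ℝ) / r)
        + 9 * (rangeX b : ℝ) * (1 + Real.log (rangeX b)) / Real.log (levelD b)
      * (6 * ∑ r ∈ Icc 1 (lowW b) with r.Prime, (1 : ℝ) / r))
      ≤ μ * (rangeX b * (η⁻¹ * (64 / b ^ 2 + 1 / b + 216 / Real.sqrt b))) := by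
    have h1 : (rangeX b : ℝ) * 64 ≤ μ * (rangeX b * 64) := le_mul_of_one_le_left (by positivity) hμ
    have h2 : (rangeX b : ℝ) * (216 * b * Real.sqrt b) ≤ μ * (rangeX b * (216 * b * Real.sqrt b)) :=
      le_mul_of_one_le_left (by positivity) hμ
    have h3 : (rangeX b : ℝ) * μ * ∑ r ∈ midPrimes (highZ b) (levelD b).sqrt, (1 : ℝ) / r ≤ rangeX b * μ * b := by
      gcongr
    have h4 : E ≤ rangeX b * 64 := t3.trans (by
      gcongr
      exact div_le_self (by norm_num) (one_le_pow₀ (by linarith)))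
    calc _ ≤ (η * b ^ 2)⁻¹ * (μ * (rangeX b * 64) + rangeX b * μ * b + μ * (rangeX b * (216 * b * Real.sqrt b))) := by
          refine mul_le_mul_of_nonneg_left ?_ (by positivity)
          linarith
      _ = _ := inv_mul_sum_eq hη hb0 hsb0 hsb
  have u3 : E ≤ μ * (rangeX b * (64 / b)) := by
    refine t3.trans (le_trans ?_ (le_mul_of_one_le_left (by positivity) hμ))
    gcongr
    exact le_self_pow₀ (by linarith) (by norm_num)
  have u4 : 9 * (rangeX b : ℝ) * (1 + Real.log (rangeX b)) / Real.log (levelD b) * (5 / (lowW b : ℝ) ^ 2)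
      ≤ μ * (rangeX b * (180 / b)) := t4.trans (le_mul_of_one_le_left (by positivity) hμ)
  have u1 := mul_le_mul_of_nonneg_left t1 hμ0.le
  have u7 : (rangeX b : ℝ) * μ * (1 / lowW b) ≤ μ * (rangeX b * (1 / b)) := by
    calc _ ≤ (rangeX b : ℝ) * μ * (1 / b) := by gcongr
      _ = _ := by ring
  have hfin : μ * B ≤ μ * (rangeX b * (transferRatio b + 254 / b
      + η⁻¹ * (64 / b ^ 2 + 1 / b + 216 / Real.sqrt b))) := by
    have e : μ * (rangeX b * (transferRatio b + 254 / b + η⁻¹ * (64 / b ^ 2 + 1 / b + 216 / Real.sqrt b)))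
      = μ * (rangeX b * (9 / b)) + μ * (rangeX b * transferRatio b) + (μ * (rangeX b * (64 / b)) + μ * (rangeX b * (1 / b)))
        + μ * (rangeX b * (180 / b)) + μ * (rangeX b * (η⁻¹ * (64 / b ^ 2 + 1 / b + 216 / Real.sqrt b))) := by ring
    rw [e]
    rw [hτ] at key
    linarith
  have h1 := le_of_mul_le_mul_left hfin hμ0
  rw [div_le_iff₀ hX]
  refine h1.trans ?_
  rw [mul_comm]
  gcongr
  norm_num

theorem tendsto_card_bad {η : ℝ} (hη : 0 < η) :
    Tendsto (fun b => (#{n ∈ Icc 1 (rangeX b) | 2 ≤ n ∧ (nStar (lowW b) (highZ b) n : ℝ) + η * b ^ 2 + 16 * b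
        < (sP n).primeFactorsList.length} : ℝ) / rangeX b) atTop (nhds 0) := by
  have h1 : Tendsto (fun b : ℝ => transferRatio b + 300 / b + η⁻¹ * (64 / b ^ 2 + 1 / b + 216 / Real.sqrt b))
      atTop (nhds 0) := by
    have a1 : Tendsto (fun b : ℝ => 300 / b) atTop (nhds 0) := tendsto_const_nhds.div_atTop tendsto_id
    have a2 : Tendsto (fun b : ℝ => 64 / b ^ 2) atTop (nhds 0) :=
      tendsto_const_nhds.div_atTop (tendsto_pow_atTop two_ne_zero)
    have a3 : Tendsto (fun b : ℝ => 1 / b) atTop (nhds 0) := tendsto_const_nhds.div_atTop tendsto_id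
    have a4 : Tendsto (fun b : ℝ => 216 / Real.sqrt b) atTop (nhds 0) :=
      tendsto_const_nhds.div_atTop Real.tendsto_sqrt_atTop
    simpa using (tendsto_transferRatio.add a1).add (((a2.add a3).add a4).const_mul η⁻¹)
  refine squeeze_zero' (Eventually.of_forall fun b => by positivity) ?_ h1
  filter_upwards [eventually_paramBounds] with b hP using card_bad_le hη hP

theorem norm_prod_sub_prod_le {ι : Type*} (s : Finset ι) (f g : ι → ℂ) (hf : ∀ i ∈ s, ‖f i‖ ≤ 1)
    (hg : ∀ i ∈ s, ‖g i‖ ≤ 1) : ‖∏ i ∈ s, f i - ∏ i ∈ s, g i‖ ≤ ∑ i ∈ s, ‖f i - g i‖ := by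
  classical
  induction s using Finset.induction_on with
  | empty => simp
  | insert a s ha ih =>
    rw [prod_insert ha, prod_insert ha, sum_insert ha]
    have e : f a * ∏ i ∈ s, f i - g a * ∏ i ∈ s, g i
        = (f a - g a) * ∏ i ∈ s, g i + f a * (∏ i ∈ s, f i - ∏ i ∈ s, g i) := by ring
    rw [e]
    refine (norm_add_le _ _).trans ?_
    rw [norm_mul, norm_mul]
    have h1 := ih (fun i hi => hf i (mem_insert_of_mem hi)) (fun i hi => hg i (mem_insert_of_mem hi))
    have h2 := hf a (mem_insert_self a s)
    have h3 : ‖∏ i ∈ s, g i‖ ≤ 1 := by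
      rw [norm_prod]
      exact prod_le_one (fun _ _ => norm_nonneg _) fun i hi => hg i (mem_insert_of_mem hi)
    have h4 := mul_le_mul h2 h1 (norm_nonneg _) zero_le_one
    have h5 := mul_le_mul_of_nonneg_left h3 (norm_nonneg (f a - g a))
    linarith

/-- The increment `exp(it/b²) - 1`. -/
noncomputable def phase (t b : ℝ) : ℂ := Complex.exp (Complex.I * ((t / b ^ 2 : ℝ) : ℂ)) - 1

theorem one_add_phase (t b : ℝ) : 1 + phase t b = Complex.exp (Complex.I * ((t / b ^ 2 : ℝ) : ℂ)) := by
  unfold phase; ring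

theorem norm_one_add_phase (t b : ℝ) : ‖1 + phase t b‖ = 1 := by
  rw [one_add_phase, mul_comm]; exact Complex.norm_exp_ofReal_mul_I _

theorem norm_phase_le (t b : ℝ) : ‖phase t b‖ ≤ |t| / b ^ 2 := by
  have := Real.norm_exp_I_mul_ofReal_sub_one_le (x := t / b ^ 2)
  unfold phase
  refine this.trans (le_of_eq ?_)
  rw [Real.norm_eq_abs, abs_div, abs_of_nonneg (by positivity : 0 ≤ b ^ 2)]

theorem re_phase_nonpos (t b : ℝ) : (phase t b).re ≤ 0 := by
  have h := Complex.re_le_norm (1 + phase t b)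
  rw [norm_one_add_phase] at h
  simpa using h

theorem norm_prod_sub_exp_le {y : ℂ} (hy : ‖1 + y‖ = 1) (hy1 : ‖y‖ ≤ 1) (hre : y.re ≤ 0) {w z : ℕ}
    (hw : 0 < w) :
    ‖∏ r ∈ midPrimes w z, (1 + y / r) - Complex.exp (y * ((∑ r ∈ midPrimes w z, (1 : ℝ) / r : ℝ) : ℂ))‖
      ≤ 1 / w := by
  have e : Complex.exp (y * ((∑ r ∈ midPrimes w z, (1 : ℝ) / r : ℝ) : ℂ))
      = ∏ r ∈ midPrimes w z, Complex.exp (y / r) := by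
    rw [← Complex.exp_sum]; congr 1; push_cast; rw [mul_sum]
    exact sum_congr rfl fun r _ => by ring
  have hr : ∀ r ∈ midPrimes w z, w < r := fun r hr => (mem_midPrimes.mp hr).1.1
  rw [e]
  calc _ ≤ ∑ r ∈ midPrimes w z, ‖1 + y / r - Complex.exp (y / r)‖ := by
        refine norm_prod_sub_prod_le _ _ _ (fun r h => norm_one_add_div_le hy (by have := hr r h; omega))
          fun r h => ?_
        rw [Complex.norm_exp, Real.exp_le_one_iff, Complex.div_natCast_re]
        exact div_nonpos_of_nonpos_of_nonneg hre (Nat.cast_nonneg r)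
    _ ≤ ∑ r ∈ midPrimes w z, (1 : ℝ) / (r : ℝ) ^ 2 := by
        refine sum_le_sum fun r h => ?_
        have hr1 : (1 : ℝ) ≤ r := by exact_mod_cast (show 1 ≤ r by have := hr r h; omega)
        have hn : ‖y / r‖ ≤ 1 / r := by
          rw [norm_div, Complex.norm_natCast]; gcongr
        have h1 : ‖y / r‖ ≤ 1 := hn.trans (by rw [div_le_one (by linarith)]; exact hr1)
        have := Complex.norm_exp_sub_one_sub_id_le h1
        rw [norm_sub_rev, show Complex.exp (y / r) - (1 + y / r) = Complex.exp (y / r) - 1 - y / r by ring]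
        calc _ ≤ ‖y / r‖ ^ 2 := this
          _ ≤ (1 / r) ^ 2 := by gcongr
          _ = _ := by rw [div_pow, one_pow]
    _ ≤ ∑ r ∈ Ioc w z, (1 : ℝ) / (r : ℝ) ^ 2 :=
        sum_le_sum_of_subset_of_nonneg (filter_subset _ _) fun _ _ _ => by positivity
    _ ≤ 1 / w := sum_inv_sq_gt_le w z hw

theorem prod_one_add_le_exp_mul {c : ℝ} (hc : 0 ≤ c) (s : Finset ℕ) :
    ∏ r ∈ s, (1 + c / r) ≤ Real.exp (c * ∑ r ∈ s, (1 : ℝ) / r) := by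
  rw [mul_sum, Real.exp_sum]
  refine prod_le_prod (fun _ _ => by positivity) fun r _ => ?_
  have := Real.add_one_le_exp (c * (1 / (r : ℝ)))
  calc _ = c * (1 / (r : ℝ)) + 1 := by ring
    _ ≤ _ := this

theorem half_pow_truncK_le {b : ℝ} : (1 / 2 : ℝ) ^ truncK b ≤ 2 * Real.exp (-(b ^ 3 / 2)) := by
  have h1 : (1 / 2 : ℝ) ≤ Real.exp (-(1 / 2)) := by
    rw [Real.exp_neg, one_div]
    gcongr
    have h : Real.exp (1 / 2) ^ 2 = Real.exp 1 := by rw [← Real.exp_nat_mul]; norm_num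
    nlinarith [Real.exp_one_lt_d9, Real.exp_pos (1 / 2)]
  have h2 : b ^ 3 - 1 ≤ truncK b := (Nat.sub_one_lt_floor _).le
  have h3 : Real.exp (1 / 2) ≤ 2 := by
    have := one_div_le_one_div_of_le (by norm_num) h1
    rw [Real.exp_neg] at this
    simpa using this
  calc _ ≤ Real.exp (-(1 / 2)) ^ truncK b := by gcongr
    _ = Real.exp (truncK b * (-(1 / 2))) := by rw [← Real.exp_nat_mul]
    _ ≤ Real.exp (1 / 2 + -(b ^ 3 / 2)) := by gcongr; linarith
    _ = Real.exp (1 / 2) * Real.exp (-(b ^ 3 / 2)) := Real.exp_add _ _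
    _ ≤ _ := by gcongr

theorem norm_mean_sub_prod_le {b t : ℝ} (hP : ParamBounds b) (ht : 8 * |t| + 4 ≤ b) :
    ‖(∑ n ∈ Icc 1 (rangeX b), (1 + phase t b) ^ nStar (lowW b) (highZ b) n) / rangeX b
      - ∏ r ∈ midPrimes (lowW b) (highZ b), (1 + phase t b / r)‖ ≤ 2 * transferRatio b + 96 / b ^ 2
        + 4 * Real.exp (-b) := by
  have hb := hP.large
  have hμ := hP.mass
  have hX : (0 : ℝ) < rangeX b := by exact_mod_cast one_le_rangeX hb
  have hw : 0 < lowW b := by have := two_le_lowW hb; omega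
  have hy := norm_phase_le t b
  have hy1 : ‖phase t b‖ ≤ 1 := by
    refine hy.trans ?_
    rw [div_le_one (by positivity)]
    nlinarith [abs_nonneg t]
  have key := norm_sum_pow_nStar_sub_le (norm_one_add_phase t b) hy1 (two_le_levelD hb) (levelD_le_rangeX hb)
    hw (highZ_pow_le hb)
  set μ := auxMass (rangeX b) (levelD b) with hμd
  set A := ∑ n ∈ Icc 1 (rangeX b), (1 + phase t b) ^ nStar (lowW b) (highZ b) n
  set Z := ∏ r ∈ midPrimes (lowW b) (highZ b), (1 + phase t b / r)
  set y := phase t b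
  have hS := hP.main_sum
  set S := ∑ r ∈ midPrimes (lowW b) (highZ b), (1 : ℝ) / r
  have hprod : (1 / 2 : ℝ) ^ truncK b * ∏ r ∈ midPrimes (lowW b) (highZ b), (1 + 2 * ‖y‖ / r)
      ≤ 2 * Real.exp (-b) := by
    have h1 := prod_one_add_le_exp_mul (c := 2 * ‖y‖) (by positivity) (midPrimes (lowW b) (highZ b))
    have h2 : S ≤ 2 * b ^ 4 := by
      have := (abs_le.mp hS).2
      have : b ≤ b ^ 4 := le_self_pow₀ (by linarith) (by norm_num)
      linarith
    have hS0 : 0 ≤ S := sum_nonneg fun _ _ => by positivity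
    have h3 : 2 * ‖y‖ * S ≤ 4 * |t| * b ^ 2 := by
      calc _ ≤ 2 * (|t| / b ^ 2) * (2 * b ^ 4) := by gcongr
        _ = _ := by field_simp; ring
    calc _ ≤ 2 * Real.exp (-(b ^ 3 / 2)) * Real.exp (4 * |t| * b ^ 2) := by
          gcongr
          · exact half_pow_truncK_le
          · exact h1.trans (by gcongr)
      _ = 2 * Real.exp (-(b ^ 3 / 2) + 4 * |t| * b ^ 2) := by rw [Real.exp_add]; ring
      _ ≤ _ := by
        gcongr
        have h5 : 0 ≤ b ^ 2 * (b - (8 * |t| + 4)) := by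
          have : 0 ≤ b - (8 * |t| + 4) := by linarith
          positivity
        nlinarith
  have hls := large_sieve_err_le hb
  have hlw := log_div_lowW_le hb
  have hie := inv_ell_le hb
  have hlog : 8 * Real.log (rangeX b) / lowW b ≤ 32 / ell b := by
    have : (0 : ℝ) ≤ 1 / lowW b := by positivity
    calc _ = 8 * ((1 + Real.log (rangeX b)) / lowW b - 1 / lowW b) := by ring
      _ ≤ 8 * (4 / ell b) := by linarith
      _ = _ := by ring
  have hell : 0 < ell b := Real.exp_pos _
  have hT : transferErr (rangeX b) (levelD b) = transferRatio b * (rangeX b * μ) := by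
    unfold transferRatio; rw [← hμd]; field_simp
  have e : A / rangeX b - Z = (A - rangeX b * Z) / rangeX b := by
    have : (rangeX b : ℂ) ≠ 0 := by exact_mod_cast hX.ne'
    field_simp
  rw [e, norm_div, Complex.norm_natCast, div_le_iff₀ hX]
  refine le_of_mul_le_mul_left (key.trans ?_) (by linarith : 0 < μ)
  have h6 : (rangeX b : ℝ) * (64 / ell b) ≤ μ * (rangeX b * (64 / ell b)) :=
    le_mul_of_one_le_left (by positivity) hμ
  have h7 : (rangeX b : ℝ) * μ * (2 * ((1 / 2 : ℝ) ^ truncK b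
      * ∏ r ∈ midPrimes (lowW b) (highZ b), (1 + 2 * ‖y‖ / r)) + 8 * Real.log (rangeX b) / lowW b)
      ≤ rangeX b * μ * (2 * (2 * Real.exp (-b)) + 32 / ell b) := by gcongr
  have h8 : (rangeX b : ℝ) * μ * (96 * (1 / ell b)) ≤ rangeX b * μ * (96 * (1 / b ^ 2)) := by gcongr
  calc _ ≤ 2 * (transferRatio b * (rangeX b * μ)) + μ * (rangeX b * (64 / ell b))
        + rangeX b * μ * (2 * (2 * Real.exp (-b)) + 32 / ell b) := by rw [hT]; linarith
    _ = 2 * (transferRatio b * (rangeX b * μ)) + rangeX b * μ * (96 * (1 / ell b))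
        + rangeX b * μ * (4 * Real.exp (-b)) := by ring
    _ ≤ 2 * (transferRatio b * (rangeX b * μ)) + rangeX b * μ * (96 * (1 / b ^ 2))
        + rangeX b * μ * (4 * Real.exp (-b)) := by gcongr
    _ = _ := by ring

theorem norm_phase_mul_sub_le {t b : ℝ} (hb : 1 ≤ b) (ht : |t| ≤ b) :
    ‖phase t b * ((b ^ 4 : ℝ) : ℂ) - Complex.I * ((t * b ^ 2 : ℝ) : ℂ) + ((t ^ 2 / 2 : ℝ) : ℂ)‖
      ≤ 3 * |t| ^ 3 / b ^ 2 := by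
  have hb0 : (b : ℂ) ≠ 0 := by exact_mod_cast (by linarith : b ≠ 0)
  set v : ℂ := Complex.I * ((t / b ^ 2 : ℝ) : ℂ) with hv
  have hvn : ‖v‖ = |t| / b ^ 2 := by
    rw [hv, norm_mul, Complex.norm_I, one_mul, Complex.norm_real, Real.norm_eq_abs, abs_div,
      abs_of_nonneg (by positivity : 0 ≤ b ^ 2)]
  have h := Complex.norm_exp_sub_sum_le_norm_mul_exp v 3
  have hv1 : ‖v‖ ≤ 1 := by
    rw [hvn, div_le_one (by positivity)]
    nlinarith
  have hexp : Real.exp ‖v‖ ≤ 3 := (Real.exp_le_exp.mpr hv1).trans (by linarith [Real.exp_one_lt_d9])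
  have e : phase t b * ((b ^ 4 : ℝ) : ℂ) - Complex.I * ((t * b ^ 2 : ℝ) : ℂ) + ((t ^ 2 / 2 : ℝ) : ℂ)
      = (Complex.exp v - ∑ m ∈ range 3, v ^ m / m.factorial) * ((b ^ 4 : ℝ) : ℂ) := by
    simp only [sum_range_succ, range_zero, sum_empty, Nat.factorial, phase, ← hv]
    have hv2 : v ^ 2 = -((t : ℂ) / b ^ 2) ^ 2 := by
      rw [hv, mul_pow, Complex.I_sq]; push_cast; ring
    rw [hv2, hv]
    push_cast
    field_simp
    ring
  rw [e, norm_mul, Complex.norm_real, Real.norm_eq_abs, abs_of_nonneg (by positivity : 0 ≤ b ^ 4)]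
  calc _ ≤ ‖v‖ ^ 3 * 3 * b ^ 4 := by
        gcongr
        exact h.trans (by gcongr)
    _ = _ := by rw [hvn]; field_simp

open Classical in
theorem tendsto_mean_exp (t : ℝ) : Tendsto (fun b : ℝ => (∑ n ∈ Icc 1 (rangeX b),
      Complex.exp (((t * ((nStar (lowW b) (highZ b) n - b ^ 4) / b ^ 2) : ℝ) : ℂ) * Complex.I)) / rangeX b)
    atTop (nhds (Complex.exp (-(t : ℂ) ^ 2 / 2))) := by
  set S : ℝ → ℝ := fun b => ∑ r ∈ midPrimes (lowW b) (highZ b), (1 : ℝ) / r with hS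
  set E : ℝ → ℂ := fun b => Complex.exp (-(Complex.I * ((t * b ^ 2 : ℝ) : ℂ))) with hE
  have hEn : ∀ b, ‖E b‖ = 1 := fun b => by
    rw [hE]
    simp only
    rw [show -(Complex.I * ((t * b ^ 2 : ℝ) : ℂ)) = ((-(t * b ^ 2) : ℝ) : ℂ) * Complex.I by push_cast; ring]
    exact Complex.norm_exp_ofReal_mul_I _
  set M : ℝ → ℂ := fun b => (∑ n ∈ Icc 1 (rangeX b), (1 + phase t b) ^ nStar (lowW b) (highZ b) n) / rangeX b
  set Z : ℝ → ℂ := fun b => ∏ r ∈ midPrimes (lowW b) (highZ b), (1 + phase t b / r)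
  have hinv2 : Tendsto (fun b : ℝ => 1 / b ^ 2) atTop (nhds 0) := by
    simpa [Function.comp_def] using tendsto_inv_atTop_zero.comp
      (tendsto_pow_atTop (α := ℝ) (n := 2) (by norm_num))
  have hev : ∀ᶠ b : ℝ in atTop, 8 * |t| + 4 ≤ b := eventually_ge_atTop _
  have h1 : Tendsto (fun b => (M b - Z b) * E b) atTop (nhds 0) := by
    have hlim : Tendsto (fun b : ℝ => 2 * transferRatio b + 96 * (1 / b ^ 2) + 4 * Real.exp (-b)) atTop (nhds 0) := by
      simpa using ((tendsto_transferRatio.const_mul 2).add (hinv2.const_mul 96)).add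
        ((Real.tendsto_exp_neg_atTop_nhds_zero).const_mul 4)
    refine squeeze_zero_norm' ?_ hlim
    filter_upwards [eventually_paramBounds, hev] with b hP ht
    rw [norm_mul, hEn, mul_one]
    refine (norm_mean_sub_prod_le hP ht).trans (le_of_eq (by ring))
  have h2 : Tendsto (fun b => (Z b - Complex.exp (phase t b * (S b : ℂ))) * E b) atTop (nhds 0) := by
    refine squeeze_zero_norm' ?_ hinv2
    filter_upwards [eventually_paramBounds, hev] with b hP ht
    have hb := hP.large
    rw [norm_mul, hEn, mul_one]
    have hy1 : ‖phase t b‖ ≤ 1 := by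
      refine (norm_phase_le t b).trans ?_
      rw [div_le_one (by positivity)]
      nlinarith [abs_nonneg t]
    have hw : 0 < lowW b := by have := two_le_lowW hb; omega
    refine (norm_prod_sub_exp_le (norm_one_add_phase t b) hy1 (re_phase_nonpos t b) hw).trans ?_
    refine le_trans ?_ (inv_ell_le hb)
    have := ell_le_lowW hb
    have hell : 0 < ell b := Real.exp_pos _
    gcongr
  have h3 : Tendsto (fun b => phase t b * (S b : ℂ) - Complex.I * ((t * b ^ 2 : ℝ) : ℂ)) atTop
      (nhds (-(t : ℂ) ^ 2 / 2)) := by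
    rw [tendsto_iff_norm_sub_tendsto_zero]
    have hlim : Tendsto (fun b : ℝ => |t| * b⁻¹ + 3 * |t| ^ 3 * (1 / b ^ 2)) atTop (nhds 0) := by
      simpa using (tendsto_inv_atTop_zero.const_mul |t|).add (hinv2.const_mul (3 * |t| ^ 3))
    refine squeeze_zero' (Eventually.of_forall fun _ => norm_nonneg _) ?_ hlim
    filter_upwards [eventually_paramBounds, hev] with b hP ht
    have hb := hP.large
    have e : phase t b * (S b : ℂ) - Complex.I * ((t * b ^ 2 : ℝ) : ℂ) - -(t : ℂ) ^ 2 / 2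
        = phase t b * ((S b - b ^ 4 : ℝ) : ℂ) + (phase t b * ((b ^ 4 : ℝ) : ℂ)
          - Complex.I * ((t * b ^ 2 : ℝ) : ℂ) + ((t ^ 2 / 2 : ℝ) : ℂ)) := by push_cast; ring
    rw [e]
    refine (norm_add_le _ _).trans (add_le_add ?_ ?_)
    · rw [norm_mul, Complex.norm_real, Real.norm_eq_abs]
      calc _ ≤ |t| / b ^ 2 * b := by
            gcongr
            · exact norm_phase_le t b
            · exact hP.main_sum
        _ = _ := by field_simp
    · refine (norm_phase_mul_sub_le (by linarith) (by linarith [abs_nonneg t])).trans (le_of_eq (by ring))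
  have h4 := (Complex.continuous_exp.tendsto _).comp h3
  have h5 := (h1.add h2).add h4
  simp only [zero_add] at h5
  refine h5.congr' ?_
  filter_upwards [eventually_paramBounds] with b hP
  have hb0 : (b : ℂ) ≠ 0 := by exact_mod_cast (by linarith [hP.large] : b ≠ 0)
  simp only [Function.comp]
  rw [sub_eq_add_neg (phase t b * (S b : ℂ)), Complex.exp_add, ← sub_eq_zero]
  have : (∑ n ∈ Icc 1 (rangeX b),
      Complex.exp (((t * ((nStar (lowW b) (highZ b) n - b ^ 4) / b ^ 2) : ℝ) : ℂ) * Complex.I)) / rangeX b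
      = M b * E b := by
    simp only [M]
    rw [div_mul_eq_mul_div, sum_mul]
    congr 1
    refine sum_congr rfl fun n _ => ?_
    rw [one_add_phase, ← Complex.exp_nat_mul, hE, ← Complex.exp_add]
    congr 1
    push_cast
    field_simp
    ring
  rw [this]
  simp only [hE]
  ring

open MeasureTheory ProbabilityTheory in
/-- The law of `f` under the uniform measure on `s`. -/
noncomputable def empiricalLaw (s : Finset ℕ) (f : ℕ → ℝ) : Measure ℝ :=
  (#s : ENNReal)⁻¹ • ∑ n ∈ s, Measure.dirac (f n)

open MeasureTheory in
theorem isProbabilityMeasure_empiricalLaw {s : Finset ℕ} (hs : s.Nonempty) (f : ℕ → ℝ) :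
    IsProbabilityMeasure (empiricalLaw s f) := by
  constructor
  simp only [empiricalLaw, Measure.smul_apply, Measure.finsetSum_apply, measure_univ, sum_const,
    smul_eq_mul, nsmul_eq_mul, mul_one]
  exact ENNReal.inv_mul_cancel (by simpa using hs.ne_empty) (by simp)

open MeasureTheory in
theorem charFun_empiricalLaw (s : Finset ℕ) (f : ℕ → ℝ) (t : ℝ) :
    charFun (empiricalLaw s f) t = (∑ n ∈ s, Complex.exp (((t * f n : ℝ) : ℂ) * Complex.I)) / #s := by
  rw [charFun_apply, empiricalLaw, integral_smul_measure, integral_finsetSum_measure]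
  · simp [div_eq_inv_mul]
  · intro n _
    exact integrable_dirac (by simp [enorm_lt_top])

open MeasureTheory in
theorem empiricalLaw_Iic (s : Finset ℕ) (f : ℕ → ℝ) (v : ℝ) :
    (empiricalLaw s f (Set.Iic v)).toReal = (#{n ∈ s | f n ≤ v} : ℝ) / #s := by
  classical
  rw [empiricalLaw]
  simp only [Measure.smul_apply, Measure.finsetSum_apply, Measure.dirac_apply' _ measurableSet_Iic,
    smul_eq_mul]
  simp only [Set.indicator_apply, Set.mem_Iic, Pi.one_apply, sum_boole]
  rw [ENNReal.toReal_mul]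
  simp [div_eq_inv_mul]

/-- The standard normal distribution function. -/
noncomputable def normalCDF (u : ℝ) : ℝ :=
  (Real.sqrt (2 * Real.pi))⁻¹ * ∫ t in Set.Iic u, Real.exp (-t ^ 2 / 2)

open MeasureTheory ProbabilityTheory in
theorem gaussianReal_Iic_toReal (u : ℝ) : (gaussianReal 0 1 (Set.Iic u)).toReal = normalCDF u := by
  rw [gaussianReal_apply_eq_integral 0 one_ne_zero, ENNReal.toReal_ofReal
    (setIntegral_nonneg measurableSet_Iic fun x _ => gaussianPDFReal_nonneg 0 1 x), normalCDF,
    ← integral_const_mul]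
  simp [gaussianPDFReal]

open MeasureTheory ProbabilityTheory in
theorem tendsto_card_nStar (v : ℝ) : Tendsto (fun b : ℝ =>
    (#{n ∈ Icc 1 (rangeX b) | ((nStar (lowW b) (highZ b) n : ℝ) - b ^ 4) / b ^ 2 ≤ v} : ℝ) / rangeX b)
    atTop (nhds (normalCDF v)) := by
  refine tendsto_of_seq_tendsto fun c hc => ?_
  let F : ℝ → ℕ → ℝ := fun b n => ((nStar (lowW b) (highZ b) n : ℝ) - b ^ 4) / b ^ 2
  have hne : ∀ b, (Icc 1 (rangeX b)).Nonempty := fun b => by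
    rw [nonempty_Icc]
    exact Nat.floor_pos.mpr (Real.one_le_exp (Real.exp_pos _).le)
  let μ : ℕ → ProbabilityMeasure ℝ := fun k =>
    ⟨empiricalLaw (Icc 1 (rangeX (c k))) (F (c k)), isProbabilityMeasure_empiricalLaw (hne _) _⟩
  let μ₀ : ProbabilityMeasure ℝ := ⟨gaussianReal 0 1, inferInstance⟩
  have hμ : Tendsto μ atTop (nhds μ₀) := by
    refine ProbabilityMeasure.tendsto_of_tendsto_charFun fun t => ?_
    have h := (tendsto_mean_exp t).comp hc
    have e : charFun (μ₀ : Measure ℝ) t = Complex.exp (-(t : ℂ) ^ 2 / 2) := by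
      change charFun (gaussianReal 0 1) t = _
      rw [charFun_gaussianReal]
      congr 1
      simp
      ring
    rw [e]
    refine h.congr fun k => ?_
    change _ = charFun (empiricalLaw (Icc 1 (rangeX (c k))) (F (c k))) t
    rw [charFun_empiricalLaw]
    simp [F, Function.comp]
  have hfr : (μ₀ : Measure ℝ) (frontier (Set.Iic v)) = 0 := by
    rw [frontier_Iic]
    change gaussianReal 0 1 {v} = 0
    have := nullSingletonClass_gaussianReal (μ := 0) (v := 1) one_ne_zero
    exact measure_singleton v
  have h := ProbabilityMeasure.tendsto_measure_of_null_frontier_of_tendsto' hμ hfr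
  have h2 := (ENNReal.tendsto_toReal (measure_ne_top (μ₀ : Measure ℝ) (Set.Iic v))).comp h
  rw [show ((μ₀ : Measure ℝ) (Set.Iic v)).toReal = normalCDF v from gaussianReal_Iic_toReal v] at h2
  refine h2.congr fun k => ?_
  change (empiricalLaw (Icc 1 (rangeX (c k))) (F (c k)) (Set.Iic v)).toReal = _
  rw [empiricalLaw_Iic]
  simp [F]

open MeasureTheory ProbabilityTheory in
theorem continuous_normalCDF : Continuous normalCDF := by
  have hgauss : Integrable (fun t : ℝ => Real.exp (-t ^ 2 / 2)) := by
    have := integrable_exp_neg_mul_sq (b := 1 / 2) (by norm_num)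
    refine this.congr (Eventually.of_forall fun t => ?_)
    simp only
    congr 1
    ring
  refine continuous_const.mul ?_
  have h : ∀ u : ℝ, ∫ t in Set.Iic u, Real.exp (-t ^ 2 / 2)
      = (∫ t in Set.Iic (0 : ℝ), Real.exp (-t ^ 2 / 2)) + ∫ t in (0 : ℝ)..u, Real.exp (-t ^ 2 / 2) := fun u => by
    rw [← intervalIntegral.integral_Iic_sub_Iic hgauss.integrableOn hgauss.integrableOn]; ring
  rw [show (fun u : ℝ => ∫ t in Set.Iic u, Real.exp (-t ^ 2 / 2)) = _ from funext h]
  exact continuous_const.add (intervalIntegral.continuous_primitive (fun a b => hgauss.intervalIntegrable) 0)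

theorem nStar_le_length {n : ℕ} (hn : 2 ≤ n) (w z : ℕ) : nStar w z n ≤ (sP n).primeFactorsList.length := by
  have h0 := (sP_pos hn).ne'
  calc nStar w z n ≤ #(sP n).primeFactors := by
        refine card_le_card fun r hr => ?_
        rw [mem_filter, mem_midPrimes] at hr
        exact Nat.mem_primeFactors.mpr ⟨hr.1.2, hr.2.1, h0⟩
    _ ≤ _ := List.toFinset_card_le _

/-- The Gaussian law for `Ω(s(n))` along the parametrisation `b = (log log x)^(1/4)`. -/
theorem tendsto_card_length (u : ℝ) : Tendsto (fun b : ℝ =>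
    (#{n ∈ Icc 2 (rangeX b) | ((sP n).primeFactorsList.length : ℝ) - b ^ 4 ≤ u * b ^ 2} : ℝ) / rangeX b)
    atTop (nhds (normalCDF u)) := by
  rw [Metric.tendsto_atTop']
  intro ε hε
  obtain ⟨δ, hδ, hcont⟩ := Metric.continuous_iff.mp continuous_normalCDF u (ε / 4) (by linarith)
  set η := δ / 4 with hη
  have hη0 : 0 < η := by positivity
  set v := u - 2 * η with hv
  have hvu : |normalCDF v - normalCDF u| < ε / 4 := by
    refine hcont v ?_
    rw [Real.dist_eq, hv, hη, show u - 2 * (δ / 4) - u = -(δ / 2) by ring, abs_neg, abs_of_pos (by linarith)]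
    linarith
  have e1 := (Metric.tendsto_nhds.mp (tendsto_card_nStar u)) (ε / 4) (by linarith)
  have e2 := (Metric.tendsto_nhds.mp (tendsto_card_nStar v)) (ε / 4) (by linarith)
  have e3 := (Metric.tendsto_nhds.mp (tendsto_card_bad hη0)) (ε / 4) (by linarith)
  have e4 : Tendsto (fun b : ℝ => 1 / b) atTop (nhds 0) := by simpa using tendsto_inv_atTop_zero (𝕜 := ℝ)
  have e4 := (Metric.tendsto_nhds.mp e4) (ε / 4) (by linarith)
  have hall : ∀ᶠ b : ℝ in atTop, dist ((#{n ∈ Icc 2 (rangeX b) |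
      ((sP n).primeFactorsList.length : ℝ) - b ^ 4 ≤ u * b ^ 2} : ℝ) / rangeX b) (normalCDF u) < ε := by
    filter_upwards [e1, e2, e3, e4, eventually_ge_atTop 1000, eventually_ge_atTop (16 / η)]
      with b h1 h2 h3 h4 hb hbη
    have hX : (0 : ℝ) < rangeX b := by exact_mod_cast one_le_rangeX hb
    have hXb : b ≤ rangeX b := by
      have hl1 := ell_le_levelD hb
      have hl2 : (levelD b : ℝ) ≤ rangeX b := by exact_mod_cast levelD_le_rangeX hb
      have hl3 : b ≤ b ^ 20 := le_self_pow₀ (by linarith) (by norm_num)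
      linarith [pow_le_ell hb]
    have hb2 : 0 < b ^ 2 := by positivity
    have h16 : 16 * b ≤ η * b ^ 2 := by
      rw [div_le_iff₀ hη0] at hbη
      nlinarith
    rw [Real.dist_eq] at h1 h2 h3 h4 ⊢
    have hup : (#{n ∈ Icc 2 (rangeX b) | ((sP n).primeFactorsList.length : ℝ) - b ^ 4 ≤ u * b ^ 2} : ℝ)
        / rangeX b ≤ (#{n ∈ Icc 1 (rangeX b) |
          ((nStar (lowW b) (highZ b) n : ℝ) - b ^ 4) / b ^ 2 ≤ u} : ℝ) / rangeX b := by
      gcongr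
      intro n hn
      rw [mem_filter, mem_Icc] at hn ⊢
      refine ⟨⟨by omega, hn.1.2⟩, ?_⟩
      rw [div_le_iff₀ hb2]
      have : (nStar (lowW b) (highZ b) n : ℝ) ≤ (sP n).primeFactorsList.length := by
        exact_mod_cast nStar_le_length hn.1.1 _ _
      linarith [hn.2]
    have hlo : (#{n ∈ Icc 1 (rangeX b) | ((nStar (lowW b) (highZ b) n : ℝ) - b ^ 4) / b ^ 2 ≤ v} : ℝ) / rangeX b
        ≤ (#{n ∈ Icc 2 (rangeX b) | ((sP n).primeFactorsList.length : ℝ) - b ^ 4 ≤ u * b ^ 2} : ℝ) / rangeX b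
          + (#{n ∈ Icc 1 (rangeX b) | 2 ≤ n ∧ (nStar (lowW b) (highZ b) n : ℝ) + η * b ^ 2 + 16 * b
            < (sP n).primeFactorsList.length} : ℝ) / rangeX b + 1 / b := by
      have hsub : {n ∈ Icc 1 (rangeX b) | ((nStar (lowW b) (highZ b) n : ℝ) - b ^ 4) / b ^ 2 ≤ v}
          ⊆ ({n ∈ Icc 2 (rangeX b) | ((sP n).primeFactorsList.length : ℝ) - b ^ 4 ≤ u * b ^ 2}
            ∪ {n ∈ Icc 1 (rangeX b) | 2 ≤ n ∧ (nStar (lowW b) (highZ b) n : ℝ) + η * b ^ 2 + 16 * b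
            < (sP n).primeFactorsList.length}) ∪ {1} := by
        intro n hn
        rw [mem_filter, mem_Icc, div_le_iff₀ hb2] at hn
        simp only [mem_union, mem_filter, mem_Icc, mem_singleton]
        by_cases hn1 : n = 1
        · exact Or.inr hn1
        refine Or.inl ?_
        by_cases hbad : (nStar (lowW b) (highZ b) n : ℝ) + η * b ^ 2 + 16 * b < (sP n).primeFactorsList.length
        · exact Or.inr ⟨hn.1, by omega, hbad⟩
        · refine Or.inl ⟨⟨by omega, hn.1.2⟩, ?_⟩
          push Not at hbad
          have h5 := hn.2
          rw [hv] at h5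
          linarith
      have hc := (card_le_card hsub).trans ((card_union_le _ _).trans (Nat.add_le_add_right (card_union_le _ _) _))
      rw [card_singleton] at hc
      have hc' : (#{n ∈ Icc 1 (rangeX b) | ((nStar (lowW b) (highZ b) n : ℝ) - b ^ 4) / b ^ 2 ≤ v} : ℝ)
          ≤ #{n ∈ Icc 2 (rangeX b) | ((sP n).primeFactorsList.length : ℝ) - b ^ 4 ≤ u * b ^ 2}
            + #{n ∈ Icc 1 (rangeX b) | 2 ≤ n ∧ (nStar (lowW b) (highZ b) n : ℝ) + η * b ^ 2 + 16 * b
            < (sP n).primeFactorsList.length} + 1 := by exact_mod_cast hc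
      have h6 : 1 / (rangeX b : ℝ) ≤ 1 / b := one_div_le_one_div_of_le (by linarith) hXb
      calc _ ≤ _ := div_le_div_of_nonneg_right hc' hX.le
        _ = _ + _ + 1 / (rangeX b : ℝ) := by rw [add_div, add_div]
        _ ≤ _ := by gcongr
    rw [abs_lt] at h1 h2 h3 h4 hvu ⊢
    constructor <;> linarith [h1.1, h1.2, h2.1, h2.2, h3.2, h4.2, hvu.1, hvu.2]
  obtain ⟨B, hB⟩ := eventually_atTop.mp hall
  exact ⟨B, fun b hb => hB b hb.le⟩

end ErdosKacS

/-- Erdős–Kac law for Ω(s(n)): prime factors counted with multiplicity,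
where s(n) = σ(n) − n is the sum of proper divisors. -/
theorem erdosKac_bigOmega_sum_proper_divisors (u : ℝ) :
    Tendsto (fun x : ℝ =>
      (((Finset.Icc 2 ⌊x⌋₊).filter (fun n : ℕ =>
        ((((∑ d ∈ n.properDivisors, d).primeFactorsList.length : ℝ) : ℝ)) - Real.log (Real.log x)
          ≤ u * Real.sqrt (Real.log (Real.log x)))).card : ℝ) / x)
      atTop
      (nhds ((Real.sqrt (2 * Real.pi))⁻¹ * ∫ t in Set.Iic u, Real.exp (-t ^ 2 / 2))) := by
  have hll : Tendsto (fun x : ℝ => Real.log (Real.log x)) atTop atTop :=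
    Real.tendsto_log_atTop.comp Real.tendsto_log_atTop
  have hb : Tendsto (fun x : ℝ => Real.sqrt (Real.sqrt (Real.log (Real.log x)))) atTop atTop :=
    Real.tendsto_sqrt_atTop.comp (Real.tendsto_sqrt_atTop.comp hll)
  have h1 := (ErdosKacS.tendsto_card_length u).comp hb
  have h2 : Tendsto (fun x : ℝ => (⌊x⌋₊ : ℝ) / x) atTop (nhds 1) := tendsto_nat_floor_div_atTop
  have h3 := h1.mul h2
  rw [mul_one] at h3
  refine h3.congr' ?_
  filter_upwards [eventually_gt_atTop (1 : ℝ), Real.tendsto_log_atTop.eventually_gt_atTop 1,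
    hll.eventually_ge_atTop 0] with x hx hlx hllx
  set L := Real.log (Real.log x) with hL
  have hs2 : Real.sqrt (Real.sqrt L) ^ 2 = Real.sqrt L := Real.sq_sqrt (Real.sqrt_nonneg _)
  have hs4 : Real.sqrt (Real.sqrt L) ^ 4 = L := by
    rw [show Real.sqrt (Real.sqrt L) ^ 4 = (Real.sqrt (Real.sqrt L) ^ 2) ^ 2 by ring, hs2, Real.sq_sqrt hllx]
  have hr : ErdosKacS.rangeX (Real.sqrt (Real.sqrt L)) = ⌊x⌋₊ := by
    rw [ErdosKacS.rangeX, ErdosKacS.ell, hs4, hL, Real.exp_log (by linarith), Real.exp_log (by linarith)]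
  have hfl : (0 : ℝ) < ⌊x⌋₊ := by exact_mod_cast Nat.floor_pos.mpr hx.le
  simp only [Function.comp, ← hL, hs2, hs4, hr, ErdosKacS.sP]
  field_simp
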